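/- For every M ≥ 1 there exist constants c(M) > 0 and C(M) > 0 with the following property. Let ε > 0, 0 < T ≤ c(M)·ε^{-3}, and let u be a KdV solution on (0,T] such that for every t ∈ (0,T]: ‖u(t,·)‖_{B^{-1/2,ε}_{2,∞}} ≤ ε, the bootstrap bounds with constants M, ε hold at time t, and ‖L^{NL}u(t)‖_{Ḣ^{1/2}} ≤ M·ε. Then there exist smooth functions w₁, f₁ : (0,T] × ℝ → ℝ, Schwartz in x for each t, such that u² = ∂ₜw₁ + ∂ₓ³w₁ - 6u·∂ₓw₁ + f₁ on (0,T] × ℝ, and for every t ∈ (0,T]: ‖w₁(t,·)‖_{Ḣ^{1/2}} ≤ C(M)·ε·(ε·t^{1/3})^{1/2} and ‖f₁(t,·)‖_{Ḣ^{1/2}} ≤ C(M)·ε·t^{-1}·(ε·t^{1/3})^{1/2}. -/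

import Mathlib

open MeasureTheory Real SchwartzMap Set
open scoped FourierTransform

noncomputable section

/-- Fourier transform of a real-valued function on `ℝ`. -/
def FT (u : ℝ → ℝ) : ℝ → ℂ := 𝓕 (fun x => (u x : ℂ))

/-- Homogeneous Sobolev norm `‖u‖_{Ḣˢ}`. -/
def HsNorm (s : ℝ) (u : ℝ → ℝ) : ℝ :=
  (∫ ξ : ℝ, |ξ| ^ (2 * s) * ‖FT u ξ‖ ^ 2) ^ (1/2 : ℝ)

/-- Homogeneous Besov norm `‖u‖_{Ḃ^{-1/2}_{2,∞}}`. -/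
def BesovNorm (u : ℝ → ℝ) : ℝ :=
  ⨆ j : ℤ, (2:ℝ) ^ (-(j:ℝ)/2) *
    (∫ ξ in {ξ : ℝ | (2:ℝ)^j ≤ |ξ| ∧ |ξ| < (2:ℝ)^(j+1)}, ‖FT u ξ‖^2) ^ (1/2:ℝ)

/-- `L²` norm. -/
def L2Norm (u : ℝ → ℝ) : ℝ := (∫ x : ℝ, u x ^ 2) ^ (1/2:ℝ)

/-- `L²` norm restricted to a set. -/
def L2NormOn (A : Set ℝ) (u : ℝ → ℝ) : ℝ := (∫ x in A, u x ^ 2) ^ (1/2:ℝ)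

/-- The time-dependent japanese bracket `⟨x⟩ = (x² + t^{2/3})^{1/2}`. -/
def jb (t x : ℝ) : ℝ := (x^2 + t ^ ((2:ℝ)/3)) ^ (1/2:ℝ)

/-- The flattened Besov norm `‖u‖_{B^{-1/2,ε}_{2,∞}}`. -/
def BesovEpsNorm (ε : ℝ) (u : ℝ → ℝ) : ℝ :=
  sInf {c : ℝ | ∃ g h : ℝ → ℝ, u = g + h ∧ c = BesovNorm g + ε ^ (-(1:ℝ)/2) * L2Norm h}

/-- `u` is a KdV solution on the time interval `I`: it is smooth on `I × ℝ`,
Schwartz in `x` for each `t ∈ I`, and satisfies `∂ₜu + ∂ₓ³u - 6u∂ₓu = 0` on `I × ℝ`. -/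
def IsKdVOn (I : Set ℝ) (u : ℝ → ℝ → ℝ) : Prop :=
  ContDiffOn ℝ (⊤ : ℕ∞) (fun p : ℝ × ℝ => u p.1 p.2) (I ×ˢ (Set.univ : Set ℝ)) ∧
  (∀ t ∈ I, ∃ f : 𝓢(ℝ, ℝ), ∀ x, u t x = f x) ∧
  (∀ t ∈ I, ∀ x : ℝ,
    deriv (fun s => u s x) t + iteratedDeriv 3 (u t) x - 6 * u t x * deriv (u t) x = 0)

/-- The bootstrap bounds with constants `M`, `ε` at time `t`. -/
def Bootstrap (M ε t : ℝ) (u : ℝ → ℝ) : Prop :=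
  ∀ x : ℝ, |u x| ≤ M * ε * t ^ (-(1:ℝ)/4) * jb t x ^ (-(1:ℝ)/4) ∧
    |deriv u x| ≤ M * ε * t ^ (-(3:ℝ)/4) * jb t x ^ ((1:ℝ)/4)

/-- The nonlinear operator `L^{NL}u(t)(x) = x·u(x) - 3t·u''(x) + 9t·u(x)²`. -/
def LNL (t : ℝ) (u : ℝ → ℝ) : ℝ → ℝ :=
  fun x => x * u x - 3 * t * iteratedDeriv 2 u x + 9 * t * u x ^ 2

open scoped ENNReal

theorem lintegral_comp_mul_right_real (g : ℝ → ℝ≥0∞) {a : ℝ} (ha : a ≠ 0) :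
    ∫⁻ x, g x = ENNReal.ofReal |a| * ∫⁻ x, g (a * x) := by
  have h := lintegral_image_eq_lintegral_abs_deriv_mul (s := univ) (f := fun x : ℝ => a * x)
    (f' := fun _ => a) MeasurableSet.univ
    (fun x _ => by simpa using (hasDerivAt_id x).const_mul a)
    (fun x _ y _ h => mul_left_cancel₀ ha h) g
  have him : (fun x : ℝ => a * x) '' univ = univ := by
    rw [image_univ, range_eq_univ]
    exact mul_left_surjective₀ ha
  rw [him] at h
  simp only [Measure.restrict_univ] at h
  rw [h, lintegral_const_mul' _ _ ENNReal.ofReal_ne_top]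

/-- The Gagliardo double integral of order `1/2`. -/
def gagliardo (f : ℝ → ℝ) : ℝ≥0∞ :=
  ∫⁻ x, ∫⁻ y, ENNReal.ofReal ((f x - f y) ^ 2 / (x - y) ^ 2)

theorem gagliardo_eq_shift {f : ℝ → ℝ} (hf : Measurable f) :
    gagliardo f = ∫⁻ h, ∫⁻ x, ENNReal.ofReal ((f (x + h) - f x) ^ 2 / h ^ 2) := by
  unfold gagliardo
  have : ∀ x, ∫⁻ y, ENNReal.ofReal ((f x - f y) ^ 2 / (x - y) ^ 2)
      = ∫⁻ h, ENNReal.ofReal ((f (x + h) - f x) ^ 2 / h ^ 2) := by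
    intro x
    rw [← lintegral_add_left_eq_self _ x]
    refine lintegral_congr fun h => ?_
    congr 1
    rw [show x - (x + h) = -h by ring, neg_sq, ← neg_sq (f (x + h) - f x), neg_sub]
  simp_rw [this]
  rw [lintegral_lintegral_swap]
  fun_prop

/-- Complexification of a real-valued Schwartz function. -/
def SchwartzMap.complexify (f : 𝓢(ℝ, ℝ)) : 𝓢(ℝ, ℂ) :=
  SchwartzMap.postcompCLM (𝕜 := ℝ) Complex.ofRealCLM f

theorem SchwartzMap.complexify_apply (f : 𝓢(ℝ, ℝ)) (x : ℝ) : f.complexify x = (f x : ℂ) := rfl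

theorem FT_schwartz (f : 𝓢(ℝ, ℝ)) : FT f = 𝓕 f.complexify := rfl

theorem FT_shift (f : 𝓢(ℝ, ℝ)) (h ξ : ℝ) :
    FT (f.compSubConstCLM ℝ (-h)) ξ = Complex.exp (2 * π * h * ξ * Complex.I) * FT f ξ := by
  unfold FT
  rw [Real.fourier_real_eq_integral_exp_smul, Real.fourier_real_eq_integral_exp_smul,
    ← integral_const_mul]
  have := integral_add_right_eq_self (μ := volume) (fun v : ℝ => 
    Complex.exp (2 * π * h * ξ * Complex.I)
      * Complex.exp (↑(-2 * π * v * ξ) * Complex.I) • (f v : ℂ)) h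
  rw [← this]
  congr 1 with v
  rw [smul_eq_mul, smul_eq_mul, ← mul_assoc, ← Complex.exp_add]
  congr 2
  · push_cast; ring
  · simp

theorem norm_exp_sub_one_sq (θ : ℝ) :
    ‖Complex.exp (θ * Complex.I) - 1‖ ^ 2 = 4 * sin (θ / 2) ^ 2 := by
  have := Complex.norm_exp_I_mul_ofReal_sub_one θ
  rw [mul_comm Complex.I] at this
  rw [this]
  rw [norm_mul, mul_pow, Real.norm_eq_abs, sq_abs, Real.norm_eq_abs, sq_abs]; norm_num

theorem lintegral_shift_sq (f : 𝓢(ℝ, ℝ)) (h : ℝ) :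
    ∫⁻ x, ENNReal.ofReal ((f (x + h) - f x) ^ 2)
      = ∫⁻ ξ, ENNReal.ofReal (4 * sin (π * h * ξ) ^ 2 * ‖FT f ξ‖ ^ 2) := by
  set g : 𝓢(ℝ, ℝ) := f.compSubConstCLM ℝ (-h) - f with hg
  have hgx : ∀ x, g x = f (x + h) - f x := fun x => by simp [hg]
  have h1 := SchwartzMap.integral_norm_sq_fourier g.complexify
  have hF : ∀ ξ, ‖𝓕 g.complexify ξ‖ ^ 2 = 4 * sin (π * h * ξ) ^ 2 * ‖FT f ξ‖ ^ 2 := by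
    intro ξ
    have : 𝓕 g.complexify ξ = FT (f.compSubConstCLM ℝ (-h)) ξ - FT f ξ := by
      rw [FT_schwartz, FT_schwartz]
      have : g.complexify = (f.compSubConstCLM ℝ (-h)).complexify - f.complexify := by
        simp [hg, SchwartzMap.complexify, map_sub]
      rw [this, sub_eq_add_neg, FourierTransform.fourier_add, FourierTransform.fourier_neg,
        sub_eq_add_neg]; rfl
    rw [this, FT_shift, ← sub_one_mul, norm_mul, mul_pow]
    congr 1
    rw [show (2 * π * h * ξ * Complex.I : ℂ) = ((2 * π * h * ξ : ℝ) : ℂ) * Complex.I by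
      push_cast; ring,
      norm_exp_sub_one_sq]
    congr 3; ring
  have hI : ∀ k : 𝓢(ℝ, ℂ), Integrable (fun x => ‖k x‖ ^ 2) := fun k =>
    (k.memLp 2).integrable_norm_pow (by norm_num)
  have h2 : ∀ x, ‖g.complexify x‖ ^ 2 = (f (x + h) - f x) ^ 2 := by
    intro x
    rw [SchwartzMap.complexify_apply, Complex.norm_real, Real.norm_eq_abs, sq_abs, hgx]
  have e1 := ofReal_integral_eq_lintegral_ofReal (hI g.complexify)
    (ae_of_all _ fun x => by positivity)
  have e2 := ofReal_integral_eq_lintegral_ofReal (hI (𝓕 g.complexify))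
    (ae_of_all _ fun x => by positivity)
  simp_rw [h2] at e1 h1
  simp_rw [hF] at e2 h1
  rw [← e1, ← e2, h1]

/-- The constant relating the Gagliardo integral and the homogeneous Sobolev norm. -/
def gagliardoConst : ℝ≥0∞ := ∫⁻ s : ℝ, ENNReal.ofReal (4 * sin (π * s) ^ 2 / s ^ 2)

theorem gagliardoConst_ne_top : gagliardoConst ≠ ⊤ := by
  have hi : Integrable fun s : ℝ => (8 * (π ^ 2 + 1)) * (1 + s ^ 2)⁻¹ :=
    integrable_inv_one_add_sq.const_mul _
  refine ne_top_of_le_ne_top hi.lintegral_lt_top.ne (lintegral_mono fun s => ?_)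
  refine ENNReal.ofReal_le_ofReal ?_
  rw [← div_eq_mul_inv]
  rcases eq_or_ne s 0 with rfl | hs
  · simp; positivity
  have h1 : sin (π * s) ^ 2 ≤ 1 := sin_sq_le_one _
  have h2 : sin (π * s) ^ 2 ≤ (π * s) ^ 2 := by
    rw [← sq_abs, ← sq_abs (π * s)]
    exact pow_le_pow_left₀ (abs_nonneg _) abs_sin_le_abs 2
  have hs2 : 0 < s ^ 2 := by positivity
  rw [div_le_div_iff₀ hs2 (by positivity)]
  nlinarith [sq_nonneg π, mul_nonneg hs2.le (sub_nonneg.2 h1)]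

theorem gagliardoConst_ne_zero : gagliardoConst ≠ 0 := by
  unfold gagliardoConst
  intro h
  rw [lintegral_eq_zero_iff (by fun_prop)] at h
  have h2 : ∀ᵐ s ∂(volume.restrict (Ioo (0:ℝ) 1)), False := by
    filter_upwards [ae_restrict_of_ae h, ae_restrict_mem measurableSet_Ioo] with s hs hs'
    have : 0 < sin (π * s) := sin_pos_of_pos_of_lt_pi (by have := hs'.1; positivity)
      (by nlinarith [hs'.2, pi_pos])
    have hs0 := hs'.1
    simp only [Pi.zero_apply, ENNReal.ofReal_eq_zero] at hs
    have : 0 < 4 * sin (π * s) ^ 2 / s ^ 2 := by positivity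
    linarith
  rw [ae_iff] at h2
  simp at h2

theorem lintegral_sin_sq_div (ξ : ℝ) :
    ∫⁻ h : ℝ, ENNReal.ofReal (4 * sin (π * h * ξ) ^ 2 / h ^ 2)
      = ENNReal.ofReal |ξ| * gagliardoConst := by
  rcases eq_or_ne ξ 0 with rfl | hξ
  · simp
  unfold gagliardoConst
  rw [lintegral_comp_mul_right_real (fun s : ℝ => ENNReal.ofReal (4 * sin (π * s) ^ 2 / s ^ 2)) hξ,
    ← lintegral_const_mul' _ _ ENNReal.ofReal_ne_top,
      ← lintegral_const_mul' _ _ ENNReal.ofReal_ne_top]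
  refine lintegral_congr fun h => ?_
  rw [← ENNReal.ofReal_mul (abs_nonneg _), ← ENNReal.ofReal_mul (abs_nonneg _)]
  congr 1
  rw [show π * (ξ * h) = π * h * ξ by ring]
  rcases eq_or_ne h 0 with rfl | hh
  · simp
  have : |ξ| * |ξ| = ξ ^ 2 := by rw [abs_mul_abs_self, sq]
  field_simp
  rw [sq_abs, mul_comm]

theorem integrable_abs_mul_FT (f : 𝓢(ℝ, ℝ)) : Integrable fun ξ : ℝ => |ξ| * ‖FT f ξ‖ ^ 2 := by
  rw [FT_schwartz]
  set F := 𝓕 f.complexify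
  have h1 : Integrable fun ξ => ‖ξ‖ ^ 1 * ‖F ξ‖ := F.integrable_pow_mul volume 1
  obtain ⟨C, hC⟩ := F.decay 0 0
  refine (h1.mul_const C).mono' (by fun_prop) (ae_of_all _ fun ξ => ?_)
  have := hC.2 ξ
  simp only [pow_zero, norm_iteratedFDeriv_zero, one_mul] at this
  rw [Real.norm_of_nonneg (by positivity), pow_one, Real.norm_eq_abs, sq, ← mul_assoc]
  gcongr

theorem HsNorm_half_sq (f : 𝓢(ℝ, ℝ)) :
    HsNorm (1 / 2) f ^ 2 = ∫ ξ : ℝ, |ξ| * ‖FT f ξ‖ ^ 2 := by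
  unfold HsNorm
  rw [← Real.rpow_natCast, ← Real.rpow_mul (integral_nonneg fun x => by positivity)]
  norm_num

/-- The Gagliardo integral is a multiple of the squared homogeneous Sobolev norm. -/
theorem gagliardo_eq (f : 𝓢(ℝ, ℝ)) :
    gagliardo f = gagliardoConst * ENNReal.ofReal (HsNorm (1 / 2) f ^ 2) := by
  rw [gagliardo_eq_shift f.continuous.measurable, HsNorm_half_sq,
    ofReal_integral_eq_lintegral_ofReal (integrable_abs_mul_FT f)
      (ae_of_all _ fun x => by positivity)]
  have hFc : Continuous (FT f) := by rw [FT_schwartz]; exact (𝓕 f.complexify).continuous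
  have h1 : ∀ h : ℝ, ∫⁻ x, ENNReal.ofReal ((f (x + h) - f x) ^ 2 / h ^ 2)
      = ∫⁻ ξ, ENNReal.ofReal (4 * sin (π * h * ξ) ^ 2 / h ^ 2) * ENNReal.ofReal (‖FT f ξ‖ ^ 2) := by
    intro h
    have h2 := lintegral_shift_sq f h
    have := congrArg (fun z => ENNReal.ofReal (1 / h ^ 2) * z) h2
    rw [← lintegral_const_mul' _ _ ENNReal.ofReal_ne_top,
      ← lintegral_const_mul' _ _ ENNReal.ofReal_ne_top] at this
    convert this using 1
    · refine lintegral_congr fun x => ?_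
      rw [← ENNReal.ofReal_mul (by positivity)]
      congr 1; ring
    · refine lintegral_congr fun x => ?_
      rw [← ENNReal.ofReal_mul (by positivity), ← ENNReal.ofReal_mul (by positivity)]
      congr 1; ring
  simp_rw [h1]
  rw [lintegral_lintegral_swap (by fun_prop), ← lintegral_const_mul' _ _ gagliardoConst_ne_top]
  refine lintegral_congr fun ξ => ?_
  rw [lintegral_mul_const' _ _ ENNReal.ofReal_ne_top, lintegral_sin_sq_div,
    ENNReal.ofReal_mul (abs_nonneg _)]
  ring

/-- The weight `(1 + y²)^{1/8}`. -/
def wt (y : ℝ) : ℝ := (1 + y ^ 2) ^ (1 / 8 : ℝ)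

theorem one_le_wt (y : ℝ) : 1 ≤ wt y := one_le_rpow (by nlinarith [sq_nonneg y]) (by norm_num)

theorem wt_pos (y : ℝ) : 0 < wt y := zero_lt_one.trans_le (one_le_wt y)

theorem wt_pow_eight (y : ℝ) : wt y ^ 8 = 1 + y ^ 2 := by
  unfold wt
  rw [← Real.rpow_natCast, ← Real.rpow_mul (by positivity)]
  norm_num

theorem abs_le_wt_pow_four (y : ℝ) : |y| ≤ wt y ^ 4 := by
  refine abs_le_of_sq_le_sq ?_ (by have := wt_pos y; positivity)
  have := wt_pow_eight y
  nlinarith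

theorem wt_pow_four_le (y : ℝ) : wt y ^ 4 ≤ 1 + |y| := by
  refine le_of_sq_le_sq ?_ (by positivity)
  have := wt_pow_eight y
  nlinarith [abs_nonneg y, sq_abs y]

@[fun_prop]
theorem continuous_wt : Continuous wt := by
  unfold wt
  exact (by fun_prop : Continuous fun y : ℝ => 1 + y ^ 2).rpow_const (fun y => Or.inr (by norm_num))

theorem wt_lipschitz (x y : ℝ) : wt x ≤ wt y + |x - y| / 4 := by
  rcases le_or_gt (wt x) (wt y) with h | h
  · have := abs_nonneg (x - y); linarith
  set a := wt x
  set b := wt y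
  have ha : 1 ≤ a := one_le_wt x
  have hb : 1 ≤ b := one_le_wt y
  have h8 : a ^ 8 - b ^ 8 = (x - y) * (x + y) := by
    rw [wt_pow_eight, wt_pow_eight]; ring
  have h1 : (x - y) * (x + y) ≤ |x - y| * (a ^ 4 + b ^ 4) := by
    refine (le_abs_self _).trans ?_
    rw [abs_mul]
    gcongr
    exact (abs_add_le x y).trans (add_le_add (abs_le_wt_pow_four x) (abs_le_wt_pow_four y))
  have h2 : (a - b) * ((a + b) * (a ^ 2 + b ^ 2)) * (a ^ 4 + b ^ 4) ≤
    |x - y| * (a ^ 4 + b ^ 4) := by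
    nlinarith
  have h3 := le_of_mul_le_mul_right h2 (by positivity)
  have h4 : 4 ≤ (a + b) * (a ^ 2 + b ^ 2) := by
    nlinarith [mul_nonneg (by linarith : 0 ≤ a + b) (by nlinarith : 0 ≤ a ^ 2 + b ^ 2 - 2)]
  have h5 : (a - b) * 4 ≤ (a - b) * ((a + b) * (a ^ 2 + b ^ 2)) := by
    apply mul_le_mul_of_nonneg_left h4; linarith
  linarith

theorem sq_sub_div_le_lintegral {G G' : ℝ → ℝ} (hG : ∀ x, HasDerivAt G (G' x) x)
    (hc : Continuous G') (x h : ℝ) :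
    ENNReal.ofReal ((G (x + h) - G x) ^ 2 / h ^ 2)
      ≤ ∫⁻ θ in Ioc (0 : ℝ) 1, ENNReal.ofReal (G' (x + θ * h) ^ 2) := by
  rcases eq_or_ne h 0 with rfl | hh
  · simp
  have h1 : ∫ θ in (0 : ℝ)..1, G' (x + θ * h) * h = G (x + h) - G x := by
    have := intervalIntegral.integral_eq_sub_of_hasDerivAt (a := 0) (b := 1)
      (f := fun θ => G (x + θ * h)) (f' := fun θ => G' (x + θ * h) * h)
      (fun θ _ => by
        have h2 : HasDerivAt (fun θ : ℝ => x + θ * h) h θ := by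
          simpa using ((hasDerivAt_id θ).mul_const h).const_add x
        exact (hG _).comp θ h2)
      (Continuous.intervalIntegrable (by fun_prop) _ _)
    simpa using this
  have h2 : ∫ θ in (0 : ℝ)..1, G' (x + θ * h) = (G (x + h) - G x) / h := by
    rw [← h1, intervalIntegral.integral_mul_const, mul_div_cancel_right₀ _ hh]
  set a := (G (x + h) - G x) / h with ha
  have h3 : 0 ≤ ∫ θ in (0 : ℝ)..1, (G' (x + θ * h) - a) ^ 2 :=
    intervalIntegral.integral_nonneg (by norm_num) fun θ _ => sq_nonneg _
  have h4 : ∫ θ in (0 : ℝ)..1, (G' (x + θ * h) - a) ^ 2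
      = (∫ θ in (0 : ℝ)..1, G' (x + θ * h) ^ 2) - a ^ 2 := by
    have : ∀ θ, (G' (x + θ * h) - a) ^ 2 = G' (x + θ * h) ^ 2 - 2 * a * G' (x + θ * h) + a ^ 2 := by
      intro θ; ring
    simp_rw [this]
    rw [intervalIntegral.integral_add (Continuous.intervalIntegrable (by fun_prop) _ _) (by simp),
      intervalIntegral.integral_sub (Continuous.intervalIntegrable (by fun_prop) _ _)
        (Continuous.intervalIntegrable (by fun_prop) _ _),
      intervalIntegral.integral_const_mul, h2]
    simp; ring
  have h5 : (G (x + h) - G x) ^ 2 / h ^ 2 ≤ ∫ θ in (0 : ℝ)..1, G' (x + θ * h) ^ 2 := by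
    rw [← div_pow]; linarith
  refine (ENNReal.ofReal_le_ofReal h5).trans_eq ?_
  rw [intervalIntegral.integral_of_le zero_le_one, ofReal_integral_eq_lintegral_ofReal]
  · exact (Continuous.integrableOn_Icc (by fun_prop)).mono_set Ioc_subset_Icc_self
  · exact ae_of_all _ fun _ => sq_nonneg _

/-- The total mass of `2 / (1 + s²)`. -/
def cauchyMass : ℝ≥0∞ := ∫⁻ s : ℝ, ENNReal.ofReal (2 * (1 + s ^ 2)⁻¹)

theorem cauchyMass_ne_top : cauchyMass ≠ ⊤ :=
  (integrable_inv_one_add_sq.const_mul 2).lintegral_lt_top.ne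

theorem lintegral_tail_inv_sq {a : ℝ} (ha : 0 < a) :
    ∫⁻ h : ℝ, (if a ≤ |h| then ENNReal.ofReal (1 / h ^ 2) else 0)
      ≤ ENNReal.ofReal (1 / a) * cauchyMass := by
  rw [lintegral_comp_mul_right_real _ ha.ne', abs_of_pos ha, cauchyMass,
    ← lintegral_const_mul' _ _ ENNReal.ofReal_ne_top,
      ← lintegral_const_mul' _ _ ENNReal.ofReal_ne_top]
  refine lintegral_mono fun s => ?_
  dsimp only
  split_ifs with h
  · rw [← ENNReal.ofReal_mul ha.le, ← ENNReal.ofReal_mul (by positivity)]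
    refine ENNReal.ofReal_le_ofReal ?_
    rw [abs_mul, abs_of_pos ha] at h
    have hs : 1 ≤ |s| := by nlinarith
    have hs2 : 1 ≤ s ^ 2 := by rw [← sq_abs]; nlinarith
    have : a * (1 / (a * s) ^ 2) = 1 / a * (s ^ 2)⁻¹ := by field_simp
    rw [this]
    gcongr
    rw [← div_eq_mul_inv, inv_eq_one_div, div_le_div_iff₀ (by positivity) (by positivity)]
    linarith
  · simp

/-- The part of the shifted square of `F` with shift `h` at most `3 wt x`. -/
def nearPart (F : ℝ → ℝ) (h x : ℝ) : ℝ≥0∞ :=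
  if |h| ≤ 3 * wt x then ENNReal.ofReal (F x ^ 2) else 0

/-- The part of the difference quotient of `F` with shift `h` at least `wt x`. -/
def farPart (F : ℝ → ℝ) (h x : ℝ) : ℝ≥0∞ :=
  if wt x ≤ |h| then ENNReal.ofReal (2 * F x ^ 2 * (1 / h ^ 2)) else 0

theorem measurable_nearPart {F : ℝ → ℝ} (hF : Measurable F) :
    Measurable fun p : ℝ × ℝ => nearPart F p.1 p.2 := by
  have := continuous_wt.measurable
  exact Measurable.ite (measurableSet_le (by fun_prop) (by fun_prop)) (by fun_prop) (by fun_prop)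

theorem measurable_farPart {F : ℝ → ℝ} (hF : Measurable F) :
    Measurable fun p : ℝ × ℝ => farPart F p.1 p.2 := by
  have := continuous_wt.measurable
  exact Measurable.ite (measurableSet_le (by fun_prop) (by fun_prop)) (by fun_prop) (by fun_prop)

theorem ofReal_diff_quotient_le {G G' : ℝ → ℝ} (hG : ∀ x, HasDerivAt G (G' x) x)
    (hc : Continuous G') (h x : ℝ) : ENNReal.ofReal ((G (x + h) - G x) ^ 2 / h ^ 2)
      ≤ (∫⁻ θ in Ioc (0 : ℝ) 1, nearPart G' h (x + θ * h))
        + (farPart G h x + farPart G h (x + h)) := by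
  by_cases hd : |h| ≤ wt x + wt (x + h)
  · refine le_add_right ((sq_sub_div_le_lintegral hG hc x h).trans_eq ?_)
    refine setLIntegral_congr_fun measurableSet_Ioc fun θ hθ => ?_
    have h1 := wt_lipschitz x (x + θ * h)
    have h2 := wt_lipschitz (x + h) (x + θ * h)
    have e1 : |x - (x + θ * h)| = θ * |h| := by
      rw [show x - (x + θ * h) = -(θ * h) by ring, abs_neg, abs_mul, abs_of_pos hθ.1]
    have e2 : |x + h - (x + θ * h)| = (1 - θ) * |h| := by
      rw [show x + h - (x + θ * h) = (1 - θ) * h by ring, abs_mul,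
        abs_of_nonneg (by linarith [hθ.2])]
    rw [e1] at h1
    rw [e2] at h2
    have : |h| ≤ 3 * wt (x + θ * h) := by nlinarith [wt_pos (x + θ * h)]
    simp only [nearPart, if_pos this]
  · push Not at hd
    refine le_add_left ?_
    have h1 : wt x ≤ |h| := by linarith [wt_pos (x + h)]
    have h2 : wt (x + h) ≤ |h| := by linarith [wt_pos x]
    simp only [farPart, if_pos h1, if_pos h2]
    rw [← ENNReal.ofReal_add (by positivity) (by positivity)]
    refine ENNReal.ofReal_le_ofReal ?_
    rw [div_eq_mul_one_div, ← add_mul]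
    gcongr
    nlinarith [sq_nonneg (G (x + h) + G x)]

theorem lintegral_nearPart {F : ℝ → ℝ} (hF : Measurable F) :
    ∫⁻ h, ∫⁻ x, ∫⁻ θ in Ioc (0 : ℝ) 1, nearPart F h (x + θ * h)
      = 6 * ∫⁻ x, ENNReal.ofReal (wt x * F x ^ 2) := by
  have hm := measurable_nearPart hF
  have : ∀ h, ∫⁻ x, ∫⁻ θ in Ioc (0 : ℝ) 1, nearPart F h (x + θ * h) = ∫⁻ x, nearPart F h x := by
    intro h
    rw [lintegral_lintegral_swap (by
      have : Measurable fun p : ℝ × ℝ => nearPart F h (p.1 + p.2 * h) :=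
        hm.comp (by fun_prop : Measurable fun p : ℝ × ℝ => (h, p.1 + p.2 * h))
      exact this.aemeasurable)]
    have : ∀ θ : ℝ, ∫⁻ x, nearPart F h (x + θ * h) = ∫⁻ x, nearPart F h x := fun θ =>
      lintegral_add_right_eq_self (fun x => nearPart F h x) (θ * h)
    simp_rw [this]
    simp
  simp_rw [this]
  rw [lintegral_lintegral_swap hm.aemeasurable, ← lintegral_const_mul' _ _ (by norm_num)]
  refine lintegral_congr fun x => ?_
  have : ∀ h, nearPart F h x = (Icc (-(3 * wt x)) (3 * wt x)).indicator
      (fun _ => ENNReal.ofReal (F x ^ 2)) h := by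
    intro h
    simp only [nearPart, indicator, mem_Icc, abs_le]
  simp_rw [this]
  rw [lintegral_indicator measurableSet_Icc, setLIntegral_const, Real.volume_Icc,
    ← ENNReal.ofReal_mul (sq_nonneg _), ← ENNReal.ofReal_ofNat 6,
      ← ENNReal.ofReal_mul (by norm_num)]
  congr 1; simp; ring

theorem lintegral_farPart {F : ℝ → ℝ} (hF : Measurable F) :
    ∫⁻ h, ∫⁻ x, farPart F h x ≤ 2 * cauchyMass * ∫⁻ x, ENNReal.ofReal (F x ^ 2 / wt x) := by
  rw [lintegral_lintegral_swap (measurable_farPart hF).aemeasurable, ← lintegral_const_mul' _ _ (by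
    exact ENNReal.mul_ne_top (by norm_num) cauchyMass_ne_top)]
  refine lintegral_mono fun x => ?_
  have : ∀ h, farPart F h x = ENNReal.ofReal (2 * F x ^ 2) *
      (if wt x ≤ |h| then ENNReal.ofReal (1 / h ^ 2) else 0) := by
    intro h
    simp only [farPart, mul_ite, mul_zero]
    rw [ENNReal.ofReal_mul (by positivity)]
  simp_rw [this]
  rw [lintegral_const_mul' _ _ ENNReal.ofReal_ne_top]
  refine (mul_le_mul_right (lintegral_tail_inv_sq (wt_pos x)) _).trans_eq ?_
  rw [← mul_assoc, ← ENNReal.ofReal_mul (by positivity),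
    show 2 * F x ^ 2 * (1 / wt x) = 2 * (F x ^ 2 / wt x) by ring, ENNReal.ofReal_mul (by norm_num),
    ENNReal.ofReal_ofNat]
  ring

/-- Interpolation of the Gagliardo integral between weighted `L²` and weighted `H¹`. -/
theorem gagliardo_le_weighted {G G' : ℝ → ℝ} (hG : ∀ x, HasDerivAt G (G' x) x)
    (hc : Continuous G') :
    gagliardo G ≤ (6 * ∫⁻ x, ENNReal.ofReal (wt x * G' x ^ 2))
      + 4 * cauchyMass * ∫⁻ x, ENNReal.ofReal (G x ^ 2 / wt x) := by
  have hGc : Continuous G := continuous_iff_continuousAt.2 fun x => (hG x).continuousAt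
  have hm1 := measurable_nearPart hc.measurable
  have hm2 := measurable_farPart hGc.measurable
  rw [gagliardo_eq_shift hGc.measurable]
  have I3 : ∫⁻ h, ∫⁻ x, farPart G h (x + h) = ∫⁻ h, ∫⁻ x, farPart G h x :=
    lintegral_congr fun h => lintegral_add_right_eq_self (fun x => farPart G h x) h
  have hmA : Measurable fun p : ℝ × ℝ => ∫⁻ θ in Ioc (0 : ℝ) 1, nearPart G' p.1 (p.2 + θ * p.1) :=
    Measurable.lintegral_prod_right' (ν := volume.restrict (Ioc (0 : ℝ) 1))
      (f := fun q : (ℝ × ℝ) × ℝ => nearPart G' q.1.1 (q.1.2 + q.2 * q.1.1))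
      (hm1.comp (by fun_prop : Measurable fun q : (ℝ × ℝ) × ℝ => (q.1.1, q.1.2 + q.2 * q.1.1)))
  have hstep : ∀ h, ∫⁻ x, ((∫⁻ θ in Ioc (0 : ℝ) 1, nearPart G' h (x + θ * h))
        + (farPart G h x + farPart G h (x + h)))
      = (∫⁻ x, ∫⁻ θ in Ioc (0 : ℝ) 1, nearPart G' h (x + θ * h))
        + ((∫⁻ x, farPart G h x) + ∫⁻ x, farPart G h (x + h)) := fun h => by
    have hA : Measurable fun x => ∫⁻ θ in Ioc (0 : ℝ) 1, nearPart G' h (x + θ * h) :=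
      hmA.comp measurable_prodMk_left
    have hB : Measurable fun x => farPart G h x := hm2.comp measurable_prodMk_left
    rw [lintegral_add_left hA, lintegral_add_left hB]
  have hA : Measurable fun h => ∫⁻ x, ∫⁻ θ in Ioc (0 : ℝ) 1, nearPart G' h (x + θ * h) :=
    hmA.lintegral_prod_right'
  have hB : Measurable fun h => ∫⁻ x, farPart G h x := hm2.lintegral_prod_right'
  refine (lintegral_mono fun h => lintegral_mono fun x =>
    ofReal_diff_quotient_le hG hc h x).trans ?_
  rw [lintegral_congr hstep, lintegral_add_left hA, lintegral_add_left hB, I3,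
    lintegral_nearPart hc.measurable]
  refine add_le_add le_rfl ((add_le_add (lintegral_farPart hGc.measurable)
    (lintegral_farPart hGc.measurable)).trans_eq ?_)
  ring

/-- The squared weighted `L²` norm with weight `(1 + y²)^{-5/8}`. -/
def weightedSq (Z : ℝ → ℝ) : ℝ≥0∞ := ∫⁻ y, ENNReal.ofReal (Z y ^ 2 / wt y ^ 5)

theorem gagliardo_le_of_pointwise {G G' Q : ℝ → ℝ} {A : ℝ} (hG : ∀ x, HasDerivAt G (G' x) x)
    (hc : Continuous G') (h0 : ∀ x, |G x| ≤ A * Q x / wt x ^ 2)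
    (h1 : ∀ x, |G' x| ≤ A * Q x / wt x ^ 3) :
    gagliardo G ≤ (6 + 4 * cauchyMass) * (ENNReal.ofReal (A ^ 2) * weightedSq Q) := by
  refine (gagliardo_le_weighted hG hc).trans ?_
  rw [add_mul]
  have e : ENNReal.ofReal (A ^ 2) * weightedSq Q
      = ∫⁻ y, ENNReal.ofReal (A ^ 2 * (Q y ^ 2 / wt y ^ 5)) := by
    simp_rw [ENNReal.ofReal_mul (sq_nonneg A)]
    rw [lintegral_const_mul' _ _ ENNReal.ofReal_ne_top, weightedSq]
  rw [e]
  refine add_le_add (mul_le_mul_right (lintegral_mono fun x => ENNReal.ofReal_le_ofReal ?_) _)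
    (mul_le_mul_right (lintegral_mono fun x => ENNReal.ofReal_le_ofReal ?_) _)
  · have hw := wt_pos x
    have := pow_le_pow_left₀ (abs_nonneg _) (h1 x) 2
    rw [sq_abs] at this
    calc wt x * G' x ^ 2 ≤ wt x * (A * Q x / wt x ^ 3) ^ 2 := by gcongr
      _ = _ := by field_simp
  · have hw := wt_pos x
    have := pow_le_pow_left₀ (abs_nonneg _) (h0 x) 2
    rw [sq_abs] at this
    calc G x ^ 2 / wt x ≤ (A * Q x / wt x ^ 2) ^ 2 / wt x := by gcongr
      _ = _ := by field_simp

theorem sq_diff_quotient_le {c c' : ℝ → ℝ} {A : ℝ} (hA : 0 ≤ A)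
    (hc : ∀ x, HasDerivAt c (c' x) x)
    (h0 : ∀ x, |c x| ≤ A / wt x ^ 5) (h1 : ∀ x, |c' x| ≤ A / wt x ^ 3) (x y : ℝ) :
    (c x - c y) ^ 2 / (x - y) ^ 2
      ≤ 18 * A ^ 2 / wt x ^ 5 * ((1 + y ^ 2)⁻¹ + (1 + (x - y) ^ 2)⁻¹) := by
  have hw := wt_pos x
  have hw1 := one_le_wt x
  have hy : 0 < (1 + y ^ 2)⁻¹ := by positivity
  have hxy : 0 < (1 + (x - y) ^ 2)⁻¹ := by positivity
  rcases eq_or_ne x y with rfl | hne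
  · simp; positivity
  have hd : 0 < (x - y) ^ 2 := by have := sub_ne_zero.2 hne; positivity
  rw [div_le_iff₀ hd]
  rcases le_or_gt |x - y| 1 with h | h
  · have hq : ∀ p ∈ uIcc x y, |c' p| ≤ 3 * A / wt x ^ 3 := by
      intro p hp
      have hp' : |x - p| ≤ 1 := by
        rw [abs_sub_comm]
        exact (abs_sub_left_of_mem_uIcc hp).trans (by rwa [abs_sub_comm])
      have h3 := wt_lipschitz x p
      have h4 : 3 / 4 * wt x ≤ wt p := by linarith
      refine (h1 p).trans ?_
      rw [div_le_div_iff₀ (pow_pos (wt_pos p) 3) (by positivity)]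
      have : (3 / 4 * wt x) ^ 3 ≤ wt p ^ 3 := by gcongr
      have h5 : wt x ^ 3 ≤ 3 * wt p ^ 3 := by nlinarith [pow_pos hw 3]
      nlinarith
    have hmv : |c y - c x| ≤ 3 * A / wt x ^ 3 * |y - x| := by
      have := (convex_uIcc x y).norm_image_sub_le_of_norm_hasDerivWithin_le (f := c) (f' := c')
        (fun p _ => (hc p).hasDerivWithinAt) hq left_mem_uIcc right_mem_uIcc
      simpa using this
    have h5 : (c x - c y) ^ 2 ≤ 9 * A ^ 2 / wt x ^ 6 * (x - y) ^ 2 := by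
      rw [← sq_abs, ← sq_abs (x - y), abs_sub_comm, abs_sub_comm x]
      refine (pow_le_pow_left₀ (abs_nonneg _) hmv 2).trans_eq ?_
      ring
    refine h5.trans ?_
    gcongr
    have h6 : (1 / 2 : ℝ) ≤ (1 + (x - y) ^ 2)⁻¹ := by
      rw [one_div]
      apply inv_anti₀ (by positivity)
      rw [← sq_abs]
      nlinarith [abs_nonneg (x - y)]
    calc 9 * A ^ 2 / wt x ^ 6 ≤ 9 * A ^ 2 / wt x ^ 5 := by
          gcongr; norm_num
      _ = 18 * A ^ 2 / wt x ^ 5 * (1 / 2) := by ring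
      _ ≤ _ := by gcongr; linarith
  · have hS : 1 ≤ 2 * (1 + (x - y) ^ 2)⁻¹ * (x - y) ^ 2 := by
      rw [mul_assoc, inv_mul_eq_div, ← mul_div_assoc, one_le_div (by positivity), ← sq_abs]
      nlinarith
    have hcx : (c x) ^ 2 ≤ A ^ 2 * (1 / wt x ^ 5) := by
      rw [← sq_abs]
      refine (pow_le_pow_left₀ (abs_nonneg _) (h0 x) 2).trans ?_
      rw [div_pow, ← pow_mul, mul_one_div]
      gcongr; norm_num
    have hcy : (c y) ^ 2 ≤ A ^ 2 * (1 + y ^ 2)⁻¹ := by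
      rw [← sq_abs]
      refine (pow_le_pow_left₀ (abs_nonneg _) (h0 y) 2).trans ?_
      rw [div_pow, ← pow_mul, ← div_eq_mul_inv, ← wt_pow_eight y]
      have := one_le_wt y
      gcongr; norm_num
    have hX : (1 + y ^ 2)⁻¹ * (1 + (x - y) ^ 2)⁻¹
        ≤ 2 * (1 / wt x ^ 5) * ((1 + y ^ 2)⁻¹ + (1 + (x - y) ^ 2)⁻¹) := by
      have h8 : (1 + x ^ 2)⁻¹ ≤ 1 / wt x ^ 5 := by
        rw [← wt_pow_eight x, ← one_div]
        gcongr; norm_num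
      refine le_trans ?_ (mul_le_mul_of_nonneg_right (mul_le_mul_of_nonneg_left h8 zero_le_two)
        (by positivity))
      rw [inv_add_inv (by positivity) (by positivity), ← mul_inv, inv_eq_one_div, mul_comm (2:ℝ),
        mul_assoc, inv_mul_eq_div, ← mul_div_assoc, div_div,
        div_le_div_iff₀ (by positivity) (by positivity)]
      have : 1 + x ^ 2 ≤ 2 * (1 + y ^ 2 + (1 + (x - y) ^ 2)) := by
        nlinarith [sq_nonneg (x - 2 * y)]
      nlinarith [mul_le_mul_of_nonneg_left this
        (show 0 ≤ (1 + y ^ 2) * (1 + (x - y) ^ 2) by positivity)]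
    set P := (1 + y ^ 2)⁻¹
    set S := (1 + (x - y) ^ 2)⁻¹
    set a := 1 / wt x ^ 5 with ha
    have ha0 : 0 < a := by positivity
    have e : 18 * A ^ 2 / wt x ^ 5 = 18 * A ^ 2 * a := by rw [ha]; ring
    rw [e]
    have h9 : (c x - c y) ^ 2 ≤ 2 * A ^ 2 * (a + P) := by
      nlinarith [sq_nonneg (c x + c y)]
    have h10 : 2 * A ^ 2 * (a + P) * (2 * S) ≤ 18 * A ^ 2 * a * (P + S) := by
      have : (a + P) * (4 * S) ≤ 18 * a * (P + S) := by nlinarith [mul_pos ha0 hy, mul_pos ha0 hxy]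
      nlinarith [mul_le_mul_of_nonneg_left this (sq_nonneg A)]
    calc (c x - c y) ^ 2 ≤ 2 * A ^ 2 * (a + P) * 1 := by linarith
      _ ≤ 2 * A ^ 2 * (a + P) * (2 * S * (x - y) ^ 2) := by gcongr
      _ = 2 * A ^ 2 * (a + P) * (2 * S) * (x - y) ^ 2 := by ring
      _ ≤ _ := by gcongr

theorem gagliardo_mul_le {c c' Z : ℝ → ℝ} {A : ℝ} (hA : 0 ≤ A)
    (hc : ∀ x, HasDerivAt c (c' x) x)
    (h0 : ∀ x, |c x| ≤ A / wt x ^ 5) (h1 : ∀ x, |c' x| ≤ A / wt x ^ 3) (hZ : Continuous Z) :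
    gagliardo (fun x => c x * Z x)
      ≤ (2 + 72 * cauchyMass) * (ENNReal.ofReal (A ^ 2) * (gagliardo Z + weightedSq Z)) := by
  have hcc : Continuous c := continuous_iff_continuousAt.2 fun x => (hc x).continuousAt
  have key : ∀ x y, ENNReal.ofReal ((c x * Z x - c y * Z y) ^ 2 / (x - y) ^ 2)
      ≤ ENNReal.ofReal (2 * A ^ 2) * ENNReal.ofReal ((Z x - Z y) ^ 2 / (x - y) ^ 2)
        + ENNReal.ofReal (18 * A ^ 2 * (Z x ^ 2 / wt x ^ 5))
          * (ENNReal.ofReal (2 * (1 + y ^ 2)⁻¹) + ENNReal.ofReal (2 * (1 + (x - y) ^ 2)⁻¹)) := by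
    intro x y
    have hw := wt_pos x
    rw [← ENNReal.ofReal_mul (by positivity), ← ENNReal.ofReal_add (by positivity) (by positivity),
      ← ENNReal.ofReal_mul (by positivity), ← ENNReal.ofReal_add (by positivity) (by positivity)]
    refine ENNReal.ofReal_le_ofReal ?_
    have e1 := sq_diff_quotient_le hA hc h0 h1 x y
    have hcy : c y ^ 2 ≤ A ^ 2 := by
      rw [← sq_abs]
      refine pow_le_pow_left₀ (abs_nonneg _) ((h0 y).trans ?_) 2
      exact div_le_self hA (one_le_pow₀ (one_le_wt y))
    calc (c x * Z x - c y * Z y) ^ 2 / (x - y) ^ 2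
        ≤ (2 * (c y ^ 2 * (Z x - Z y) ^ 2) + 2 * Z x ^ 2 * (c x - c y) ^ 2) / (x - y) ^ 2 := by
          gcongr
          nlinarith [sq_nonneg (c y * (Z x - Z y) - Z x * (c x - c y))]
      _ = 2 * c y ^ 2 * ((Z x - Z y) ^ 2 / (x - y) ^ 2)
          + 2 * Z x ^ 2 * ((c x - c y) ^ 2 / (x - y) ^ 2) := by ring
      _ ≤ 2 * A ^ 2 * ((Z x - Z y) ^ 2 / (x - y) ^ 2)
          + 2 * Z x ^ 2 * (18 * A ^ 2 / wt x ^ 5 * ((1 + y ^ 2)⁻¹ + (1 + (x - y) ^ 2)⁻¹)) := by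
          gcongr
      _ = _ := by ring
  have inner : ∀ x, ∫⁻ y, ENNReal.ofReal ((c x * Z x - c y * Z y) ^ 2 / (x - y) ^ 2)
      ≤ ENNReal.ofReal (2 * A ^ 2) * (∫⁻ y, ENNReal.ofReal ((Z x - Z y) ^ 2 / (x - y) ^ 2))
        + ENNReal.ofReal (18 * A ^ 2 * (Z x ^ 2 / wt x ^ 5)) * (cauchyMass + cauchyMass) := by
    intro x
    refine (lintegral_mono (key x)).trans_eq ?_
    have hm : Measurable Z := hZ.measurable
    rw [lintegral_add_left (by fun_prop), lintegral_const_mul' _ _ ENNReal.ofReal_ne_top,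
      lintegral_const_mul' _ _ ENNReal.ofReal_ne_top, lintegral_add_left (by fun_prop)]
    have : ∫⁻ y, ENNReal.ofReal (2 * (1 + (x - y) ^ 2)⁻¹) = cauchyMass :=
      lintegral_sub_left_eq_self (fun s => ENNReal.ofReal (2 * (1 + s ^ 2)⁻¹)) x
    rw [this]; rfl
  refine (lintegral_mono inner).trans ?_
  have hm : Measurable Z := hZ.measurable
  have hcm := continuous_wt.measurable
  rw [lintegral_add_right _ (by fun_prop), lintegral_const_mul' _ _ ENNReal.ofReal_ne_top,
    lintegral_mul_const _ (by fun_prop)]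
  simp_rw [ENNReal.ofReal_mul (show 0 ≤ 18 * A ^ 2 by positivity)]
  rw [lintegral_const_mul' _ _ ENNReal.ofReal_ne_top, ENNReal.ofReal_mul (by norm_num),
    ENNReal.ofReal_mul (by norm_num), ENNReal.ofReal_ofNat, ENNReal.ofReal_ofNat]
  change 2 * ENNReal.ofReal (A ^ 2) * gagliardo Z
    + 18 * ENNReal.ofReal (A ^ 2) * weightedSq Z * (cauchyMass + cauchyMass) ≤ _
  generalize ENNReal.ofReal (A ^ 2) = a
  calc _ ≤ 2 * a * gagliardo Z + 18 * a * weightedSq Z * (cauchyMass + cauchyMass)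
      + (2 * a * weightedSq Z + 72 * cauchyMass * a * gagliardo Z
        + 36 * cauchyMass * a * weightedSq Z) := le_self_add
    _ = _ := by ring

theorem weightedSq_average_le {Z : ℝ → ℝ} (hZ : Continuous Z) :
    weightedSq (fun y => ∫ η in (0 : ℝ)..1, |Z (y - η)|) ≤ 4 * weightedSq Z := by
  have key : ∀ y, ENNReal.ofReal ((∫ η in (0 : ℝ)..1, |Z (y - η)|) ^ 2 / wt y ^ 5)
      ≤ ∫⁻ η in Ioc (0 : ℝ) 1, 4 * ENNReal.ofReal (Z (y - η) ^ 2 / wt (y - η) ^ 5) := by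
    intro y
    set a := ∫ η in (0 : ℝ)..1, |Z (y - η)| with ha
    have h3 : 0 ≤ ∫ η in (0 : ℝ)..1, (|Z (y - η)| - a) ^ 2 :=
      intervalIntegral.integral_nonneg (by norm_num) fun θ _ => sq_nonneg _
    have h4 : ∫ η in (0 : ℝ)..1, (|Z (y - η)| - a) ^ 2
        = (∫ η in (0 : ℝ)..1, Z (y - η) ^ 2) - a ^ 2 := by
      have : ∀ η, (|Z (y - η)| - a) ^ 2 = Z (y - η) ^ 2 - 2 * a * |Z (y - η)| + a ^ 2 := by
        intro η; rw [← sq_abs (Z (y - η))]; ring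
      simp_rw [this]
      rw [intervalIntegral.integral_add (Continuous.intervalIntegrable (by fun_prop) _ _) (by simp),
        intervalIntegral.integral_sub (Continuous.intervalIntegrable (by fun_prop) _ _)
          (Continuous.intervalIntegrable (by fun_prop) _ _),
        intervalIntegral.integral_const_mul, ← ha]
      simp; ring
    have h5 : a ^ 2 / wt y ^ 5 ≤ ∫ η in (0 : ℝ)..1, Z (y - η) ^ 2 / wt y ^ 5 := by
      rw [intervalIntegral.integral_div]
      have := wt_pos y
      gcongr
      linarith
    refine (ENNReal.ofReal_le_ofReal h5).trans ?_
    rw [intervalIntegral.integral_of_le zero_le_one, ofReal_integral_eq_lintegral_ofReal]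
    · refine setLIntegral_mono' measurableSet_Ioc fun η hη => ?_
      rw [← ENNReal.ofReal_ofNat 4, ← ENNReal.ofReal_mul (by norm_num)]
      refine ENNReal.ofReal_le_ofReal ?_
      have h6 := wt_lipschitz (y - η) y
      have h7 : |y - η - y| ≤ 1 := by
        rw [show y - η - y = -η by ring, abs_neg, abs_of_pos hη.1]; exact hη.2
      have h8 := one_le_wt y
      have h9 := wt_pos (y - η)
      have h10 : wt (y - η) ^ 5 ≤ (5 / 4 * wt y) ^ 5 := by gcongr; linarith
      have h11 := wt_pos y
      rw [← mul_div_assoc, div_le_div_iff₀ (by positivity) (by positivity)]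
      have h12 : wt (y - η) ^ 5 ≤ 4 * wt y ^ 5 := h10.trans (by
        rw [mul_pow]; gcongr; norm_num)
      nlinarith [sq_nonneg (Z (y - η))]
    · exact (Continuous.integrableOn_Icc (by fun_prop)).mono_set Ioc_subset_Icc_self
    · exact ae_of_all _ fun _ => by have := wt_pos y; positivity
  refine (lintegral_mono key).trans ?_
  have hm : Measurable Z := hZ.measurable
  have hcm := continuous_wt.measurable
  rw [lintegral_lintegral_swap (by
    refine Measurable.aemeasurable ?_
    unfold Function.uncurry
    fun_prop)]
  have : ∀ η : ℝ, ∫⁻ y, 4 * ENNReal.ofReal (Z (y - η) ^ 2 / wt (y - η) ^ 5) = 4 * weightedSq Z := by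
    intro η
    rw [lintegral_const_mul' _ _ (by norm_num), weightedSq,
      ← lintegral_sub_right_eq_self (fun y => ENNReal.ofReal (Z y ^ 2 / wt y ^ 5)) η]
  simp_rw [this]
  simp

/-- The smooth averaging profile `140 η³ (1 - η)³`, a probability density on `[0, 1]`. -/
def bump (η : ℝ) : ℝ := 140 * η ^ 3 * (1 - η) ^ 3

@[fun_prop]
theorem continuous_bump : Continuous bump := by unfold bump; fun_prop

theorem integral_bump : ∫ η in (0 : ℝ)..1, bump η = 1 := by
  have h : ∀ η : ℝ, HasDerivAt (fun η : ℝ => 35 * η ^ 4 - 84 * η ^ 5 + 70 * η ^ 6 - 20 * η ^ 7)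
      (bump η) η := by
    intro η
    have := ((((hasDerivAt_pow 4 η).const_mul 35).sub ((hasDerivAt_pow 5 η).const_mul 84)).add
      ((hasDerivAt_pow 6 η).const_mul 70)).sub ((hasDerivAt_pow 7 η).const_mul 20)
    refine this.congr_deriv ?_
    unfold bump; push_cast; ring
  rw [intervalIntegral.integral_eq_sub_of_hasDerivAt (fun η _ => h η)
    (Continuous.intervalIntegrable (by fun_prop) _ _)]
  norm_num

theorem bump_nonneg {η : ℝ} (hη : η ∈ Icc (0 : ℝ) 1) : 0 ≤ bump η := by
  have h1 := hη.1
  have h2 : 0 ≤ 1 - η := by linarith [hη.2]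
  unfold bump; positivity

theorem bump_le {η : ℝ} (hη : η ∈ Icc (0 : ℝ) 1) : bump η ≤ 3 := by
  have h1 := hη.1
  have h2 : 0 ≤ 1 - η := by linarith [hη.2]
  have h3 : η * (1 - η) ≤ 1 / 4 := by nlinarith [sq_nonneg (η - 1 / 2)]
  have h4 : (η * (1 - η)) ^ 3 ≤ (1 / 4) ^ 3 := pow_le_pow_left₀ (by positivity) h3 3
  unfold bump
  nlinarith [mul_pow η (1 - η) 3]

/-- The average of `Z` over `[-1, 0]` against the reflected bump. -/
def bumpMean (Z : ℝ → ℝ) : ℝ := ∫ η in (0 : ℝ)..1, bump η * Z (0 - η)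

theorem sq_sub_bumpMean_le {Z : ℝ → ℝ} (hZ : Continuous Z) (y : ℝ) :
    (Z y - bumpMean Z) ^ 2 ≤ ∫ η in (0 : ℝ)..1, 3 * (Z y - Z (-η)) ^ 2 := by
  set a := Z y - bumpMean Z with ha
  have h3 : 0 ≤ ∫ η in (0 : ℝ)..1, bump η * ((Z y - Z (-η)) - a) ^ 2 :=
    intervalIntegral.integral_nonneg (by norm_num) fun θ hθ =>
      mul_nonneg (bump_nonneg hθ) (sq_nonneg _)
  have h4 : ∫ η in (0 : ℝ)..1, bump η * ((Z y - Z (-η)) - a) ^ 2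
      = (∫ η in (0 : ℝ)..1, bump η * (Z y - Z (-η)) ^ 2) - a ^ 2 := by
    have : ∀ η, bump η * ((Z y - Z (-η)) - a) ^ 2
        = bump η * (Z y - Z (-η)) ^ 2 + 2 * a * (bump η * Z (0 - η))
          + (a ^ 2 - 2 * a * Z y) * bump η := by
      intro η; simp only [zero_sub]; ring
    simp_rw [this]
    rw [intervalIntegral.integral_add (Continuous.intervalIntegrable (by fun_prop) _ _)
        (Continuous.intervalIntegrable (by fun_prop) _ _),
      intervalIntegral.integral_add (Continuous.intervalIntegrable (by fun_prop) _ _)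
        (Continuous.intervalIntegrable (by fun_prop) _ _),
      intervalIntegral.integral_const_mul, intervalIntegral.integral_const_mul, integral_bump,
      ← bumpMean]
    rw [ha]; ring
  have h5 : ∫ η in (0 : ℝ)..1, bump η * (Z y - Z (-η)) ^ 2
      ≤ ∫ η in (0 : ℝ)..1, 3 * (Z y - Z (-η)) ^ 2 := by
    refine intervalIntegral.integral_mono_on zero_le_one
      (Continuous.intervalIntegrable (by fun_prop) _ _)
      (Continuous.intervalIntegrable (by fun_prop) _ _) fun η hη => ?_
    exact mul_le_mul_of_nonneg_right (bump_le hη) (sq_nonneg _)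
  linarith

theorem lintegral_sq_near_zero_le {Z : ℝ → ℝ} (hZ : Continuous Z) :
    ∫⁻ y in Icc (-1 : ℝ) 1, ENNReal.ofReal (Z y ^ 2)
      ≤ 24 * gagliardo Z + 4 * ENNReal.ofReal (bumpMean Z ^ 2) := by
  have hm : Measurable Z := hZ.measurable
  have key : ∀ y ∈ Icc (-1 : ℝ) 1, ENNReal.ofReal (Z y ^ 2)
      ≤ 24 * (∫⁻ x, ENNReal.ofReal ((Z y - Z x) ^ 2 / (y - x) ^ 2))
        + 2 * ENNReal.ofReal (bumpMean Z ^ 2) := by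
    intro y hy
    have h1 : Z y ^ 2 ≤ (∫ η in (0 : ℝ)..1, 6 * (Z y - Z (-η)) ^ 2) + 2 * bumpMean Z ^ 2 := by
      have := sq_sub_bumpMean_le hZ y
      rw [intervalIntegral.integral_const_mul] at this ⊢
      nlinarith [sq_nonneg (Z y - 2 * bumpMean Z)]
    refine (ENNReal.ofReal_le_ofReal h1).trans ?_
    rw [ENNReal.ofReal_add (intervalIntegral.integral_nonneg zero_le_one fun _ _ => by positivity)
      (by positivity), ENNReal.ofReal_mul (by norm_num), ENNReal.ofReal_ofNat]
    refine add_le_add ?_ le_rfl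
    rw [intervalIntegral.integral_of_le zero_le_one, ofReal_integral_eq_lintegral_ofReal]
    · calc ∫⁻ η in Ioc (0 : ℝ) 1, ENNReal.ofReal (6 * (Z y - Z (-η)) ^ 2)
          ≤ ∫⁻ η in Ioc (0 : ℝ) 1, 24 * ENNReal.ofReal ((Z y - Z (-η)) ^ 2 / (y - (-η)) ^ 2) := by
            refine setLIntegral_mono' measurableSet_Ioc fun η hη => ?_
            rw [← ENNReal.ofReal_ofNat 24, ← ENNReal.ofReal_mul (by norm_num)]
            refine ENNReal.ofReal_le_ofReal ?_
            rcases eq_or_ne y (-η) with h | h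
            · rw [← h]; simp
            have h2 : 0 < (y - (-η)) ^ 2 := by have := sub_ne_zero.2 h; positivity
            rw [← mul_div_assoc, le_div_iff₀ h2]
            have h3 : (y - (-η)) ^ 2 ≤ 4 := by
              have := hy.1; have := hy.2; have := hη.1; have := hη.2
              nlinarith
            nlinarith [sq_nonneg (Z y - Z (-η))]
        _ ≤ ∫⁻ η, 24 * ENNReal.ofReal ((Z y - Z (-η)) ^ 2 / (y - (-η)) ^ 2) :=
            setLIntegral_le_lintegral _ _
        _ = 24 * ∫⁻ x, ENNReal.ofReal ((Z y - Z x) ^ 2 / (y - x) ^ 2) := by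
            rw [lintegral_const_mul' _ _ (by norm_num)]
            congr 1
            exact lintegral_neg_eq_self (fun x => ENNReal.ofReal ((Z y - Z x) ^ 2 / (y - x) ^ 2))
    · exact (Continuous.integrableOn_Icc (by fun_prop)).mono_set Ioc_subset_Icc_self
    · exact ae_of_all _ fun _ => by positivity
  refine (setLIntegral_mono' measurableSet_Icc key).trans ?_
  rw [lintegral_add_right _ (by fun_prop), lintegral_const_mul' _ _ (by norm_num),
    setLIntegral_const,
    Real.volume_Icc]
  refine add_le_add ?_ (le_of_eq ?_)
  · gcongr
    exact setLIntegral_le_lintegral _ _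
  · rw [show (1 : ℝ) - -1 = 2 by norm_num, ENNReal.ofReal_ofNat]; ring

/-- The tail of the squared weighted norm, with the homogeneous weight. -/
def tailSq (Z : ℝ → ℝ) : ℝ≥0∞ :=
  ∫⁻ y in {y : ℝ | 1 ≤ |y|}, ENNReal.ofReal (|y| ^ (-(5 / 4) : ℝ) * Z y ^ 2)

theorem measurableSet_tail : MeasurableSet {y : ℝ | 1 ≤ |y|} :=
  measurableSet_le measurable_const (by fun_prop)

theorem tailSq_dilate_le {Z : ℝ → ℝ} (hZ : Continuous Z) {r : ℝ} (h0 : 1 / 32 ≤ r)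
    (h1 : r ≤ 1 / 16) :
    2 * (∫⁻ y in {y : ℝ | 1 ≤ |y|}, ENNReal.ofReal (|y| ^ (-(5 / 4) : ℝ) * Z (r * y) ^ 2))
      ≤ tailSq Z + 128 * ∫⁻ y in Icc (-1 : ℝ) 1, ENNReal.ofReal (Z y ^ 2) := by
  have hr : 0 < r := by linarith
  have hm : Measurable Z := hZ.measurable
  have eA : tailSq Z = ∫⁻ y, ENNReal.ofReal r * {y : ℝ | 1 ≤ |y|}.indicator
      (fun y => ENNReal.ofReal (|y| ^ (-(5 / 4) : ℝ) * Z y ^ 2)) (r * y) := by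
    rw [tailSq, ← lintegral_indicator measurableSet_tail, lintegral_comp_mul_right_real _ hr.ne',
      abs_of_pos hr, lintegral_const_mul' _ _ ENNReal.ofReal_ne_top]
  have eL : ∫⁻ y in Icc (-1 : ℝ) 1, ENNReal.ofReal (Z y ^ 2)
      = ∫⁻ y, ENNReal.ofReal r * (Icc (-1 : ℝ) 1).indicator
        (fun y => ENNReal.ofReal (Z y ^ 2)) (r * y) := by
    rw [← lintegral_indicator measurableSet_Icc, lintegral_comp_mul_right_real _ hr.ne',
      abs_of_pos hr, lintegral_const_mul' _ _ ENNReal.ofReal_ne_top]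
  have hm2 : Measurable fun y : ℝ => ENNReal.ofReal (|y| ^ (-(5 / 4) : ℝ) * Z y ^ 2) := by fun_prop
  have hm3 : Measurable fun y => ENNReal.ofReal r * {y : ℝ | 1 ≤ |y|}.indicator
      (fun y => ENNReal.ofReal (|y| ^ (-(5 / 4) : ℝ) * Z y ^ 2)) (r * y) :=
    Measurable.const_mul ((hm2.indicator measurableSet_tail).comp (measurable_const_mul r)) _
  rw [eA, eL, ← lintegral_indicator measurableSet_tail, ← lintegral_const_mul' _ _ (by norm_num),
    ← lintegral_const_mul' _ _ (by norm_num), ← lintegral_add_left hm3]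
  refine lintegral_mono fun y => ?_
  simp only [indicator, mem_ofPred_eq, mem_Icc, ← abs_le]
  by_cases h2 : 1 ≤ |y|
  swap
  · simp [h2]
  rw [if_pos h2]
  by_cases h3 : 1 ≤ |r * y|
  · rw [if_pos h3]
    refine le_add_right ?_
    rw [← ENNReal.ofReal_ofNat 2, ← ENNReal.ofReal_mul zero_le_two, ← ENNReal.ofReal_mul hr.le]
    refine ENNReal.ofReal_le_ofReal ?_
    rw [abs_mul, abs_of_pos hr, Real.mul_rpow hr.le (abs_nonneg _)]
    have h4 : 2 ≤ r * r ^ (-(5 / 4) : ℝ) := by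
      have e1 : r * r ^ (-(5 / 4) : ℝ) = r ^ (-(1 / 4) : ℝ) := by
        nth_rewrite 1 [← Real.rpow_one r]
        rw [← Real.rpow_add hr]; norm_num
      have e2 : ((1 / 16 : ℝ)) ^ (-(1 / 4) : ℝ) = 2 := by
        rw [show (1 / 16 : ℝ) = 2 ^ (-4 : ℝ) by norm_num [Real.rpow_neg],
          ← Real.rpow_mul zero_le_two]
        norm_num
      rw [e1, ← e2]
      exact Real.rpow_le_rpow_of_nonpos hr h1 (by norm_num)
    calc 2 * (|y| ^ (-(5 / 4) : ℝ) * Z (r * y) ^ 2)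
        ≤ (r * r ^ (-(5 / 4) : ℝ)) * (|y| ^ (-(5 / 4) : ℝ) * Z (r * y) ^ 2) := by gcongr
      _ = _ := by ring
  · rw [if_pos (le_of_lt (not_le.1 h3))]
    refine le_add_left ?_
    rw [← ENNReal.ofReal_ofNat 2, ← ENNReal.ofReal_ofNat 128, ← ENNReal.ofReal_mul zero_le_two,
      ← ENNReal.ofReal_mul hr.le, ← ENNReal.ofReal_mul (by norm_num)]
    refine ENNReal.ofReal_le_ofReal ?_
    have h4 : |y| ^ (-(5 / 4) : ℝ) ≤ 1 := Real.rpow_le_one_of_one_le_of_nonpos h2 (by norm_num)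
    have := sq_nonneg (Z (r * y))
    nlinarith [mul_le_mul_of_nonneg_right h4 this, mul_le_mul_of_nonneg_right h0 this]

theorem tailSq_step {Z : ℝ → ℝ} (hZ : Continuous Z) (hfin : tailSq Z ≠ ⊤) {r : ℝ}
    (h0 : 1 / 32 ≤ r) (h1 : r ≤ 1 / 16) :
    tailSq Z ≤ 12 * (∫⁻ y in {y : ℝ | 1 ≤ |y|},
        ENNReal.ofReal (|y| ^ (-(5 / 4) : ℝ) * (Z y - Z (r * y)) ^ 2))
      + 384 * ∫⁻ y in Icc (-1 : ℝ) 1, ENNReal.ofReal (Z y ^ 2) := by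
  have hm : Measurable Z := hZ.measurable
  have e := tailSq_dilate_le hZ h0 h1
  set D := ∫⁻ y in {y : ℝ | 1 ≤ |y|}, ENNReal.ofReal (|y| ^ (-(5 / 4) : ℝ) * (Z y - Z (r * y)) ^ 2)
  set E := ∫⁻ y in {y : ℝ | 1 ≤ |y|}, ENNReal.ofReal (|y| ^ (-(5 / 4) : ℝ) * Z (r * y) ^ 2) with hE
  set L := ∫⁻ y in Icc (-1 : ℝ) 1, ENNReal.ofReal (Z y ^ 2)
  have h2 : 4 * tailSq Z ≤ 12 * D + 6 * E := by
    rw [tailSq, ← lintegral_const_mul' _ _ (by norm_num), ← lintegral_const_mul' _ _ (by norm_num),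
      ← lintegral_const_mul' _ _ (by norm_num), ← lintegral_add_right _ (by fun_prop)]
    refine lintegral_mono fun y => ?_
    rw [← ENNReal.ofReal_ofNat 4, ← ENNReal.ofReal_ofNat 12, ← ENNReal.ofReal_ofNat 6,
      ← ENNReal.ofReal_mul (by norm_num), ← ENNReal.ofReal_mul (by norm_num),
      ← ENNReal.ofReal_mul (by norm_num), ← ENNReal.ofReal_add (by positivity) (by positivity)]
    refine ENNReal.ofReal_le_ofReal ?_
    have : 0 ≤ |y| ^ (-(5 / 4) : ℝ) := by positivity
    nlinarith [mul_nonneg this (sq_nonneg (2 * Z y - 3 * Z (r * y)))]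
  have h3 : 3 * tailSq Z + tailSq Z ≤ 3 * tailSq Z + (12 * D + 384 * L) := by
    calc 3 * tailSq Z + tailSq Z = 4 * tailSq Z := by ring
      _ ≤ 12 * D + 3 * (2 * E) := h2.trans_eq (by ring)
      _ ≤ 12 * D + 3 * (tailSq Z + 128 * L) := by gcongr
      _ = _ := by ring
  exact (ENNReal.add_le_add_iff_left (ENNReal.mul_ne_top (by norm_num) hfin)).1 h3

theorem lintegral_dilation_diff_le {Z : ℝ → ℝ} (hZ : Continuous Z) :
    ∫⁻ r in Icc (1 / 32 : ℝ) (1 / 16), ∫⁻ y in {y : ℝ | 1 ≤ |y|},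
      ENNReal.ofReal (|y| ^ (-(5 / 4) : ℝ) * (Z y - Z (r * y)) ^ 2) ≤ gagliardo Z := by
  have hm : Measurable Z := hZ.measurable
  rw [lintegral_lintegral_swap (by
    refine Measurable.aemeasurable ?_
    unfold Function.uncurry
    fun_prop)]
  refine (setLIntegral_mono' measurableSet_tail fun y hy => ?_).trans
    (setLIntegral_le_lintegral _ _)
  have hy1 : 1 ≤ |y| := hy
  have hy0 : y ≠ 0 := by rintro rfl; simp at hy1; linarith
  rw [lintegral_comp_mul_right_real _ hy0, ← lintegral_const_mul' _ _ ENNReal.ofReal_ne_top]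
  refine le_trans ?_ (setLIntegral_le_lintegral (Icc (1 / 32 : ℝ) (1 / 16)) _)
  refine setLIntegral_mono' measurableSet_Icc fun r hr => ?_
  rw [← ENNReal.ofReal_mul (abs_nonneg _)]
  refine ENNReal.ofReal_le_ofReal ?_
  have hr0 := hr.1
  have hr1 := hr.2
  have h2 : 0 < (y - y * r) ^ 2 := by
    have : y - y * r = y * (1 - r) := by ring
    rw [this]
    have : 1 - r ≠ 0 := by linarith
    positivity
  rw [mul_comm r y, ← mul_div_assoc, le_div_iff₀ h2]
  have h3 : |y| ^ (-(5 / 4) : ℝ) * (y - y * r) ^ 2 ≤ |y| := by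
    have h4 : |y| ^ (-(5 / 4) : ℝ) ≤ |y|⁻¹ := by
      rw [← Real.rpow_neg_one]
      exact Real.rpow_le_rpow_of_exponent_le hy1 (by norm_num)
    have h5 : (y - y * r) ^ 2 ≤ |y| ^ 2 := by
      rw [sq_abs, show y - y * r = y * (1 - r) by ring, mul_pow]
      have : (1 - r) ^ 2 ≤ 1 := by nlinarith
      exact mul_le_of_le_one_right (sq_nonneg y) this
    calc _ ≤ |y|⁻¹ * |y| ^ 2 := by gcongr
      _ = _ := by field_simp
  nlinarith [sq_nonneg (Z y - Z (y * r))]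

theorem tailSq_le {Z : ℝ → ℝ} (hZ : Continuous Z) (hfin : tailSq Z ≠ ⊤) :
    tailSq Z ≤ 384 * gagliardo Z + 384 * ∫⁻ y in Icc (-1 : ℝ) 1, ENNReal.ofReal (Z y ^ 2) := by
  have h := setLIntegral_mono' (μ := volume) (measurableSet_Icc (a := (1 / 32 : ℝ)) (b := 1 / 16))
    fun r hr => tailSq_step hZ hfin hr.1 hr.2
  rw [lintegral_add_right _ measurable_const, setLIntegral_const, setLIntegral_const,
    lintegral_const_mul' _ _ (by norm_num), Real.volume_Icc] at h
  have h2 := h.trans (add_le_add (mul_le_mul_right (lintegral_dilation_diff_le hZ) 12) le_rfl)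
  have h3 := mul_le_mul_right h2 32
  have e : (32 : ℝ≥0∞) * ENNReal.ofReal (1 / 16 - 1 / 32) = 1 := by
    rw [← ENNReal.ofReal_ofNat 32, ← ENNReal.ofReal_mul (by norm_num)]
    norm_num
  calc tailSq Z = 32 * (tailSq Z * ENNReal.ofReal (1 / 16 - 1 / 32)) := by
        rw [mul_left_comm, e, mul_one]
    _ ≤ _ := h3
    _ = 384 * gagliardo Z + 384 * (∫⁻ y in Icc (-1 : ℝ) 1, ENNReal.ofReal (Z y ^ 2))
        * (32 * ENNReal.ofReal (1 / 16 - 1 / 32)) := by ring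
    _ = _ := by rw [e, mul_one]

theorem weightedSq_le_split (Z : ℝ → ℝ) :
    weightedSq Z ≤ (∫⁻ y in Icc (-1 : ℝ) 1, ENNReal.ofReal (Z y ^ 2)) + tailSq Z := by
  rw [weightedSq, tailSq, ← lintegral_add_compl _ (measurableSet_Icc (a := (-1 : ℝ)) (b := 1))]
  refine add_le_add (lintegral_mono fun y => ENNReal.ofReal_le_ofReal ?_) ?_
  · exact div_le_self (sq_nonneg _) (one_le_pow₀ (one_le_wt y))
  · refine (lintegral_mono_set ?_).trans
      (setLIntegral_mono' measurableSet_tail fun y hy => ENNReal.ofReal_le_ofReal ?_)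
    · intro y hy
      simp only [mem_compl_iff, mem_Icc, ← abs_le, not_le] at hy
      exact hy.le
    · have hy1 : 1 ≤ |y| := hy
      rw [div_eq_mul_inv, mul_comm]
      gcongr
      rw [Real.rpow_neg (abs_nonneg _)]
      apply inv_anti₀ (by positivity)
      have : |y| ^ (5 / 4 : ℝ) ≤ (wt y ^ 4) ^ (5 / 4 : ℝ) := by
        gcongr
        exact abs_le_wt_pow_four y
      refine this.trans_eq ?_
      rw [← Real.rpow_natCast, ← Real.rpow_natCast, ← Real.rpow_mul (wt_pos y).le]
      norm_num

theorem weightedSq_le {Z : ℝ → ℝ} (hZ : Continuous Z)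
    (hfin : ∫⁻ y, ENNReal.ofReal (Z y ^ 2) ≠ ⊤) :
    weightedSq Z ≤ 9624 * (gagliardo Z + ENNReal.ofReal (bumpMean Z ^ 2)) := by
  have h1 : tailSq Z ≠ ⊤ := by
    refine ne_top_of_le_ne_top hfin (le_trans (setLIntegral_mono' measurableSet_tail fun y hy =>
      ENNReal.ofReal_le_ofReal ?_) (setLIntegral_le_lintegral {y : ℝ | 1 ≤ |y|} _))
    exact mul_le_of_le_one_left (sq_nonneg _)
      (Real.rpow_le_one_of_one_le_of_nonpos hy (by norm_num))
  have h2 := weightedSq_le_split Z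
  have h3 := tailSq_le hZ h1
  have h4 := lintegral_sq_near_zero_le hZ
  calc weightedSq Z ≤ _ := h2
    _ ≤ (∫⁻ y in Icc (-1 : ℝ) 1, ENNReal.ofReal (Z y ^ 2)) + (384 * gagliardo Z
        + 384 * ∫⁻ y in Icc (-1 : ℝ) 1, ENNReal.ofReal (Z y ^ 2)) := by gcongr
    _ = 384 * gagliardo Z + 385 * ∫⁻ y in Icc (-1 : ℝ) 1, ENNReal.ofReal (Z y ^ 2) := by ring
    _ ≤ 384 * gagliardo Z + 385 * (24 * gagliardo Z + 4 * ENNReal.ofReal (bumpMean Z ^ 2)) := by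
        gcongr
    _ ≤ 384 * gagliardo Z + 385 * (24 * gagliardo Z + 4 * ENNReal.ofReal (bumpMean Z ^ 2))
        + 8084 * ENNReal.ofReal (bumpMean Z ^ 2) := le_self_add
    _ = _ := by ring

/-- One-sided average of `f` against the kernel `κ` on `[0, 1]`. -/
def avg (κ f : ℝ → ℝ) (y : ℝ) : ℝ := ∫ η in (0 : ℝ)..1, κ η * f (y - η)

theorem hasDerivAt_avg {κ f f' : ℝ → ℝ} (hκ : Continuous κ) (hf : ∀ x, HasDerivAt f (f' x) x)
    (hf' : Continuous f') (y : ℝ) : HasDerivAt (avg κ f) (avg κ f' y) y := by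
  have hfc : Continuous f := continuous_iff_continuousAt.2 fun x => (hf x).continuousAt
  obtain ⟨B, hB⟩ := (isCompact_Icc (a := y - 2) (b := y + 2)).exists_bound_of_continuousOn
    hf'.continuousOn
  refine (intervalIntegral.hasDerivAt_integral_of_dominated_loc_of_deriv_le
    (F := fun x η => κ η * f (x - η)) (F' := fun x η => κ η * f' (x - η))
    (bound := fun η => |κ η| * B) (Metric.ball_mem_nhds y one_pos)
    (Filter.Eventually.of_forall fun x => ?_) ?_ ?_ ?_ ?_ ?_).2
  · exact (Continuous.aestronglyMeasurable (by fun_prop))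
  · exact Continuous.intervalIntegrable (by fun_prop) _ _
  · exact (Continuous.aestronglyMeasurable (by fun_prop))
  · refine Filter.Eventually.of_forall fun η hη x hx => ?_
    rw [uIoc_of_le zero_le_one] at hη
    rw [Metric.mem_ball, Real.dist_eq, abs_lt] at hx
    rw [norm_mul, norm_eq_abs]
    exact mul_le_mul_of_nonneg_left (hB _ ⟨by linarith [hη.2], by linarith [hη.1]⟩) (abs_nonneg _)
  · exact Continuous.intervalIntegrable (by fun_prop) _ _
  · refine Filter.Eventually.of_forall fun η _ x _ => ?_
    exact ((hf (x - η)).comp_sub_const x η).const_mul (κ η)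

theorem avg_deriv {κ κ' f f' : ℝ → ℝ} (hκ : ∀ x, HasDerivAt κ (κ' x) x) (hκ' : Continuous κ')
    (hf : ∀ x, HasDerivAt f (f' x) x) (hf' : Continuous f') (y : ℝ) :
    avg κ f' y = κ 0 * f y - κ 1 * f (y - 1) + avg κ' f y := by
  have hfc : Continuous f := continuous_iff_continuousAt.2 fun x => (hf x).continuousAt
  have hκc : Continuous κ := continuous_iff_continuousAt.2 fun x => (hκ x).continuousAt
  have h : ∀ η : ℝ, HasDerivAt (fun η => -(κ η * f (y - η)))
      (κ η * f' (y - η) - κ' η * f (y - η)) η := by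
    intro η
    refine ((hκ η).mul ((hf (y - η)).comp_const_sub y η)).neg.congr_deriv ?_
    ring
  have h2 := intervalIntegral.integral_eq_sub_of_hasDerivAt (a := 0) (b := 1) (fun η _ => h η)
    (Continuous.intervalIntegrable (by fun_prop) _ _)
  rw [intervalIntegral.integral_sub (Continuous.intervalIntegrable (by fun_prop) _ _)
    (Continuous.intervalIntegrable (by fun_prop) _ _)] at h2
  simp only [sub_zero] at h2
  unfold avg
  linarith

theorem abs_avg_le {κ f : ℝ → ℝ} {K : ℝ} (hf : Continuous f)
    (hK : ∀ η ∈ Icc (0 : ℝ) 1, |κ η| ≤ K) (y : ℝ) :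
    |avg κ f y| ≤ K * ∫ η in (0 : ℝ)..1, |f (y - η)| := by
  have hK0 : 0 ≤ K := (abs_nonneg _).trans (hK 0 (by simp))
  have hi : IntervalIntegrable (fun η => K * |f (y - η)|) volume 0 1 :=
    Continuous.intervalIntegrable (by fun_prop) _ _
  rw [← intervalIntegral.integral_const_mul]
  refine intervalIntegral.norm_integral_le_of_norm_le (f := fun η => κ η * f (y - η)) zero_le_one
    (Filter.Eventually.of_forall fun η hη => ?_) hi
  rw [norm_mul]
  exact mul_le_mul_of_nonneg_right (hK η (Ioc_subset_Icc_self hη)) (abs_nonneg _)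

theorem abs_avg_le_const {κ f : ℝ → ℝ} {K B y : ℝ}
    (hK : ∀ η ∈ Icc (0 : ℝ) 1, |κ η| ≤ K) (hB : ∀ η ∈ Icc (0 : ℝ) 1, |f (y - η)| ≤ B) :
    |avg κ f y| ≤ K * B := by
  have hK0 : 0 ≤ K := (abs_nonneg _).trans (hK 0 (by simp))
  have := intervalIntegral.norm_integral_le_of_norm_le_const (a := 0) (b := 1)
    (f := fun η => κ η * f (y - η)) (C := K * B) fun η hη => by
      rw [uIoc_of_le zero_le_one] at hη
      rw [norm_mul]
      exact mul_le_mul (hK η (Ioc_subset_Icc_self hη)) (hB η (Ioc_subset_Icc_self hη))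
        (abs_nonneg _) hK0
  simpa [avg] using this

theorem inv_wt_sub_le {y η : ℝ} (hη : η ∈ Icc (0 : ℝ) 1) : 1 / wt (y - η) ≤ 2 / wt y := by
  have h := wt_lipschitz y (y - η)
  rw [show y - (y - η) = η by ring, abs_of_nonneg hη.1] at h
  rw [div_le_div_iff₀ (wt_pos _) (wt_pos _)]
  linarith [hη.2, one_le_wt (y - η)]

theorem abs_avg_le_div_wt {κ f : ℝ → ℝ} {K δ : ℝ} (hδ : 0 ≤ δ)
    (hK : ∀ η ∈ Icc (0 : ℝ) 1, |κ η| ≤ K) (hf : ∀ x, |f x| ≤ δ / wt x) (y : ℝ) :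
    |avg κ f y| ≤ 2 * K * (δ / wt y) := by
  refine (abs_avg_le_const hK (B := δ * (2 / wt y)) fun η hη => (hf _).trans ?_).trans_eq (by ring)
  rw [div_eq_mul_one_div]
  exact mul_le_mul_of_nonneg_left (inv_wt_sub_le hη) hδ

theorem avg_add {κ f g : ℝ → ℝ} (hκ : Continuous κ) (hf : Continuous f) (hg : Continuous g)
    (y : ℝ) : avg κ (fun x => f x + g x) y = avg κ f y + avg κ g y := by
  unfold avg
  rw [← intervalIntegral.integral_add (Continuous.intervalIntegrable (by fun_prop) _ _)
    (Continuous.intervalIntegrable (by fun_prop) _ _)]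
  simp_rw [mul_add]

theorem avg_const_mul (κ f : ℝ → ℝ) (a y : ℝ) :
    avg κ (fun x => a * f x) y = a * avg κ f y := by
  unfold avg
  rw [← intervalIntegral.integral_const_mul]
  congr 1; ext η; ring

/-- The average of `x f(x)` in terms of averages of `f`. -/
theorem avg_id_mul {κ f : ℝ → ℝ} (hκ : Continuous κ) (hf : Continuous f) (y : ℝ) :
    avg κ (fun x => x * f x) y = y * avg κ f y - avg (fun η => η * κ η) f y := by
  unfold avg
  rw [← intervalIntegral.integral_const_mul,
    ← intervalIntegral.integral_sub (Continuous.intervalIntegrable (by fun_prop) _ _)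
    (Continuous.intervalIntegrable (by fun_prop) _ _)]
  congr 1; ext η; ring

theorem exists_bound_kernels (l : List (ℝ → ℝ)) (hl : ∀ κ ∈ l, Continuous κ) :
    ∃ K : ℝ, 1 ≤ K ∧ ∀ κ ∈ l, ∀ η ∈ Icc (0 : ℝ) 1, |κ η| ≤ K := by
  induction l with
  | nil => exact ⟨1, le_rfl, by simp⟩
  | cons κ l ih =>
    obtain ⟨K, hK1, hK⟩ := ih fun κ hκ => hl κ (List.mem_cons_of_mem _ hκ)
    obtain ⟨B, hB⟩ := (isCompact_Icc (a := (0 : ℝ)) (b := 1)).exists_bound_of_continuousOn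
      (hl κ (by simp)).continuousOn
    refine ⟨max K B, hK1.trans (le_max_left _ _), fun κ' hκ' η hη => ?_⟩
    rcases List.mem_cons.1 hκ' with rfl | h
    · exact (hB η hη).trans (le_max_right _ _)
    · exact (hK κ' h η hη).trans (le_max_left _ _)

theorem exists_bound_of_continuous {n : ℕ} {P : (Fin n → ℝ) → ℝ} (hP : Continuous P) (K : ℝ) :
    ∃ C : ℝ, 1 ≤ C ∧ ∀ v : Fin n → ℝ, (∀ i, |v i| ≤ K) → |P v| ≤ C := by
  obtain ⟨B, hB⟩ := (isCompact_univ_pi fun _ : Fin n =>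
    isCompact_Icc (a := -K) (b := K)).exists_bound_of_continuousOn hP.continuousOn
  exact ⟨max 1 B, le_max_left _ _, fun v hv =>
    (hB v fun i _ => abs_le.1 (hv i)).trans (le_max_right _ _)⟩

/-- Values at a point `y` of the quantities entering the normal form correction: the multiplier
`m0` and its derivatives, the profile `U` and its derivative, the vector field quantity `Z`, and
averages of these. The fields `sh`, `s1h` are copies of `s`, `s1` for which a better decay bound
is used. -/
structure Jet where
  y : ℝ
  m0 : ℝ
  m1 : ℝ
  m2 : ℝ
  m3 : ℝ
  m4 : ℝ
  U : ℝ
  U1 : ℝ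
  Z : ℝ
  V : ℝ
  s : ℝ
  s1 : ℝ
  s2 : ℝ
  s3 : ℝ
  SZ : ℝ
  S1Z : ℝ
  sh : ℝ
  s1h : ℝ

namespace Jet

/-- The natural size bounds, with `r` standing for `(1 + y²)^{-1/8}`. -/
structure Bounded (K δ Q r : ℝ) (j : Jet) : Prop where
  y : |j.y| ≤ K * (1 / r ^ 4)
  m0 : |j.m0| ≤ K * (r ^ 4)
  m1 : |j.m1| ≤ K * (r ^ 8)
  m2 : |j.m2| ≤ K * (r ^ 12)
  m3 : |j.m3| ≤ K * (r ^ 16)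
  m4 : |j.m4| ≤ K * (r ^ 20)
  U : |j.U| ≤ K * (δ * r)
  U1 : |j.U1| ≤ K * (δ / r)
  Z : |j.Z| ≤ K * (Q)
  V : |j.V| ≤ K * (δ * r)
  s : |j.s| ≤ K * (δ * r)
  s1 : |j.s1| ≤ K * (δ * r)
  s2 : |j.s2| ≤ K * (δ * r)
  s3 : |j.s3| ≤ K * (δ * r)
  SZ : |j.SZ| ≤ K * (Q)
  S1Z : |j.S1Z| ≤ K * (Q)
  sh : |j.sh| ≤ K * (r ^ 4 * Q)
  s1h : |j.s1h| ≤ K * (r ^ 4 * Q)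

/-- The part of the remainder that is not of the form coefficient times `Z`. -/
def rem (j : Jet) : ℝ :=
  j.U ^ 2 - j.y * j.m0 * j.U ^ 2 - 3 * j.m0 * j.U1 ^ 2 + 2 / 3 * j.y * j.m0 * j.U * j.s + 1 / 3 *
  j.m0 * j.U * j.SZ + 3 * j.m0 * j.U1 * j.s1 + j.m0 * j.U * j.s2 - 2 / 3 * (j.m0 + j.y * j.m1) *
  j.U * j.V - 6 * j.m0 * j.U ^ 3 + 3 * j.m0 * j.U ^ 2 * j.s - 3 * j.m1 * j.U ^ 2 * j.V + j.m1 *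
  (-9 * j.U * j.U1 + 6 * j.U1 * j.s + 3 * j.U * j.s1) + j.m2 * (-3 * j.U1 * j.V - 3 * j.U ^ 2 + 3
  * j.U * j.s) - j.m3 * j.U * j.V

/-- The derivative of `Jet.rem`, after using the profile equation. -/
def remD (p : ℝ) (j : Jet) : ℝ :=
  -(j.m0 + j.y * j.m1) * j.U ^ 2 + 2 * p * j.U * j.U1 - 3 * j.m1 * j.U1 ^ 2 + 2 * j.m0 * j.U1 *
  j.Z - 18 * j.m0 * j.U1 * j.U ^ 2 + 2 / 3 * (j.m0 + j.y * j.m1) * j.U * j.s + 2 / 3 * j.y * j.m0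
  * j.U1 * j.sh + 2 / 3 * j.y * j.m0 * j.U * j.s1h + 1 / 3 * (j.m1 * j.U * j.SZ + j.m0 * j.U1 *
  j.SZ + j.m0 * j.U * j.S1Z) + 3 * j.m1 * j.U1 * j.s1 + j.m0 * (j.y * j.U * j.s1h - j.Z * j.s1 + 9
  * j.U ^ 2 * j.s1) + 3 * j.m0 * j.U1 * j.s2 + j.m1 * j.U * j.s2 + j.m0 * j.U1 * j.s2 + j.m0 * j.U
  * j.s3 - 2 / 3 * (2 * j.m1 + j.y * j.m2) * j.U * j.V - 2 / 3 * (j.m0 + j.y * j.m1) * (j.U1 * j.V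
  + j.U * (j.U - j.s)) - 6 * j.m1 * j.U ^ 3 - 18 * j.m0 * j.U ^ 2 * j.U1 + 3 * j.m1 * j.U ^ 2 *
  j.s + 6 * j.m0 * j.U * j.U1 * j.s + 3 * j.m0 * j.U ^ 2 * j.s1 - 3 * j.m2 * j.U ^ 2 * j.V - 6 *
  j.m1 * j.U * j.U1 * j.V - 3 * j.m1 * j.U ^ 2 * (j.U - j.s) + j.m2 * (-9 * j.U * j.U1 + 6 * j.U1
  * j.s + 3 * j.U * j.s1) + j.m1 * (-9 * j.U1 ^ 2 + 9 * j.U1 * j.s1 + 3 * j.U * j.s2) + j.m1 *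
  (j.y * j.U - j.Z + 9 * j.U ^ 2) * (-3 * j.U + 2 * j.s) + j.m3 * (-3 * j.U1 * j.V - 3 * j.U ^ 2 +
  3 * j.U * j.s) + j.m2 * (-3 * j.U1 * (j.U - j.s) - 6 * j.U * j.U1 + 3 * j.U1 * j.s + 3 * j.U *
  j.s1) - j.m2 * (j.y * j.U - j.Z + 9 * j.U ^ 2) * j.V - j.m4 * j.U * j.V - j.m3 * j.U1 * j.V -
  j.m3 * j.U * (j.U - j.s)

/-- The coefficient of `Z` in the remainder. -/
def coef (j : Jet) : ℝ :=
  j.m0 * (j.U - j.s) + j.m1 * j.V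

/-- The derivative of `Jet.coef`. -/
def coefD (j : Jet) : ℝ :=
  2 * j.m1 * (j.U - j.s) + j.m0 * (j.U1 - j.s1) + j.m2 * j.V

/-- The normal form correction. -/
def cor (j : Jet) : ℝ :=
  j.m0 * j.U * j.V

/-- The derivative of `Jet.cor`. -/
def corD (j : Jet) : ℝ :=
  j.m1 * j.U * j.V + j.m0 * j.U1 * j.V + j.m0 * j.U * (j.U - j.s)

theorem exists_eq_mul {x K w : ℝ} (hw : 0 < w) (h : |x| ≤ K * w) : ∃ a, |a| ≤ K ∧ x = a * w :=
  ⟨x / w, by rwa [abs_div, abs_of_pos hw, div_le_iff₀ hw], by field_simp⟩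

/-- Rescaled variables: bounded quantities in terms of which the jet is expressed. -/
theorem Bounded.exists_rescaled {K δ Q r : ℝ} {j : Jet} (hj : j.Bounded K δ Q r) (hK : 1 ≤ K)
    (hr : 0 < r) (hr1 : r ≤ 1) (hδ : 0 < δ) (hδ1 : δ ≤ 1) (hQ : δ ≤ Q) :
    ∃ v : Fin 21 → ℝ, (∀ i, |v i| ≤ K) ∧ v 0 = δ ∧ v 2 = r ∧ δ = v 1 * Q ∧
      j.y = v 3 * (1 / r ^ 4) ∧ j.m0 = v 4 * (r ^ 4) ∧ j.m1 = v 5 * (r ^ 8) ∧ j.m2 = v 6 * (r ^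
      12) ∧ j.m3 = v 7 * (r ^ 16) ∧ j.m4 = v 8 * (r ^ 20) ∧ j.U = v 9 * (δ * r) ∧ j.U1 = v 10 * (δ
      / r) ∧ j.Z = v 11 * (Q) ∧ j.V = v 12 * (δ * r) ∧ j.s = v 13 * (δ * r) ∧ j.s1 = v 14 * (δ *
      r) ∧ j.s2 = v 15 * (δ * r) ∧ j.s3 = v 16 * (δ * r) ∧ j.SZ = v 17 * (Q) ∧ j.S1Z = v 18 * (Q)
      ∧ j.sh = v 19 * (r ^ 4 * Q) ∧ j.s1h = v 20 * (r ^ 4 * Q) := by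
  have hQ0 : 0 < Q := hδ.trans_le hQ
  obtain ⟨vy, hy, ey⟩ := exists_eq_mul (by positivity) hj.y
  obtain ⟨vm0, hm0, em0⟩ := exists_eq_mul (by positivity) hj.m0
  obtain ⟨vm1, hm1, em1⟩ := exists_eq_mul (by positivity) hj.m1
  obtain ⟨vm2, hm2, em2⟩ := exists_eq_mul (by positivity) hj.m2
  obtain ⟨vm3, hm3, em3⟩ := exists_eq_mul (by positivity) hj.m3
  obtain ⟨vm4, hm4, em4⟩ := exists_eq_mul (by positivity) hj.m4
  obtain ⟨vU, hU, eU⟩ := exists_eq_mul (by positivity) hj.U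
  obtain ⟨vU1, hU1, eU1⟩ := exists_eq_mul (by positivity) hj.U1
  obtain ⟨vZ, hZ, eZ⟩ := exists_eq_mul (by positivity) hj.Z
  obtain ⟨vV, hV, eV⟩ := exists_eq_mul (by positivity) hj.V
  obtain ⟨vs, hs, es⟩ := exists_eq_mul (by positivity) hj.s
  obtain ⟨vs1, hs1, es1⟩ := exists_eq_mul (by positivity) hj.s1
  obtain ⟨vs2, hs2, es2⟩ := exists_eq_mul (by positivity) hj.s2
  obtain ⟨vs3, hs3, es3⟩ := exists_eq_mul (by positivity) hj.s3
  obtain ⟨vSZ, hSZ, eSZ⟩ := exists_eq_mul (by positivity) hj.SZ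
  obtain ⟨vS1Z, hS1Z, eS1Z⟩ := exists_eq_mul (by positivity) hj.S1Z
  obtain ⟨vsh, hsh, esh⟩ := exists_eq_mul (by positivity) hj.sh
  obtain ⟨vs1h, hs1h, es1h⟩ := exists_eq_mul (by positivity) hj.s1h
  refine ⟨![δ, δ / Q, r, vy, vm0, vm1, vm2, vm3, vm4, vU, vU1, vZ, vV, vs, vs1, vs2, vs3, vSZ,
    vS1Z, vsh, vs1h], ?_, rfl, rfl, ?_,
    ey, em0, em1, em2, em3, em4, eU, eU1, eZ, eV, es, es1, es2, es3, eSZ, eS1Z, esh, es1h⟩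
  · have h1 : |δ| ≤ K := by rw [abs_of_pos hδ]; linarith
    have h2 : |δ / Q| ≤ K := by
      rw [abs_of_pos (by positivity)]; exact ((div_le_one hQ0).2 hQ).trans hK
    have h3 : |r| ≤ K := by rw [abs_of_pos hr]; linarith
    intro i
    fin_cases i <;> assumption
  · change δ = δ / Q * Q
    field_simp

theorem exists_rem_bound {K : ℝ} (hK : 1 ≤ K) : ∃ C : ℝ, 1 ≤ C ∧ ∀ {δ Q r : ℝ} {j : Jet},
    j.Bounded K δ Q r → 0 < r → r ≤ 1 → 0 < δ → δ ≤ 1 → δ ≤ Q →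
      |j.rem| ≤ C * (δ * Q * r ^ 2) := by
  obtain ⟨C, hC1, hC⟩ := exists_bound_of_continuous (n := 21) (P := fun v =>
    (1 / 3) * v 2 ^ 3 * v 17 * v 9 * v 4 + v 1 * v 9 * v 9 + (-6) * v 0 * v 1 * v 2 ^ 5 * v 9 * v
    9 * v 9 * v 4 + (-3) * v 0 * v 1 * v 2 ^ 9 * v 9 * v 9 * v 12 * v 5 + (3) * v 0 * v 1 * v 2 ^
    5 * v 9 * v 9 * v 4 * v 13 + (-1) * v 1 * v 9 * v 9 * v 4 * v 3 + (-3) * v 1 * v 2 ^ 12 * v 9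
    * v 9 * v 6 + (-9) * v 1 * v 2 ^ 6 * v 9 * v 10 * v 5 + (-2 / 3) * v 1 * v 2 ^ 4 * v 9 * v 12
    * v 4 + (-2 / 3) * v 1 * v 2 ^ 4 * v 9 * v 12 * v 5 * v 3 + (-1) * v 1 * v 2 ^ 16 * v 9 * v 12
    * v 7 + (2 / 3) * v 1 * v 9 * v 4 * v 13 * v 3 + v 1 * v 2 ^ 4 * v 9 * v 4 * v 15 + (3) * v 1
    * v 2 ^ 8 * v 9 * v 5 * v 14 + (3) * v 1 * v 2 ^ 12 * v 9 * v 6 * v 13 + (-3) * v 1 * v 10 * v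
    10 * v 4 + (-3) * v 1 * v 2 ^ 10 * v 10 * v 12 * v 6 + (3) * v 1 * v 2 ^ 2 * v 10 * v 4 * v 14
    + (6) * v 1 * v 2 ^ 6 * v 10 * v 5 * v 13)
    (by fun_prop) K
  refine ⟨C, hC1, fun {δ Q r j} hj hr hr1 hδ hδ1 hQ => ?_⟩
  have hQ0 : 0 < Q := hδ.trans_le hQ
  obtain ⟨v, hv, h0, h2, hd, ey, em0, em1, em2, em3, em4, eU, eU1, eZ, eV, es, es1, es2, es3, eSZ,
    eS1Z, esh, es1h⟩ :=
    hj.exists_rescaled hK hr hr1 hδ hδ1 hQ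
  refine le_of_eq_of_le ?_ (mul_le_mul_of_nonneg_right (hC v hv)
    (show 0 ≤ δ * Q * r ^ 2 by positivity))
  rw [← abs_of_pos (show 0 < δ * Q * r ^ 2 by positivity), ← abs_mul]
  congr 1
  unfold rem
  simp only [ey, em0, em1, em2, em3, eU, eU1, eV, es, es1, es2, eSZ, h0, h2]
  simp only [hd]
  field_simp
  ring

theorem exists_remD_bound {K : ℝ} (hK : 1 ≤ K) : ∃ C : ℝ, 1 ≤ C ∧ ∀ {δ Q r : ℝ} {j : Jet},
    j.Bounded K δ Q r → 0 < r → r ≤ 1 → 0 < δ → δ ≤ 1 → δ ≤ Q →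
      |j.remD (r ^ 8)| ≤ C * (δ * Q * r ^ 3) := by
  obtain ⟨C, hC1, hC⟩ := exists_bound_of_continuous (n := 21) (P := fun v =>
    (1 / 3) * v 2 ^ 2 * v 18 * v 9 * v 4 + (1 / 3) * v 2 ^ 6 * v 17 * v 9 * v 5 + (1 / 3) * v 17 *
    v 10 * v 4 + (-36) * v 0 * v 1 * v 2 ^ 8 * v 9 * v 9 * v 9 * v 5 + (-36) * v 0 * v 1 * v 2 ^ 2
    * v 9 * v 9 * v 10 * v 4 + (-12) * v 0 * v 1 * v 2 ^ 12 * v 9 * v 9 * v 12 * v 6 + (-5 / 3) *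
    v 1 * v 2 ^ 3 * v 9 * v 9 * v 4 + (12) * v 0 * v 1 * v 2 ^ 4 * v 9 * v 9 * v 4 * v 14 + (24) *
    v 0 * v 1 * v 2 ^ 8 * v 9 * v 9 * v 5 * v 13 + (-14 / 3) * v 1 * v 2 ^ 3 * v 9 * v 9 * v 5 * v
    3 + (-4) * v 1 * v 2 ^ 15 * v 9 * v 9 * v 7 + (-6) * v 0 * v 1 * v 2 ^ 6 * v 9 * v 10 * v 12 *
    v 5 + (6) * v 0 * v 1 * v 2 ^ 2 * v 9 * v 10 * v 4 * v 13 + (-18) * v 1 * v 2 ^ 9 * v 9 * v 10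
    * v 6 + (2) * v 1 * v 2 ^ 5 * v 9 * v 10 + (-4 / 3) * v 1 * v 2 ^ 7 * v 9 * v 12 * v 5 + (-5 /
    3) * v 1 * v 2 ^ 7 * v 9 * v 12 * v 6 * v 3 + (-1) * v 1 * v 2 ^ 19 * v 9 * v 12 * v 8 + (3) *
    v 2 ^ 6 * v 9 * v 11 * v 5 + (4 / 3) * v 1 * v 2 ^ 3 * v 9 * v 4 * v 13 + (5 / 3) * v 2 ^ 2 *
    v 9 * v 4 * v 20 * v 3 + v 1 * v 2 ^ 3 * v 9 * v 4 * v 16 + (10 / 3) * v 1 * v 2 ^ 3 * v 9 * v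
    5 * v 13 * v 3 + (4) * v 1 * v 2 ^ 7 * v 9 * v 5 * v 15 + (6) * v 1 * v 2 ^ 11 * v 9 * v 6 * v
    14 + (4) * v 1 * v 2 ^ 15 * v 9 * v 7 * v 13 + (-12) * v 1 * v 2 ^ 3 * v 10 * v 10 * v 5 + (-2
    / 3) * v 1 * v 2 * v 10 * v 12 * v 4 + (-2 / 3) * v 1 * v 2 * v 10 * v 12 * v 5 * v 3 + (-4) *
    v 1 * v 2 ^ 13 * v 10 * v 12 * v 7 + (2) * v 10 * v 11 * v 4 + (4) * v 1 * v 2 * v 10 * v 4 *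
    v 15 + (2 / 3) * v 10 * v 4 * v 19 * v 3 + (12) * v 1 * v 2 ^ 5 * v 10 * v 5 * v 14 + (12) * v
    1 * v 2 ^ 9 * v 10 * v 6 * v 13 + v 2 ^ 10 * v 12 * v 11 * v 6 + (-1) * v 2 ^ 2 * v 11 * v 4 *
    v 14 + (-2) * v 2 ^ 6 * v 11 * v 5 * v 13)
    (by fun_prop) K
  refine ⟨C, hC1, fun {δ Q r j} hj hr hr1 hδ hδ1 hQ => ?_⟩
  have hQ0 : 0 < Q := hδ.trans_le hQ
  obtain ⟨v, hv, h0, h2, hd, ey, em0, em1, em2, em3, em4, eU, eU1, eZ, eV, es, es1, es2, es3, eSZ,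
    eS1Z, esh, es1h⟩ :=
    hj.exists_rescaled hK hr hr1 hδ hδ1 hQ
  refine le_of_eq_of_le ?_ (mul_le_mul_of_nonneg_right (hC v hv)
    (show 0 ≤ δ * Q * r ^ 3 by positivity))
  rw [← abs_of_pos (show 0 < δ * Q * r ^ 3 by positivity), ← abs_mul]
  congr 1
  unfold remD
  simp only [ey, em0, em1, em2, em3, em4, eU, eU1, eZ, eV, es, es1, es2, es3, eSZ, eS1Z, esh,
    es1h, h0, h2]
  simp only [hd]
  field_simp
  ring

theorem exists_coef_bound {K : ℝ} (hK : 1 ≤ K) : ∃ C : ℝ, 1 ≤ C ∧ ∀ {δ Q r : ℝ} {j : Jet},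
    j.Bounded K δ Q r → 0 < r → r ≤ 1 → 0 < δ → δ ≤ 1 → δ ≤ Q →
      |j.coef| ≤ C * (δ * r ^ 5) := by
  obtain ⟨C, hC1, hC⟩ := exists_bound_of_continuous (n := 21) (P := fun v =>
    v 9 * v 4 + v 2 ^ 4 * v 12 * v 5 + (-1) * v 4 * v 13)
    (by fun_prop) K
  refine ⟨C, hC1, fun {δ Q r j} hj hr hr1 hδ hδ1 hQ => ?_⟩
  have hQ0 : 0 < Q := hδ.trans_le hQ
  obtain ⟨v, hv, h0, h2, hd, ey, em0, em1, em2, em3, em4, eU, eU1, eZ, eV, es, es1, es2, es3, eSZ,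
    eS1Z, esh, es1h⟩ :=
    hj.exists_rescaled hK hr hr1 hδ hδ1 hQ
  refine le_of_eq_of_le ?_ (mul_le_mul_of_nonneg_right (hC v hv)
    (show 0 ≤ δ * r ^ 5 by positivity))
  rw [← abs_of_pos (show 0 < δ * r ^ 5 by positivity), ← abs_mul]
  congr 1
  unfold coef
  simp only [em0, em1, eU, eV, es, h2]
  simp only [hd]
  field_simp
  ring

theorem exists_coefD_bound {K : ℝ} (hK : 1 ≤ K) : ∃ C : ℝ, 1 ≤ C ∧ ∀ {δ Q r : ℝ} {j : Jet},
    j.Bounded K δ Q r → 0 < r → r ≤ 1 → 0 < δ → δ ≤ 1 → δ ≤ Q →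
      |j.coefD| ≤ C * (δ * r ^ 3) := by
  obtain ⟨C, hC1, hC⟩ := exists_bound_of_continuous (n := 21) (P := fun v =>
    (2) * v 2 ^ 6 * v 9 * v 5 + v 10 * v 4 + v 2 ^ 10 * v 12 * v 6 + (-1) * v 2 ^ 2 * v 4 * v 14 +
    (-2) * v 2 ^ 6 * v 5 * v 13)
    (by fun_prop) K
  refine ⟨C, hC1, fun {δ Q r j} hj hr hr1 hδ hδ1 hQ => ?_⟩
  have hQ0 : 0 < Q := hδ.trans_le hQ
  obtain ⟨v, hv, h0, h2, hd, ey, em0, em1, em2, em3, em4, eU, eU1, eZ, eV, es, es1, es2, es3, eSZ,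
    eS1Z, esh, es1h⟩ :=
    hj.exists_rescaled hK hr hr1 hδ hδ1 hQ
  refine le_of_eq_of_le ?_ (mul_le_mul_of_nonneg_right (hC v hv)
    (show 0 ≤ δ * r ^ 3 by positivity))
  rw [← abs_of_pos (show 0 < δ * r ^ 3 by positivity), ← abs_mul]
  congr 1
  unfold coefD
  simp only [em0, em1, em2, eU, eU1, eV, es, es1, h2]
  simp only [hd]
  field_simp
  ring

theorem exists_cor_bound {K : ℝ} (hK : 1 ≤ K) : ∃ C : ℝ, 1 ≤ C ∧ ∀ {δ Q r : ℝ} {j : Jet},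
    j.Bounded K δ Q r → 0 < r → r ≤ 1 → 0 < δ → δ ≤ 1 → δ ≤ Q →
      |j.cor| ≤ C * (δ * Q * r ^ 2) := by
  obtain ⟨C, hC1, hC⟩ := exists_bound_of_continuous (n := 21) (P := fun v =>
    v 1 * v 2 ^ 4 * v 9 * v 12 * v 4)
    (by fun_prop) K
  refine ⟨C, hC1, fun {δ Q r j} hj hr hr1 hδ hδ1 hQ => ?_⟩
  have hQ0 : 0 < Q := hδ.trans_le hQ
  obtain ⟨v, hv, h0, h2, hd, ey, em0, em1, em2, em3, em4, eU, eU1, eZ, eV, es, es1, es2, es3, eSZ,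
    eS1Z, esh, es1h⟩ :=
    hj.exists_rescaled hK hr hr1 hδ hδ1 hQ
  refine le_of_eq_of_le ?_ (mul_le_mul_of_nonneg_right (hC v hv)
    (show 0 ≤ δ * Q * r ^ 2 by positivity))
  rw [← abs_of_pos (show 0 < δ * Q * r ^ 2 by positivity), ← abs_mul]
  congr 1
  unfold cor
  simp only [em0, eU, eV, h2]
  simp only [hd]
  field_simp

theorem exists_corD_bound {K : ℝ} (hK : 1 ≤ K) : ∃ C : ℝ, 1 ≤ C ∧ ∀ {δ Q r : ℝ} {j : Jet},
    j.Bounded K δ Q r → 0 < r → r ≤ 1 → 0 < δ → δ ≤ 1 → δ ≤ Q →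
      |j.corD| ≤ C * (δ * Q * r ^ 3) := by
  obtain ⟨C, hC1, hC⟩ := exists_bound_of_continuous (n := 21) (P := fun v =>
    v 1 * v 2 ^ 3 * v 9 * v 9 * v 4 + v 1 * v 2 ^ 7 * v 9 * v 12 * v 5 + (-1) * v 1 * v 2 ^ 3 * v
    9 * v 4 * v 13 + v 1 * v 2 * v 10 * v 12 * v 4)
    (by fun_prop) K
  refine ⟨C, hC1, fun {δ Q r j} hj hr hr1 hδ hδ1 hQ => ?_⟩
  have hQ0 : 0 < Q := hδ.trans_le hQ
  obtain ⟨v, hv, h0, h2, hd, ey, em0, em1, em2, em3, em4, eU, eU1, eZ, eV, es, es1, es2, es3, eSZ,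
    eS1Z, esh, es1h⟩ :=
    hj.exists_rescaled hK hr hr1 hδ hδ1 hQ
  refine le_of_eq_of_le ?_ (mul_le_mul_of_nonneg_right (hC v hv)
    (show 0 ≤ δ * Q * r ^ 3 by positivity))
  rw [← abs_of_pos (show 0 < δ * Q * r ^ 3 by positivity), ← abs_mul]
  congr 1
  unfold corD
  simp only [em0, em1, eU, eU1, eV, es, h2]
  simp only [hd]
  field_simp
  ring

end Jet

/-- Smooth cutoff on `[0, 1]`, equal to `1` at `0` and to `0` at `1`, with derivative `-bump`. -/
def cutoff (η : ℝ) : ℝ := 1 - (35 * η ^ 4 - 84 * η ^ 5 + 70 * η ^ 6 - 20 * η ^ 7)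

/-- First derivative of `bump`. -/
def bump1 (η : ℝ) : ℝ := 140 * (3 * η ^ 2 - 12 * η ^ 3 + 15 * η ^ 4 - 6 * η ^ 5)

/-- Second derivative of `bump`. -/
def bump2 (η : ℝ) : ℝ := 140 * (6 * η - 36 * η ^ 2 + 60 * η ^ 3 - 30 * η ^ 4)

/-- Third derivative of `bump`. -/
def bump3 (η : ℝ) : ℝ := 140 * (6 - 72 * η + 180 * η ^ 2 - 120 * η ^ 3)

@[fun_prop] theorem continuous_cutoff : Continuous cutoff := by unfold cutoff; fun_prop
@[fun_prop] theorem continuous_bump1 : Continuous bump1 := by unfold bump1; fun_prop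
@[fun_prop] theorem continuous_bump2 : Continuous bump2 := by unfold bump2; fun_prop
@[fun_prop] theorem continuous_bump3 : Continuous bump3 := by unfold bump3; fun_prop

theorem hasDerivAt_cutoff (η : ℝ) : HasDerivAt cutoff (-bump η) η := by
  refine (((((hasDerivAt_pow 4 η).const_mul 35).sub ((hasDerivAt_pow 5 η).const_mul 84)).add
    ((hasDerivAt_pow 6 η).const_mul 70)).sub
      ((hasDerivAt_pow 7 η).const_mul 20)).const_sub 1 |>.congr_deriv ?_
  unfold bump; push_cast; ring

theorem hasDerivAt_bump (η : ℝ) : HasDerivAt bump (bump1 η) η := by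
  refine (((hasDerivAt_pow 3 η).const_mul 140).mul
    (((hasDerivAt_id η).const_sub 1).pow 3)).congr_deriv ?_
  simp only [Pi.pow_apply, id_eq]
  unfold bump1; push_cast; ring

theorem hasDerivAt_bump1 (η : ℝ) : HasDerivAt bump1 (bump2 η) η := by
  refine (((((hasDerivAt_pow 2 η).const_mul 3).sub ((hasDerivAt_pow 3 η).const_mul 12)).add
    ((hasDerivAt_pow 4 η).const_mul 15)).sub
      ((hasDerivAt_pow 5 η).const_mul 6)).const_mul 140 |>.congr_deriv ?_
  unfold bump2; push_cast; ring

theorem hasDerivAt_bump2 (η : ℝ) : HasDerivAt bump2 (bump3 η) η := by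
  refine (((((hasDerivAt_id η).const_mul 6).sub ((hasDerivAt_pow 2 η).const_mul 36)).add
    ((hasDerivAt_pow 3 η).const_mul 60)).sub
      ((hasDerivAt_pow 4 η).const_mul 30)).const_mul 140 |>.congr_deriv ?_
  unfold bump3; push_cast; ring

section averages

variable {f f' : ℝ → ℝ}

theorem avg_neg_kernel (κ f : ℝ → ℝ) (y : ℝ) : avg (fun η => -κ η) f y = -avg κ f y := by
  simp [avg]

theorem avg_cutoff_deriv (hf : ∀ x, HasDerivAt f (f' x) x) (hf' : Continuous f') (y : ℝ) :
    avg cutoff f' y = f y - avg bump f y := by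
  rw [avg_deriv hasDerivAt_cutoff (by fun_prop) hf hf', avg_neg_kernel]
  norm_num [cutoff, sub_eq_add_neg]

theorem avg_bump_deriv (hf : ∀ x, HasDerivAt f (f' x) x) (hf' : Continuous f') (y : ℝ) :
    avg bump f' y = avg bump1 f y := by
  rw [avg_deriv hasDerivAt_bump (by fun_prop) hf hf']
  norm_num [bump]

theorem avg_bump1_deriv (hf : ∀ x, HasDerivAt f (f' x) x) (hf' : Continuous f') (y : ℝ) :
    avg bump1 f' y = avg bump2 f y := by
  rw [avg_deriv hasDerivAt_bump1 (by fun_prop) hf hf']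
  norm_num [bump1]

theorem avg_bump2_deriv (hf : ∀ x, HasDerivAt f (f' x) x) (hf' : Continuous f') (y : ℝ) :
    avg bump2 f' y = avg bump3 f y := by
  rw [avg_deriv hasDerivAt_bump2 (by fun_prop) hf hf']
  norm_num [bump2]

theorem hasDerivAt_avg_cutoff (hf : ∀ x, HasDerivAt f (f' x) x) (hf' : Continuous f') (y : ℝ) :
    HasDerivAt (avg cutoff f) (f y - avg bump f y) y :=
  (hasDerivAt_avg (by fun_prop) hf hf' y).congr_deriv (avg_cutoff_deriv hf hf' y)

theorem hasDerivAt_avg_bump (hf : ∀ x, HasDerivAt f (f' x) x) (hf' : Continuous f') (y : ℝ) :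
    HasDerivAt (avg bump f) (avg bump1 f y) y :=
  (hasDerivAt_avg (by fun_prop) hf hf' y).congr_deriv (avg_bump_deriv hf hf' y)

theorem hasDerivAt_avg_bump1 (hf : ∀ x, HasDerivAt f (f' x) x) (hf' : Continuous f') (y : ℝ) :
    HasDerivAt (avg bump1 f) (avg bump2 f y) y :=
  (hasDerivAt_avg (by fun_prop) hf hf' y).congr_deriv (avg_bump1_deriv hf hf' y)

theorem hasDerivAt_avg_bump2 (hf : ∀ x, HasDerivAt f (f' x) x) (hf' : Continuous f') (y : ℝ) :
    HasDerivAt (avg bump2 f) (avg bump3 f y) y :=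
  (hasDerivAt_avg (by fun_prop) hf hf' y).congr_deriv (avg_bump2_deriv hf hf' y)

end averages

/-- The weight `(1 + y²)⁻¹`. -/
def cauchyWt (y : ℝ) : ℝ := (1 + y ^ 2)⁻¹

/-- The multiplier `y / (2 (1 + y²))`. -/
def mult0 (y : ℝ) : ℝ := y * cauchyWt y / 2

/-- First derivative of `mult0`. -/
def mult1 (y : ℝ) : ℝ := cauchyWt y ^ 2 - cauchyWt y / 2

/-- Second derivative of `mult0`. -/
def mult2 (y : ℝ) : ℝ := y * cauchyWt y ^ 2 - 4 * y * cauchyWt y ^ 3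

/-- Third derivative of `mult0`. -/
def mult3 (y : ℝ) : ℝ := 24 * cauchyWt y ^ 3 - 24 * cauchyWt y ^ 4 - 3 * cauchyWt y ^ 2

/-- Fourth derivative of `mult0`. -/
def mult4 (y : ℝ) : ℝ :=
  -2 * y * cauchyWt y ^ 2 * (72 * cauchyWt y ^ 2 - 96 * cauchyWt y ^ 3 - 6 * cauchyWt y)

theorem sq_mul_cauchyWt (y : ℝ) : y ^ 2 * cauchyWt y = 1 - cauchyWt y := by
  have : (1 : ℝ) + y ^ 2 ≠ 0 := by positivity
  unfold cauchyWt; field_simp; ring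

theorem cauchyWt_eq (y : ℝ) : cauchyWt y = (1 / wt y) ^ 8 := by
  rw [div_pow, wt_pow_eight, one_pow, one_div, cauchyWt]

theorem hasDerivAt_cauchyWt (y : ℝ) : HasDerivAt cauchyWt (-2 * y * cauchyWt y ^ 2) y := by
  have h : (1 : ℝ) + y ^ 2 ≠ 0 := by positivity
  refine (((hasDerivAt_pow 2 y).const_add 1).inv h).congr_deriv ?_
  unfold cauchyWt; push_cast; field_simp

theorem hasDerivAt_mult0 (y : ℝ) : HasDerivAt mult0 (mult1 y) y := by
  refine (((hasDerivAt_id y).mul (hasDerivAt_cauchyWt y)).div_const 2).congr_deriv ?_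
  simp only [id, mult1]
  linear_combination (-cauchyWt y) * sq_mul_cauchyWt y

theorem hasDerivAt_mult1 (y : ℝ) : HasDerivAt mult1 (mult2 y) y := by
  refine (((hasDerivAt_cauchyWt y).pow 2).sub ((hasDerivAt_cauchyWt y).div_const 2)).congr_deriv ?_
  simp only [mult2]; push_cast; ring

theorem hasDerivAt_mult2 (y : ℝ) : HasDerivAt mult2 (mult3 y) y := by
  refine (((hasDerivAt_id y).mul ((hasDerivAt_cauchyWt y).pow 2)).sub
    (((hasDerivAt_id y).const_mul 4).mul ((hasDerivAt_cauchyWt y).pow 3))).congr_deriv ?_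
  simp only [id, mult3, Pi.pow_apply]; push_cast
  linear_combination (24 * cauchyWt y ^ 3 - 4 * cauchyWt y ^ 2) * sq_mul_cauchyWt y

theorem hasDerivAt_mult3 (y : ℝ) : HasDerivAt mult3 (mult4 y) y := by
  refine (((((hasDerivAt_cauchyWt y).pow 3).const_mul 24).sub
    (((hasDerivAt_cauchyWt y).pow 4).const_mul 24)).sub
      (((hasDerivAt_cauchyWt y).pow 2).const_mul 3)).congr_deriv ?_
  simp only [mult4]; push_cast; ring

/-- A profile `U` of size `δ`, in self-similar coordinates: `Z` is the nonlinear vector field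
applied to `U`. -/
structure IsProfile (δ : ℝ) (U U1 U2 Z Z1 : ℝ → ℝ) : Prop where
  pos : 0 < δ
  le_one : δ ≤ 1
  hasDerivAt : ∀ y, HasDerivAt U (U1 y) y
  hasDerivAt_U1 : ∀ y, HasDerivAt U1 (U2 y) y
  hasDerivAt_Z : ∀ y, HasDerivAt Z (Z1 y) y
  continuous_U2 : Continuous U2
  continuous_Z1 : Continuous Z1
  Z_eq : ∀ y, Z y = y * U y - 3 * U2 y + 9 * U y ^ 2
  abs_le : ∀ y, |U y| ≤ δ / wt y
  abs_U1_le : ∀ y, |U1 y| ≤ δ * wt y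

/-- The jet attached to a profile. -/
def jet (U U1 Z : ℝ → ℝ) (y : ℝ) : Jet where
  y := y
  m0 := mult0 y
  m1 := mult1 y
  m2 := mult2 y
  m3 := mult3 y
  m4 := mult4 y
  U := U y
  U1 := U1 y
  Z := Z y
  V := avg cutoff U y
  s := avg bump U y
  s1 := avg bump1 U y
  s2 := avg bump2 U y
  s3 := avg bump3 U y
  SZ := avg bump Z y
  S1Z := avg bump1 Z y
  sh := avg bump U y
  s1h := avg bump1 U y

/-- Size of the vector field near a point. -/
def localSize (δ : ℝ) (Z : ℝ → ℝ) (y : ℝ) : ℝ :=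
  δ + |Z y| + ∫ η in (0 : ℝ)..1, |Z (y - η)|

namespace IsProfile

variable {δ : ℝ} {U U1 U2 Z Z1 : ℝ → ℝ}

theorem continuous (h : IsProfile δ U U1 U2 Z Z1) : Continuous U :=
  continuous_iff_continuousAt.2 fun x => (h.hasDerivAt x).continuousAt

theorem continuous_U1 (h : IsProfile δ U U1 U2 Z Z1) : Continuous U1 :=
  continuous_iff_continuousAt.2 fun x => (h.hasDerivAt_U1 x).continuousAt

theorem continuous_Z (h : IsProfile δ U U1 U2 Z Z1) : Continuous Z :=
  continuous_iff_continuousAt.2 fun x => (h.hasDerivAt_Z x).continuousAt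

theorem avg_Z (h : IsProfile δ U U1 U2 Z Z1) {κ : ℝ → ℝ} (hκ : Continuous κ) (y : ℝ) :
    avg κ Z y = y * avg κ U y - avg (fun η => η * κ η) U y - 3 * avg κ U2 y
      + 9 * avg κ (fun x => U x ^ 2) y := by
  have hU := h.continuous
  have hU2 := h.continuous_U2
  rw [← avg_id_mul hκ hU, ← avg_const_mul κ (fun x => U x ^ 2)]
  have h1 := avg_const_mul κ U2 (-3) y
  have h2 : avg κ Z y = avg κ (fun x => (x * U x + -3 * U2 x) + 9 * U x ^ 2) y := by
    congr 1; ext x; rw [h.Z_eq]; ring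
  rw [h2, avg_add hκ (by fun_prop) (by fun_prop), avg_add hκ (by fun_prop) (by fun_prop), h1]
  ring

theorem mul_avg_bump (h : IsProfile δ U U1 U2 Z Z1) (y : ℝ) :
    y * avg bump U y = avg bump Z y + avg (fun η => η * bump η) U y + 3 * avg bump2 U y
      - 9 * avg bump (fun x => U x ^ 2) y := by
  have := h.avg_Z continuous_bump y
  rw [avg_bump_deriv h.hasDerivAt_U1 h.continuous_U2,
    avg_bump1_deriv h.hasDerivAt h.continuous_U1] at this
  linarith

theorem mul_avg_bump1 (h : IsProfile δ U U1 U2 Z Z1) (y : ℝ) :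
    y * avg bump1 U y = avg bump1 Z y + avg (fun η => η * bump1 η) U y + 3 * avg bump3 U y
      - 9 * avg bump1 (fun x => U x ^ 2) y := by
  have := h.avg_Z continuous_bump1 y
  rw [avg_bump1_deriv h.hasDerivAt_U1 h.continuous_U2,
    avg_bump2_deriv h.hasDerivAt h.continuous_U1] at this
  linarith

theorem hasDerivAt_U2 (h : IsProfile δ U U1 U2 Z Z1) (y : ℝ) :
    HasDerivAt U2 ((U y + y * U1 y - Z1 y + 18 * U y * U1 y) / 3) y := by
  have h1 : U2 = fun y => (y * U y - Z y + 9 * U y ^ 2) / 3 := by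
    ext y; rw [h.Z_eq]; ring
  rw [h1]
  refine (((((hasDerivAt_id y).mul (h.hasDerivAt y)).sub (h.hasDerivAt_Z y)).add
    (((h.hasDerivAt y).pow 2).const_mul 9)).div_const 3).congr_deriv ?_
  simp only [id]; push_cast; ring

theorem hasDerivAt_cor (h : IsProfile δ U U1 U2 Z Z1) (y : ℝ) :
    HasDerivAt (fun y => (jet U U1 Z y).cor) (jet U U1 Z y).corD y := by
  have hV := hasDerivAt_avg_cutoff h.hasDerivAt h.continuous_U1 y
  refine (((hasDerivAt_mult0 y).mul (h.hasDerivAt y)).mul hV).congr_deriv ?_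
  simp only [Pi.mul_apply, Jet.corD, jet]; ring

theorem hasDerivAt_coef (h : IsProfile δ U U1 U2 Z Z1) (y : ℝ) :
    HasDerivAt (fun y => (jet U U1 Z y).coef) (jet U U1 Z y).coefD y := by
  have hV := hasDerivAt_avg_cutoff h.hasDerivAt h.continuous_U1 y
  have hs := hasDerivAt_avg_bump h.hasDerivAt h.continuous_U1 y
  refine (((hasDerivAt_mult0 y).mul ((h.hasDerivAt y).sub hs)).add
    ((hasDerivAt_mult1 y).mul hV)).congr_deriv ?_
  simp only [Pi.sub_apply, Jet.coefD, jet]; ring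

theorem hasDerivAt_rem (h : IsProfile δ U U1 U2 Z Z1) (y : ℝ) :
    HasDerivAt (fun y => (jet U U1 Z y).rem) ((jet U U1 Z y).remD (cauchyWt y)) y := by
  have hU := h.hasDerivAt y
  have hU1 := h.hasDerivAt_U1 y
  have hV := hasDerivAt_avg_cutoff h.hasDerivAt h.continuous_U1 y
  have hs := hasDerivAt_avg_bump h.hasDerivAt h.continuous_U1 y
  have hs1 := hasDerivAt_avg_bump1 h.hasDerivAt h.continuous_U1 y
  have hs2 := hasDerivAt_avg_bump2 h.hasDerivAt h.continuous_U1 y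
  have hSZ := hasDerivAt_avg_bump h.hasDerivAt_Z h.continuous_Z1 y
  have hy := hasDerivAt_id y
  have h0 := hasDerivAt_mult0 y
  have h1 := hasDerivAt_mult1 y
  have h2 := hasDerivAt_mult2 y
  have h3 := hasDerivAt_mult3 y
  have key := ((((((((((((hU.pow 2).sub ((hy.mul h0).mul (hU.pow 2))).sub
    ((h0.const_mul 3).mul (hU1.pow 2))).add ((((hy.const_mul (2 / 3)).mul h0).mul hU).mul hs)).add
    (((h0.const_mul (1 / 3)).mul hU).mul hSZ)).add (((h0.const_mul 3).mul hU1).mul hs1)).add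
    ((h0.mul hU).mul hs2)).sub ((((h0.add (hy.mul h1)).const_mul (2 / 3)).mul hU).mul hV)).sub
    ((h0.const_mul 6).mul (hU.pow 3))).add (((h0.const_mul 3).mul (hU.pow 2)).mul hs)).sub
    (((h1.const_mul 3).mul (hU.pow 2)).mul hV)).add
    (h1.mul ((((hU.const_mul (-9)).mul hU1).add ((hU1.const_mul 6).mul hs)).add
      ((hU.const_mul 3).mul hs1)))).add
    (h2.mul ((((hU1.const_mul (-3)).mul hV).sub ((hU.pow 2).const_mul 3)).add
      ((hU.const_mul 3).mul hs))) |>.sub ((h3.mul hU).mul hV)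
  have hZ := h.Z_eq y
  have hp : 2 * y * mult0 y = 1 - cauchyWt y := by
    rw [← sq_mul_cauchyWt, mult0]; ring
  refine (key.congr_deriv ?_)
  simp only [Pi.mul_apply, Pi.add_apply, Pi.sub_apply, Pi.pow_apply, id, Jet.remD, jet]
  have hU2 : U2 y = (y * U y - Z y + 9 * U y ^ 2) / 3 := by rw [hZ]; ring
  rw [hU2]
  push_cast
  linear_combination (-2 * U y * U1 y) * hp

end IsProfile

theorem cauchyWt_pos (y : ℝ) : 0 < cauchyWt y := by unfold cauchyWt; positivity

theorem cauchyWt_le_one (y : ℝ) : cauchyWt y ≤ 1 :=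
  inv_le_one_of_one_le₀ (by nlinarith [sq_nonneg y])

theorem abs_mul_cauchyWt_le (y : ℝ) : |y| * cauchyWt y ≤ (1 / wt y) ^ 4 := by
  have hw := wt_pos y
  have h := abs_le_wt_pow_four y
  rw [cauchyWt_eq, show (1 / wt y) ^ 4 = wt y ^ 4 * (1 / wt y) ^ 8 by field_simp]
  gcongr

theorem abs_mult0_le (y : ℝ) : |mult0 y| ≤ (1 / wt y) ^ 4 := by
  have h := abs_mul_cauchyWt_le y
  have h0 := mul_nonneg (abs_nonneg y) (cauchyWt_pos y).le
  rw [mult0, abs_div, abs_mul, abs_of_pos (cauchyWt_pos y), abs_two]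
  linarith

theorem abs_mult1_le (y : ℝ) : |mult1 y| ≤ (1 / wt y) ^ 8 := by
  rw [← cauchyWt_eq, mult1, abs_le]
  constructor <;> nlinarith [cauchyWt_pos y, cauchyWt_le_one y]

theorem abs_mult2_le (y : ℝ) : |mult2 y| ≤ 4 * (1 / wt y) ^ 12 := by
  have h := abs_mul_cauchyWt_le y
  have h0 := cauchyWt_pos y
  have h2 : |1 - 4 * cauchyWt y| ≤ 4 := by
    rw [abs_le]; constructor <;> linarith [cauchyWt_le_one y]
  calc |mult2 y| = (|y| * cauchyWt y) * cauchyWt y * |1 - 4 * cauchyWt y| := by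
        rw [mult2, show y * cauchyWt y ^ 2 - 4 * y * cauchyWt y ^ 3
          = y * cauchyWt y * cauchyWt y * (1 - 4 * cauchyWt y) by ring]
        simp only [abs_mul, abs_of_pos h0]
    _ ≤ (1 / wt y) ^ 4 * cauchyWt y * 4 := by gcongr
    _ = 4 * (1 / wt y) ^ 12 := by rw [cauchyWt_eq]; ring

theorem abs_mult3_le (y : ℝ) : |mult3 y| ≤ 51 * (1 / wt y) ^ 16 := by
  have h0 := cauchyWt_pos y
  have h1 := cauchyWt_le_one y
  have h2 : |24 * cauchyWt y - 24 * cauchyWt y ^ 2 - 3| ≤ 51 := by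
    rw [abs_le]; constructor <;> nlinarith
  calc |mult3 y| = cauchyWt y ^ 2 * |24 * cauchyWt y - 24 * cauchyWt y ^ 2 - 3| := by
        rw [mult3, show 24 * cauchyWt y ^ 3 - 24 * cauchyWt y ^ 4 - 3 * cauchyWt y ^ 2
          = cauchyWt y ^ 2 * (24 * cauchyWt y - 24 * cauchyWt y ^ 2 - 3) by ring]
        rw [abs_mul, abs_of_pos (pow_pos h0 2)]
    _ ≤ cauchyWt y ^ 2 * 51 := by gcongr
    _ = 51 * (1 / wt y) ^ 16 := by rw [cauchyWt_eq]; ring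

theorem abs_mult4_le (y : ℝ) : |mult4 y| ≤ 400 * (1 / wt y) ^ 20 := by
  have h := abs_mul_cauchyWt_le y
  have h0 := cauchyWt_pos y
  have h1 := cauchyWt_le_one y
  have h2 : |72 * cauchyWt y - 96 * cauchyWt y ^ 2 - 6| ≤ 200 := by
    rw [abs_le]; constructor <;> nlinarith
  calc |mult4 y|
      = 2 * (|y| * cauchyWt y) * cauchyWt y ^ 2 * |72 * cauchyWt y - 96 * cauchyWt y ^ 2 - 6| := by
        rw [mult4, show -2 * y * cauchyWt y ^ 2
            * (72 * cauchyWt y ^ 2 - 96 * cauchyWt y ^ 3 - 6 * cauchyWt y)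
          = -(2 * (y * cauchyWt y) * cauchyWt y ^ 2
            * (72 * cauchyWt y - 96 * cauchyWt y ^ 2 - 6)) by ring]
        simp only [abs_neg, abs_mul, abs_of_pos h0, abs_two, abs_of_pos (pow_pos h0 2)]
    _ ≤ 2 * (1 / wt y) ^ 4 * cauchyWt y ^ 2 * 200 := by gcongr
    _ = 400 * (1 / wt y) ^ 20 := by rw [cauchyWt_eq]; ring

/-- A function bounded together with its product with `y` decays like `wt y ^ (-4)`. -/
theorem abs_le_pow_four_mul {x y B : ℝ} (h : |x| + |y * x| ≤ B) : |x| ≤ (1 / wt y) ^ 4 * B := by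
  have hw := pow_pos (wt_pos y) 4
  rw [div_pow, one_pow, one_div_mul_eq_div, le_div_iff₀ hw]
  rw [abs_mul] at h
  nlinarith [mul_le_mul_of_nonneg_left (wt_pow_four_le y) (abs_nonneg x)]

theorem le_localSize {δ : ℝ} (Z : ℝ → ℝ) (y : ℝ) : δ ≤ localSize δ Z y := by
  have : 0 ≤ ∫ η in (0 : ℝ)..1, |Z (y - η)| :=
    intervalIntegral.integral_nonneg zero_le_one fun _ _ => abs_nonneg _
  unfold localSize
  linarith [abs_nonneg (Z y)]

/-- The jet of a profile satisfies the natural size bounds, with an absolute constant. -/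
theorem exists_jet_bounded : ∃ K : ℝ, 1 ≤ K ∧ ∀ {δ : ℝ} {U U1 U2 Z Z1 : ℝ → ℝ},
    IsProfile δ U U1 U2 Z Z1 → |bumpMean Z| ≤ K * δ ∧
      ∀ y, (jet U U1 Z y).Bounded K δ (localSize δ Z y) (1 / wt y) := by
  obtain ⟨K, hK1, hK⟩ := exists_bound_kernels [cutoff, bump, bump1, bump2, bump3,
    fun η => η * bump η, fun η => η * bump1 η] (by
      simp only [List.mem_cons, List.not_mem_nil, or_false, forall_eq_or_imp, forall_eq]
      refine ⟨?_, ?_, ?_, ?_, ?_, ?_, ?_⟩ <;> fun_prop)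
  simp only [List.mem_cons, List.not_mem_nil, or_false, forall_eq_or_imp, forall_eq] at hK
  obtain ⟨k1, k2, k3, k4, k5, k6, k7⟩ := hK
  refine ⟨20 * K + 400, by linarith, fun {δ U U1 U2 Z Z1} h => ?_⟩
  have hδ := h.pos
  have hc : ∀ {κ : ℝ → ℝ}, (∀ η ∈ Icc (0 : ℝ) 1, |κ η| ≤ K) → ∀ y,
      |avg κ U y| ≤ 2 * K * (δ * (1 / wt y)) := fun hκ y => by
    rw [mul_one_div]; exact abs_avg_le_div_wt hδ.le hκ h.abs_le y
  have hw : ∀ y, δ * (1 / wt y) ≤ δ := fun y =>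
    mul_le_of_le_one_right hδ.le ((div_le_one (wt_pos y)).2 (one_le_wt y))
  have hc1 : ∀ {κ : ℝ → ℝ}, (∀ η ∈ Icc (0 : ℝ) 1, |κ η| ≤ K) → ∀ y,
      |avg κ U y| ≤ 2 * K * δ := fun hκ y => (hc hκ y).trans (by gcongr; exact hw y)
  have hsq : ∀ {κ : ℝ → ℝ}, (∀ η ∈ Icc (0 : ℝ) 1, |κ η| ≤ K) → ∀ y,
      |avg κ (fun x => U x ^ 2) y| ≤ K * δ := fun hκ y =>
    abs_avg_le_const hκ fun η _ => by
      have h1 : |U (y - η)| ≤ δ := (h.abs_le _).trans (by rw [← mul_one_div]; exact hw _)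
      rw [abs_pow]
      nlinarith [abs_nonneg (U (y - η)), h.le_one]
  have h5 : ∀ y, |y * avg bump U y - avg bump Z y| ≤ 17 * K * δ := fun y => by
    have := h.mul_avg_bump y
    have h1 := abs_le.1 (hc1 k6 y)
    have h2 := abs_le.1 (hc1 k4 y)
    have h3 := abs_le.1 (hsq k2 y)
    rw [abs_le]; constructor <;> linarith
  have h6 : ∀ y, |y * avg bump1 U y - avg bump1 Z y| ≤ 17 * K * δ := fun y => by
    have := h.mul_avg_bump1 y
    have h1 := abs_le.1 (hc1 k7 y)
    have h2 := abs_le.1 (hc1 k5 y)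
    have h3 := abs_le.1 (hsq k3 y)
    rw [abs_le]; constructor <;> linarith
  refine ⟨?_, fun y => ?_⟩
  · have := h5 0
    simp only [zero_mul, zero_sub, abs_neg] at this
    exact this.trans (by gcongr; linarith)
  have hQ := le_localSize (δ := δ) Z y
  have hR : ∀ {κ : ℝ → ℝ}, (∀ η ∈ Icc (0 : ℝ) 1, |κ η| ≤ K) →
      |avg κ Z y| ≤ K * localSize δ Z y := fun hκ => by
    refine (abs_avg_le h.continuous_Z hκ y).trans ?_
    gcongr
    unfold localSize
    linarith [abs_nonneg (Z y)]
  have hQ0 : 0 < localSize δ Z y := hδ.trans_le hQ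
  have hr : 0 < 1 / wt y := one_div_pos.2 (wt_pos y)
  have hδr : 0 < δ * (1 / wt y) := mul_pos hδ hr
  have hp : ∀ n : ℕ, 0 < (1 / wt y) ^ n := fun n => pow_pos hr n
  have lift : ∀ {κ : ℝ → ℝ}, (∀ η ∈ Icc (0 : ℝ) 1, |κ η| ≤ K) →
      |avg κ U y| ≤ (20 * K + 400) * (δ * (1 / wt y)) := fun hκ => (hc hκ y).trans (by
    gcongr; linarith)
  have lift2 : ∀ {x z : ℝ}, |x| ≤ 2 * K * δ → |y * x - z| ≤ 17 * K * δ →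
      |z| ≤ K * localSize δ Z y → |x| ≤ (20 * K + 400) * ((1 / wt y) ^ 4 * localSize δ Z y) := by
    intro x z hx hd hz
    have h1 : |y * x| ≤ 17 * K * δ + K * localSize δ Z y := by
      calc |y * x| = |(y * x - z) + z| := by ring_nf
        _ ≤ _ := (abs_add_le _ _).trans (by linarith)
    have h2 : K * δ ≤ K * localSize δ Z y := by gcongr
    refine (abs_le_pow_four_mul (y := y) (B := (20 * K) * localSize δ Z y)
      (by linarith)).trans ?_
    have : 0 < (1 / wt y) ^ 4 * localSize δ Z y := mul_pos (hp 4) hQ0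
    nlinarith
  constructor
  · refine (abs_le_wt_pow_four y).trans ?_
    have := pow_pos (wt_pos y) 4
    simp only [one_div, inv_pow, inv_inv]
    nlinarith
  · exact (abs_mult0_le y).trans (by nlinarith [hp 4])
  · exact (abs_mult1_le y).trans (by nlinarith [hp 8])
  · exact (abs_mult2_le y).trans (by nlinarith [hp 12])
  · exact (abs_mult3_le y).trans (by nlinarith [hp 16])
  · exact (abs_mult4_le y).trans (by nlinarith [hp 20])
  · refine (h.abs_le y).trans ?_
    rw [← mul_one_div]; nlinarith
  · refine (h.abs_U1_le y).trans ?_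
    have := mul_pos hδ (wt_pos y)
    rw [div_div_eq_mul_div, div_one]
    nlinarith
  · refine le_trans (b := localSize δ Z y) ?_ (by nlinarith)
    have : 0 ≤ ∫ η in (0 : ℝ)..1, |Z (y - η)| :=
      intervalIntegral.integral_nonneg zero_le_one fun _ _ => abs_nonneg _
    simp only [jet, localSize]
    linarith
  · exact lift k1
  · exact lift k2
  · exact lift k3
  · exact lift k4
  · exact lift k5
  · exact (hR k2).trans (by gcongr; linarith)
  · exact (hR k3).trans (by gcongr; linarith)
  · exact lift2 (hc1 k2 y) (h5 y) (hR k2)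
  · exact lift2 (hc1 k3 y) (h6 y) (hR k3)

theorem gagliardo_add_le {f g : ℝ → ℝ} (hf : Measurable f) :
    gagliardo (fun x => f x + g x) ≤ 2 * gagliardo f + 2 * gagliardo g := by
  have key : ∀ x y, ENNReal.ofReal ((f x + g x - (f y + g y)) ^ 2 / (x - y) ^ 2)
      ≤ 2 * ENNReal.ofReal ((f x - f y) ^ 2 / (x - y) ^ 2)
        + 2 * ENNReal.ofReal ((g x - g y) ^ 2 / (x - y) ^ 2) := by
    intro x y
    rw [← ENNReal.ofReal_ofNat, ← ENNReal.ofReal_mul (by norm_num),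
      ← ENNReal.ofReal_mul (by norm_num), ← ENNReal.ofReal_add (by positivity) (by positivity)]
    refine ENNReal.ofReal_le_ofReal ?_
    rw [← mul_div_assoc, ← mul_div_assoc, ← add_div]
    gcongr
    nlinarith [sq_nonneg (f x - f y - (g x - g y))]
  unfold gagliardo
  calc _ ≤ ∫⁻ x, ∫⁻ y, (2 * ENNReal.ofReal ((f x - f y) ^ 2 / (x - y) ^ 2)
        + 2 * ENNReal.ofReal ((g x - g y) ^ 2 / (x - y) ^ 2)) :=
      lintegral_mono fun x => lintegral_mono fun y => key x y
    _ = _ := by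
      have h1 : ∀ x, ∫⁻ y, (2 * ENNReal.ofReal ((f x - f y) ^ 2 / (x - y) ^ 2)
          + 2 * ENNReal.ofReal ((g x - g y) ^ 2 / (x - y) ^ 2))
          = 2 * (∫⁻ y, ENNReal.ofReal ((f x - f y) ^ 2 / (x - y) ^ 2))
            + 2 * ∫⁻ y, ENNReal.ofReal ((g x - g y) ^ 2 / (x - y) ^ 2) := fun x => by
        rw [lintegral_add_left (by fun_prop), lintegral_const_mul' _ _ (by simp),
          lintegral_const_mul' _ _ (by simp)]
      simp_rw [h1]
      rw [lintegral_add_left, lintegral_const_mul' _ _ (by simp),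
        lintegral_const_mul' _ _ (by simp)]
      refine Measurable.const_mul ?_ _
      exact Measurable.lintegral_prod_right' (f := fun p : ℝ × ℝ =>
        ENNReal.ofReal ((f p.1 - f p.2) ^ 2 / (p.1 - p.2) ^ 2)) (by fun_prop)

/-- The mass of the weight defining `weightedSq`. -/
def weightMass : ℝ≥0∞ := ∫⁻ y, ENNReal.ofReal (1 / wt y ^ 5)

theorem weightMass_ne_top : weightMass ≠ ⊤ := by
  have h : Integrable fun y : ℝ => (1 + ‖y‖ ^ 2) ^ (-(5 / 4 : ℝ) / 2) :=
    integrable_rpow_neg_one_add_norm_sq (by simp; norm_num)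
  have h2 : (fun y : ℝ => (1 + ‖y‖ ^ 2) ^ (-(5 / 4 : ℝ) / 2)) = fun y => 1 / wt y ^ 5 := by
    ext y
    have : (0 : ℝ) < 1 + y ^ 2 := by positivity
    rw [norm_eq_abs, sq_abs, wt, ← Real.rpow_natCast ((1 + y ^ 2) ^ (1 / 8 : ℝ)),
      ← Real.rpow_mul this.le, one_div, ← Real.rpow_neg this.le]
    norm_num
  rw [h2] at h
  have := h.lintegral_lt_top
  exact this.ne

theorem weightedSq_localSize_le {Z : ℝ → ℝ} (hZ : Continuous Z) (δ : ℝ) :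
    weightedSq (localSize δ Z)
      ≤ 3 * (ENNReal.ofReal (δ ^ 2) * weightMass) + 15 * weightedSq Z := by
  have hw := continuous_wt
  have hw0 : ∀ y, wt y ^ 5 ≠ 0 := fun y => (pow_pos (wt_pos y) 5).ne'
  have hR : Continuous fun y => ∫ η in (0 : ℝ)..1, |Z (y - η)| :=
    intervalIntegral.continuous_parametric_intervalIntegral_of_continuous' (by fun_prop) 0 1
  have key : ∀ y, ENNReal.ofReal (localSize δ Z y ^ 2 / wt y ^ 5)
      ≤ 3 * (ENNReal.ofReal (δ ^ 2) * ENNReal.ofReal (1 / wt y ^ 5))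
        + (3 * ENNReal.ofReal (Z y ^ 2 / wt y ^ 5)
        + 3 * ENNReal.ofReal ((∫ η in (0 : ℝ)..1, |Z (y - η)|) ^ 2 / wt y ^ 5)) := by
    intro y
    have := wt_pos y
    rw [← ENNReal.ofReal_mul (by positivity), ← ENNReal.ofReal_ofNat 3,
      ← ENNReal.ofReal_mul (by norm_num), ← ENNReal.ofReal_mul (by norm_num),
      ← ENNReal.ofReal_mul (by norm_num), ← ENNReal.ofReal_add (by positivity) (by positivity),
      ← ENNReal.ofReal_add (by positivity) (by positivity)]
    refine ENNReal.ofReal_le_ofReal ?_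
    rw [mul_one_div, ← mul_div_assoc, ← mul_div_assoc, ← mul_div_assoc, ← add_div, ← add_div]
    gcongr
    unfold localSize
    set R := ∫ η in (0 : ℝ)..1, |Z (y - η)|
    rw [← sq_abs (Z y)]
    nlinarith [sq_nonneg (δ - |Z y|), sq_nonneg (δ - R), sq_nonneg (|Z y| - R)]
  refine (lintegral_mono key).trans ?_
  rw [lintegral_add_left (by fun_prop), lintegral_add_left (by fun_prop (disch := exact hw0 _)),
    lintegral_const_mul' _ _ (by simp), lintegral_const_mul' _ _ (by simp),
    lintegral_const_mul' _ _ (by simp), lintegral_const_mul' _ _ (by simp)]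
  have h4 := weightedSq_average_le hZ
  unfold weightedSq at h4 ⊢
  unfold weightMass
  calc _ ≤ 3 * (ENNReal.ofReal (δ ^ 2) * ∫⁻ y, ENNReal.ofReal (1 / wt y ^ 5))
      + (3 * (∫⁻ y, ENNReal.ofReal (Z y ^ 2 / wt y ^ 5))
        + 3 * (4 * ∫⁻ y, ENNReal.ofReal (Z y ^ 2 / wt y ^ 5))) := by gcongr
    _ = _ := by ring

theorem continuous_avg {κ f f' : ℝ → ℝ} (hκ : Continuous κ) (hf : ∀ x, HasDerivAt f (f' x) x)
    (hf' : Continuous f') : Continuous (avg κ f) :=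
  continuous_iff_continuousAt.2 fun y => (hasDerivAt_avg hκ hf hf' y).continuousAt

theorem IsProfile.continuous_derivs {δ : ℝ} {U U1 U2 Z Z1 : ℝ → ℝ}
    (h : IsProfile δ U U1 U2 Z Z1) :
    Continuous (fun y => (jet U U1 Z y).corD) ∧
      Continuous (fun y => (jet U U1 Z y).remD (cauchyWt y)) := by
  have hU := h.continuous
  have hU1 := h.continuous_U1
  have hZ := h.continuous_Z
  have hp : Continuous cauchyWt := continuous_iff_continuousAt.2 fun y =>
    (hasDerivAt_cauchyWt y).continuousAt
  have h0 := continuous_avg continuous_cutoff h.hasDerivAt hU1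
  have h1 := continuous_avg continuous_bump h.hasDerivAt hU1
  have h2 := continuous_avg continuous_bump1 h.hasDerivAt hU1
  have h3 := continuous_avg continuous_bump2 h.hasDerivAt hU1
  have h4 := continuous_avg continuous_bump3 h.hasDerivAt hU1
  have h5 := continuous_avg continuous_bump h.hasDerivAt_Z h.continuous_Z1
  have h6 := continuous_avg continuous_bump1 h.hasDerivAt_Z h.continuous_Z1
  unfold Jet.corD Jet.remD jet mult0 mult1 mult2 mult3 mult4
  constructor <;> fun_prop

/-- Main fixed time estimate: the normal form correction and the remainder it leaves are
quadratically small in `Ḣ^{1/2}`. -/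
theorem exists_gagliardo_bound : ∃ E : ℝ≥0∞, E ≠ ⊤ ∧ ∀ {δ : ℝ} {U U1 U2 Z Z1 : ℝ → ℝ},
    IsProfile δ U U1 U2 Z Z1 → gagliardo Z ≤ gagliardoConst * ENNReal.ofReal (δ ^ 2) →
    ∫⁻ y, ENNReal.ofReal (Z y ^ 2) ≠ ⊤ →
      gagliardo (fun y => (jet U U1 Z y).cor) ≤ E * ENNReal.ofReal (δ ^ 4) ∧
      gagliardo (fun y => (jet U U1 Z y).coef * Z y + (jet U U1 Z y).rem)
        ≤ E * ENNReal.ofReal (δ ^ 4) := by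
  obtain ⟨K, hK1, hK⟩ := exists_jet_bounded
  obtain ⟨C1, hC1, b1⟩ := Jet.exists_rem_bound hK1
  obtain ⟨C2, hC2, b2⟩ := Jet.exists_remD_bound hK1
  obtain ⟨C3, hC3, b3⟩ := Jet.exists_coef_bound hK1
  obtain ⟨C4, hC4, b4⟩ := Jet.exists_coefD_bound hK1
  obtain ⟨C5, hC5, b5⟩ := Jet.exists_cor_bound hK1
  obtain ⟨C6, hC6, b6⟩ := Jet.exists_corD_bound hK1
  set C := C1 + C2 + C3 + C4 + C5 + C6 with hC
  set a : ℝ≥0∞ := 9624 * (gagliardoConst + ENNReal.ofReal (K ^ 2)) with ha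
  set b : ℝ≥0∞ := 3 * weightMass + 15 * a with hb
  set e1 : ℝ≥0∞ := (6 + 4 * cauchyMass) * (ENNReal.ofReal (C ^ 2) * b) with he1
  set e2 : ℝ≥0∞ := (2 + 72 * cauchyMass) * (ENNReal.ofReal (C ^ 2) * (gagliardoConst + a)) with he2
  have ta : a ≠ ⊤ := by
    rw [ha]; finiteness [gagliardoConst_ne_top]
  have tb : b ≠ ⊤ := by rw [hb]; finiteness [weightMass_ne_top]
  have te1 : e1 ≠ ⊤ := by rw [he1]; finiteness [cauchyMass_ne_top]
  have te2 : e2 ≠ ⊤ := by rw [he2]; finiteness [cauchyMass_ne_top, gagliardoConst_ne_top]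
  refine ⟨2 * e2 + 2 * e1, by finiteness, fun {δ U U1 U2 Z Z1} h hZ hfin => ?_⟩
  obtain ⟨hm, hj⟩ := hK h
  have hδ := h.pos
  have hZc := h.continuous_Z
  have hr : ∀ y, 0 < 1 / wt y := fun y => one_div_pos.2 (wt_pos y)
  have hr1 : ∀ y, 1 / wt y ≤ 1 := fun y => (div_le_one (wt_pos y)).2 (one_le_wt y)
  have hQ := le_localSize (δ := δ) Z
  have hQ0 : ∀ y, 0 < localSize δ Z y := fun y => hδ.trans_le (hQ y)
  set d := ENNReal.ofReal (δ ^ 2) with hd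
  have hd4 : ENNReal.ofReal (δ ^ 4) = d * d := by
    rw [hd, ← ENNReal.ofReal_mul (by positivity)]; ring_nf
  have hCδ : ENNReal.ofReal ((C * δ) ^ 2) = ENNReal.ofReal (C ^ 2) * d := by
    rw [mul_pow, ENNReal.ofReal_mul (by positivity)]
  have hwZ : weightedSq Z ≤ a * d := by
    refine (weightedSq_le hZc hfin).trans ?_
    have : ENNReal.ofReal (bumpMean Z ^ 2) ≤ ENNReal.ofReal (K ^ 2) * d := by
      rw [hd, ← ENNReal.ofReal_mul (by positivity), ← mul_pow]
      exact ENNReal.ofReal_le_ofReal (sq_le_sq' (abs_le.1 hm).1 (abs_le.1 hm).2)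
    rw [ha, mul_assoc, add_mul]
    gcongr
  have hwQ : weightedSq (localSize δ Z) ≤ b * d := by
    refine (weightedSq_localSize_le hZc δ).trans ?_
    calc _ ≤ 3 * (d * weightMass) + 15 * (a * d) := by gcongr
      _ = _ := by rw [hb]; ring
  have fin1 : ∀ {x y : ℝ} {c : ℝ} {n : ℕ}, c ≤ C →
      |x| ≤ c * (δ * localSize δ Z y * (1 / wt y) ^ n) →
      |x| ≤ C * δ * localSize δ Z y / wt y ^ n := fun {x y c n} hc hx => by
    refine hx.trans (le_trans (b := C * (δ * localSize δ Z y * (1 / wt y) ^ n)) ?_ ?_)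
    · have := hQ0 y
      have := hr y
      gcongr
    · rw [div_pow, one_pow]; exact le_of_eq (by ring)
  have fin2 : ∀ {x y : ℝ} {c : ℝ} {n : ℕ}, c ≤ C → |x| ≤ c * (δ * (1 / wt y) ^ n) →
      |x| ≤ C * δ / wt y ^ n := fun {x y c n} hc hx => by
    refine hx.trans (le_trans (b := C * (δ * (1 / wt y) ^ n)) ?_ ?_)
    · have := hr y
      gcongr
    · rw [div_pow, one_pow]; exact le_of_eq (by ring)
  have g1 : gagliardo (fun y => (jet U U1 Z y).cor) ≤ e1 * ENNReal.ofReal (δ ^ 4) := by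
    refine (gagliardo_le_of_pointwise (Q := localSize δ Z) (A := C * δ) h.hasDerivAt_cor
      h.continuous_derivs.1
      (fun y => fin1 (by linarith) (b5 (hj y) (hr y) (hr1 y) hδ h.le_one (hQ y)))
      (fun y => fin1 (by linarith) (b6 (hj y) (hr y) (hr1 y) hδ h.le_one (hQ y)))).trans ?_
    rw [hCδ, hd4, he1]
    calc _ ≤ (6 + 4 * cauchyMass) * (ENNReal.ofReal (C ^ 2) * d * (b * d)) := by gcongr
      _ = _ := by ring
  have g2 : gagliardo (fun y => (jet U U1 Z y).rem) ≤ e1 * ENNReal.ofReal (δ ^ 4) := by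
    refine (gagliardo_le_of_pointwise (Q := localSize δ Z) (A := C * δ) h.hasDerivAt_rem
      h.continuous_derivs.2
      (fun y => fin1 (by linarith) (b1 (hj y) (hr y) (hr1 y) hδ h.le_one (hQ y)))
      (fun y => fin1 (c := C2) (by linarith) ?_)).trans ?_
    · rw [cauchyWt_eq]; exact b2 (hj y) (hr y) (hr1 y) hδ h.le_one (hQ y)
    rw [hCδ, hd4, he1]
    calc _ ≤ (6 + 4 * cauchyMass) * (ENNReal.ofReal (C ^ 2) * d * (b * d)) := by gcongr
      _ = _ := by ring
  have g3 : gagliardo (fun y => (jet U U1 Z y).coef * Z y) ≤ e2 * ENNReal.ofReal (δ ^ 4) := by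
    refine (gagliardo_mul_le (A := C * δ) (by positivity) h.hasDerivAt_coef
      (fun y => fin2 (by linarith) (b3 (hj y) (hr y) (hr1 y) hδ h.le_one (hQ y)))
      (fun y => fin2 (by linarith) (b4 (hj y) (hr y) (hr1 y) hδ h.le_one (hQ y))) hZc).trans ?_
    rw [hCδ, hd4, he2]
    calc _ ≤ (2 + 72 * cauchyMass) * (ENNReal.ofReal (C ^ 2) * d
          * (gagliardoConst * d + a * d)) := by gcongr
      _ = _ := by ring
  have hcm : Continuous fun y => (jet U U1 Z y).coef :=
    continuous_iff_continuousAt.2 fun y => (h.hasDerivAt_coef y).continuousAt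
  have hm : Measurable fun y => (jet U U1 Z y).coef * Z y := (hcm.mul hZc).measurable
  refine ⟨g1.trans ?_, (gagliardo_add_le hm).trans ?_⟩
  · gcongr
    calc e1 ≤ e1 + (2 * e2 + e1) := le_self_add
      _ = _ := by ring
  · calc _ ≤ 2 * (e2 * ENNReal.ofReal (δ ^ 4)) + 2 * (e1 * ENNReal.ofReal (δ ^ 4)) := by gcongr
      _ = _ := by ring

section averages

variable {κ : ℝ → ℝ}

theorem iteratedDeriv_avg (hκ : Continuous κ) (f : 𝓢(ℝ, ℝ)) (n : ℕ) :
    iteratedDeriv n (avg κ f) = avg κ ((derivCLM ℝ ℝ)^[n] f) := by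
  induction n with
  | zero => simp
  | succ n ih =>
    rw [iteratedDeriv_succ, ih, Function.iterate_succ_apply']
    set g := (derivCLM ℝ ℝ)^[n] f
    ext y
    exact (hasDerivAt_avg hκ g.hasDerivAt (derivCLM ℝ ℝ g).continuous y).deriv

theorem hasTemperateGrowth_avg (hκ : Continuous κ) (f : 𝓢(ℝ, ℝ)) :
    (avg κ f).HasTemperateGrowth := by
  refine ⟨contDiff_of_differentiable_iteratedDeriv fun m _ y => ?_, fun n => ?_⟩
  · rw [iteratedDeriv_avg hκ]
    set g := (derivCLM ℝ ℝ)^[m] f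
    exact (hasDerivAt_avg hκ g.hasDerivAt (derivCLM ℝ ℝ g).continuous y).differentiableAt
  · obtain ⟨K, -, hK⟩ := exists_bound_kernels [κ] (by simpa using hκ)
    set g := (derivCLM ℝ ℝ)^[n] f with hg
    obtain ⟨B, -, hB⟩ := g.decay 0 0
    refine ⟨0, K * B, fun y => ?_⟩
    rw [norm_iteratedFDeriv_eq_norm_iteratedDeriv, iteratedDeriv_avg hκ, ← hg, pow_zero, mul_one]
    exact abs_avg_le_const (hK κ (by simp)) fun η _ => by simpa using hB (y - η)

end averages

@[fun_prop]
theorem hasTemperateGrowth_cauchyWt : cauchyWt.HasTemperateGrowth := by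
  have h : (fun x : ℝ => (1 + ‖x‖ ^ 2) ^ (-1 : ℝ)).HasTemperateGrowth :=
    Function.hasTemperateGrowth_one_add_norm_sq_rpow ℝ (-1)
  simp only [Real.rpow_neg_one, norm_eq_abs, sq_abs] at h
  exact h

@[fun_prop]
theorem hasTemperateGrowth_mult0 : mult0.HasTemperateGrowth := by
  unfold mult0; simp only [div_eq_mul_inv]; fun_prop

@[fun_prop]
theorem hasTemperateGrowth_mult1 : mult1.HasTemperateGrowth := by
  unfold mult1; simp only [div_eq_mul_inv]; fun_prop

@[fun_prop]
theorem hasTemperateGrowth_mult2 : mult2.HasTemperateGrowth := by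
  unfold mult2; fun_prop

@[fun_prop]
theorem hasTemperateGrowth_mult3 : mult3.HasTemperateGrowth := by
  unfold mult3; fun_prop

/-- The real function `f` is (the function underlying) a Schwartz function. -/
def IsSchwartz (f : ℝ → ℝ) : Prop := ∃ g : 𝓢(ℝ, ℝ), ∀ x, f x = g x

namespace IsSchwartz

variable {f g : ℝ → ℝ}

theorem hasTemperateGrowth (hf : IsSchwartz f) : f.HasTemperateGrowth := by
  obtain ⟨φ, hφ⟩ := hf
  rw [funext hφ]; exact φ.hasTemperateGrowth

theorem add (hf : IsSchwartz f) (hg : IsSchwartz g) : IsSchwartz fun x => f x + g x := by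
  obtain ⟨φ, hφ⟩ := hf
  obtain ⟨ψ, hψ⟩ := hg
  exact ⟨φ + ψ, fun x => by simp [hφ, hψ]⟩

theorem mul_left (hg : g.HasTemperateGrowth) (hf : IsSchwartz f) :
    IsSchwartz fun x => g x * f x := by
  obtain ⟨φ, hφ⟩ := hf
  exact ⟨smulLeftCLM ℝ g φ, fun x => by simp [smulLeftCLM_apply_apply hg, hφ]⟩

theorem const_mul (hf : IsSchwartz f) (a : ℝ) : IsSchwartz fun x => a * f x :=
  mul_left (.const a) hf

theorem mul (hf : IsSchwartz f) (hg : IsSchwartz g) : IsSchwartz fun x => f x * g x :=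
  mul_left hf.hasTemperateGrowth hg

theorem deriv (hf : IsSchwartz f) : IsSchwartz (deriv f) := by
  obtain ⟨φ, hφ⟩ := hf
  exact ⟨derivCLM ℝ ℝ φ, fun x => by rw [funext hφ, derivCLM_apply]⟩

theorem comp_mul (hf : IsSchwartz f) {a : ℝ} (ha : a ≠ 0) : IsSchwartz fun x => f (a * x) := by
  obtain ⟨φ, hφ⟩ := hf
  refine ⟨compCLMOfContinuousLinearEquiv ℝ (ContinuousLinearEquiv.unitsEquivAut ℝ (Units.mk0 a ha))
    φ, fun x => ?_⟩
  simp [hφ, mul_comm]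

theorem lintegral_sq_ne_top (hf : IsSchwartz f) : ∫⁻ y, ENNReal.ofReal (f y ^ 2) ≠ ⊤ := by
  obtain ⟨φ, hφ⟩ := hf.mul hf
  have := φ.integrable (μ := volume)
  simp only [sq, hφ]
  exact this.lintegral_lt_top.ne

end IsSchwartz

theorem isSchwartz_cor {U U1 Z : ℝ → ℝ} (hU : IsSchwartz U) :
    IsSchwartz fun y => (jet U U1 Z y).cor := by
  obtain ⟨φ, hφ⟩ := id hU
  obtain rfl : U = φ := funext hφ
  have hV := hasTemperateGrowth_avg continuous_cutoff φ
  have : (fun y => mult0 y * avg cutoff φ y).HasTemperateGrowth := by fun_prop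
  convert hU.mul_left this using 2
  simp only [Jet.cor, jet]; ring

theorem isSchwartz_coef_mul_add_rem {U U1 Z : ℝ → ℝ} (hU : IsSchwartz U) (hU1 : IsSchwartz U1)
    (hZ : IsSchwartz Z) :
    IsSchwartz fun y => (jet U U1 Z y).coef * Z y + (jet U U1 Z y).rem := by
  obtain ⟨φ, hφ⟩ := id hU
  obtain rfl : U = φ := funext hφ
  obtain ⟨ψ, hψ⟩ := id hZ
  obtain rfl : Z = ψ := funext hψ
  have h0 := hasTemperateGrowth_avg continuous_cutoff φ
  have h1 := hasTemperateGrowth_avg continuous_bump φ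
  have h2 := hasTemperateGrowth_avg continuous_bump1 φ
  have h3 := hasTemperateGrowth_avg continuous_bump2 φ
  have h4 := hasTemperateGrowth_avg continuous_bump ψ
  have hφ' := φ.hasTemperateGrowth
  have h5 := hU1.hasTemperateGrowth
  have hc : (fun y => mult0 y * (φ y - avg bump φ y) + mult1 y
      * avg cutoff φ y).HasTemperateGrowth :=
    by fun_prop
  have hA : (fun y => φ y - y * mult0 y * φ y + 2 / 3 * y * mult0 y * avg bump φ y
      + 1 / 3 * mult0 y * avg bump ψ y + mult0 y * avg bump2 φ y
      - 2 / 3 * (mult0 y + y * mult1 y) * avg cutoff φ y - 6 * mult0 y * φ y ^ 2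
      + 3 * mult0 y * φ y * avg bump φ y - 3 * mult1 y * φ y * avg cutoff φ y
      + mult1 y * (-9 * U1 y + 3 * avg bump1 φ y) + mult2 y * (-3 * φ y + 3 * avg bump φ y)
      - mult3 y * avg cutoff φ y).HasTemperateGrowth := by fun_prop
  have hB : (fun y => -3 * mult0 y * U1 y + 3 * mult0 y * avg bump1 φ y
      + 6 * mult1 y * avg bump φ y - 3 * mult2 y * avg cutoff φ y).HasTemperateGrowth := by fun_prop
  convert (hZ.mul_left hc).add ((hU.mul_left hA).add (hU1.mul_left hB)) using 2
  simp only [Jet.coef, Jet.rem, jet]; ring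

/-- Fixed time estimate in terms of the Sobolev norm. -/
theorem exists_HsNorm_bound : ∃ C : ℝ, 0 < C ∧ ∀ {δ : ℝ} {U U1 U2 Z Z1 : ℝ → ℝ},
    IsProfile δ U U1 U2 Z Z1 → IsSchwartz U → IsSchwartz U1 → IsSchwartz Z →
    HsNorm (1 / 2) Z ≤ δ →
      HsNorm (1 / 2) (fun y => (jet U U1 Z y).cor) ≤ C * δ ^ 2 ∧
      HsNorm (1 / 2) (fun y => (jet U U1 Z y).coef * Z y + (jet U U1 Z y).rem) ≤ C * δ ^ 2 := by
  obtain ⟨E, hE, h⟩ := exists_gagliardo_bound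
  have hg0 := gagliardoConst_ne_zero
  have hgt := gagliardoConst_ne_top
  have hnn : ∀ f, 0 ≤ HsNorm (1 / 2) f := fun f =>
    Real.rpow_nonneg (integral_nonneg fun _ => by positivity) _
  have hfin : E / gagliardoConst ≠ ⊤ := ENNReal.div_ne_top hE hg0
  set R := √(E / gagliardoConst).toReal + 1 with hR
  have key : ∀ {δ : ℝ}, 0 < δ → ∀ f, IsSchwartz f → gagliardo f ≤ E * ENNReal.ofReal (δ ^ 4) →
      HsNorm (1 / 2) f ≤ R * δ ^ 2 := by
    intro δ hδ f ⟨φ, hφ⟩ hf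
    obtain rfl : f = φ := funext hφ
    rw [gagliardo_eq] at hf
    have h1 : ENNReal.ofReal (HsNorm (1 / 2) φ ^ 2)
        ≤ ENNReal.ofReal ((E / gagliardoConst).toReal * δ ^ 4) := by
      rw [ENNReal.ofReal_mul ENNReal.toReal_nonneg, ENNReal.ofReal_toReal hfin]
      calc _ ≤ E * ENNReal.ofReal (δ ^ 4) / gagliardoConst := by
            rw [ENNReal.le_div_iff_mul_le (Or.inl hg0) (Or.inl hgt), mul_comm]; exact hf
        _ = _ := by simp only [div_eq_mul_inv]; ring
    rw [ENNReal.ofReal_le_ofReal_iff (by positivity)] at h1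
    have h2 := Real.sq_sqrt (ENNReal.toReal_nonneg (a := E / gagliardoConst))
    have h3 := Real.sqrt_nonneg (E / gagliardoConst).toReal
    have h4 : HsNorm (1 / 2) φ ≤ √(E / gagliardoConst).toReal * δ ^ 2 := by
      refine le_of_sq_le_sq ?_ (by positivity)
      rw [mul_pow, h2]; linarith
    nlinarith [sq_nonneg δ]
  refine ⟨R, by positivity, fun {δ U U1 U2 Z Z1} hp hU hU1 hZ hδ => ?_⟩
  have hZ' : gagliardo Z ≤ gagliardoConst * ENNReal.ofReal (δ ^ 2) := by
    obtain ⟨ψ, hψ⟩ := hZ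
    obtain rfl : Z = ψ := funext hψ
    rw [gagliardo_eq]
    have := hnn ψ
    gcongr
  obtain ⟨a, b⟩ := h hp hZ' hZ.lintegral_sq_ne_top
  exact ⟨key hp.pos _ (isSchwartz_cor hU) a, key hp.pos _ (isSchwartz_coef_mul_add_rem hU hU1 hZ) b⟩

namespace IsProfile

variable {δ : ℝ} {U U1 U2 Z Z1 : ℝ → ℝ}

theorem deriv_cor (h : IsProfile δ U U1 U2 Z Z1) :
    deriv (fun y => (jet U U1 Z y).cor) = fun y => (jet U U1 Z y).corD :=
  funext fun y => (h.hasDerivAt_cor y).deriv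

theorem iteratedDeriv_three_cor (h : IsProfile δ U U1 U2 Z Z1) (y : ℝ) :
    iteratedDeriv 3 (fun y => (jet U U1 Z y).cor) y =
      mult3 y * U y * avg cutoff U y
        + mult0 y * ((U y + y * U1 y - Z1 y + 18 * U y * U1 y) / 3) * avg cutoff U y
        + mult0 y * U y * (U2 y - avg bump2 U y)
        + 3 * mult2 y * U1 y * avg cutoff U y + 3 * mult2 y * U y * (U y - avg bump U y)
        + 3 * mult1 y * U2 y * avg cutoff U y + 3 * mult1 y * U y * (U1 y - avg bump1 U y)
        + 3 * mult0 y * U2 y * (U y - avg bump U y) + 3 * mult0 y * U1 y * (U1 y - avg bump1 U y)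
        + 6 * mult1 y * U1 y * (U y - avg bump U y) := by
  have hU := h.hasDerivAt
  have hU1 := h.hasDerivAt_U1
  have hU2 := h.hasDerivAt_U2
  have hV := hasDerivAt_avg_cutoff h.hasDerivAt h.continuous_U1
  have hs := hasDerivAt_avg_bump h.hasDerivAt h.continuous_U1
  have hs1 := hasDerivAt_avg_bump1 h.hasDerivAt h.continuous_U1
  have h2 : ∀ y, HasDerivAt (fun y => (jet U U1 Z y).corD)
      (mult2 y * U y * avg cutoff U y + mult0 y * U2 y * avg cutoff U y
        + mult0 y * U y * (U1 y - avg bump1 U y) + 2 * (mult1 y * U1 y * avg cutoff U y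
        + mult1 y * U y * (U y - avg bump U y) + mult0 y * U1 y * (U y - avg bump U y))) y := by
    intro y
    refine (((((hasDerivAt_mult1 y).mul (hU y)).mul (hV y)).add
      (((hasDerivAt_mult0 y).mul (hU1 y)).mul (hV y))).add
      (((hasDerivAt_mult0 y).mul (hU y)).mul ((hU y).sub (hs y)))).congr_deriv ?_
    simp only [Pi.mul_apply, Pi.sub_apply]; ring
  rw [iteratedDeriv_succ, iteratedDeriv_succ, iteratedDeriv_one, h.deriv_cor,
    funext fun y => (h2 y).deriv]
  refine HasDerivAt.deriv ?_
  refine ((((((hasDerivAt_mult2 y).mul (hU y)).mul (hV y)).add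
    (((hasDerivAt_mult0 y).mul (hU2 y)).mul (hV y))).add
    (((hasDerivAt_mult0 y).mul (hU y)).mul ((hU1 y).sub (hs1 y)))).add
    ((((((hasDerivAt_mult1 y).mul (hU1 y)).mul (hV y)).add
      (((hasDerivAt_mult1 y).mul (hU y)).mul ((hU y).sub (hs y)))).add
      (((hasDerivAt_mult0 y).mul (hU1 y)).mul ((hU y).sub (hs y)))).const_mul 2)).congr_deriv ?_
  simp only [Pi.mul_apply, Pi.sub_apply]; ring

/-- The homological equation solved by the normal form correction, in self-similar coordinates. -/
theorem homological (h : IsProfile δ U U1 U2 Z Z1) (y : ℝ) :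
    (jet U U1 Z y).coef * Z y + (jet U U1 Z y).rem =
      U y ^ 2 + ((jet U U1 Z y).cor + y * deriv (fun y => (jet U U1 Z y).cor) y) / 3
        - mult0 y * (avg cutoff U y * (Z1 y + U y)
          + U y * (Z y - avg bump Z y + avg cutoff U y)) / 3
        - iteratedDeriv 3 (fun y => (jet U U1 Z y).cor) y
        + 6 * U y * deriv (fun y => (jet U U1 Z y).cor) y := by
  rw [h.iteratedDeriv_three_cor, h.deriv_cor]
  have hU2 : U2 y = (y * U y - Z y + 9 * U y ^ 2) / 3 := by rw [h.Z_eq]; ring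
  simp only [Jet.coef, Jet.rem, Jet.cor, Jet.corD, jet, hU2]
  ring

end IsProfile

/-- The space-time slab `(0, T] × ℝ`. -/
def slab (T : ℝ) : Set (ℝ × ℝ) := Ioc 0 T ×ˢ univ

theorem convex_slab (T : ℝ) : Convex ℝ (slab T) := (convex_Ioc 0 T).prod convex_univ

theorem uniqueDiffOn_slab (T : ℝ) : UniqueDiffOn ℝ (slab T) :=
  (uniqueDiffOn_Ioc 0 T).prod uniqueDiffOn_univ

theorem mem_slab {T t x : ℝ} : (t, x) ∈ slab T ↔ t ∈ Ioc 0 T := by simp [slab]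

theorem mem_slab_sub {T : ℝ} {p : ℝ × ℝ} (hp : p ∈ slab T) (η : ℝ) : p - (0, η) ∈ slab T := by
  obtain ⟨t, x⟩ := p
  simpa [slab] using hp

theorem slab_mem_nhds {T t : ℝ} (ht : t ∈ Ioo 0 T) (x : ℝ) : slab T ∈ nhds (t, x) :=
  prod_mem_nhds (Ioc_mem_nhds ht.1 ht.2) Filter.univ_mem

section slabAvg

variable {E : Type} [NormedAddCommGroup E] [NormedSpace ℝ E] {κ : ℝ → ℝ} {T : ℝ}

/-- Averages in the space variable of a function on space-time. -/
def slabAvg (κ : ℝ → ℝ) (F : ℝ × ℝ → E) (p : ℝ × ℝ) : E :=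
  ∫ η in (0 : ℝ)..1, κ η • F (p - (0, η))

theorem continuous_slabAvg_integrand (hκ : Continuous κ) {F : ℝ × ℝ → E}
    (hF : ContinuousOn F (slab T)) {p : ℝ × ℝ} (hp : p ∈ slab T) :
    Continuous fun η : ℝ => κ η • F (p - (0, η)) :=
  hκ.smul (hF.comp_continuous (by fun_prop) (mem_slab_sub hp))

theorem continuousOn_slabAvg (hκ : Continuous κ) {F : ℝ × ℝ → E}
    (hF : ContinuousOn F (slab T)) : ContinuousOn (slabAvg κ F) (slab T) := by
  rw [continuousOn_iff_continuous_domRestrict]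
  refine intervalIntegral.continuous_parametric_intervalIntegral_of_continuous'
    (f := fun (p : slab T) η => κ η • F (p.1 - (0, η))) ?_ 0 1
  refine (hκ.comp continuous_snd).smul ?_
  exact hF.comp_continuous (f := fun q : slab T × ℝ => q.1.1 - (0, q.2)) (by fun_prop)
    fun q => mem_slab_sub q.1.2 q.2

theorem hasFDerivWithinAt_slabAvg (hκ : Continuous κ) {F : ℝ × ℝ → E} {F' : ℝ × ℝ → ℝ × ℝ →L[ℝ] E}
    (hF : ∀ p ∈ slab T, HasFDerivWithinAt F (F' p) (slab T) p) (hF' : ContinuousOn F' (slab T))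
    {p : ℝ × ℝ} (hp : p ∈ slab T) :
    HasFDerivWithinAt (slabAvg κ F) (slabAvg κ F' p) (slab T) p := by
  obtain ⟨K, hK1, hK⟩ := exists_bound_kernels [κ] (by simpa using hκ)
  replace hK := hK κ (by simp)
  have hFc : ContinuousOn F (slab T) := fun q hq => (hF q hq).continuousWithinAt
  rw [hasFDerivWithinAt_iff_isLittleO, Asymptotics.isLittleO_iff]
  intro c hc
  have hu : ContinuousOn (fun (q : ℝ × ℝ) (η : ℝ) => F' (q - (0, η))).uncurry
      (slab T ×ˢ Icc (0 : ℝ) 1) :=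
    hF'.comp (f := fun q : (ℝ × ℝ) × ℝ => q.1 - (0, q.2)) (by fun_prop)
      fun q hq => mem_slab_sub hq.1 q.2
  obtain ⟨v, hv, hv'⟩ := isCompact_Icc.mem_uniformity_of_prod hu hp
    (Metric.dist_mem_uniformity (show (0 : ℝ) < c / K by positivity))
  obtain ⟨r, hr, hrv⟩ := Metric.mem_nhdsWithin_iff.1 hv
  filter_upwards [inter_mem_nhdsWithin (slab T) (Metric.ball_mem_nhds p hr)] with q hq
  have hconv : Convex ℝ (slab T ∩ Metric.ball p r) := (convex_slab T).inter (convex_ball p r)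
  have hpt : ∀ η ∈ Icc (0 : ℝ) 1,
      ‖F (q - (0, η)) - F (p - (0, η)) - F' (p - (0, η)) (q - p)‖ ≤ c / K * ‖q - p‖ := by
    intro η hη
    refine hconv.norm_image_sub_le_of_norm_hasFDerivWithin_le' (f := fun q => F (q - (0, η)))
      (f' := fun q => F' (q - (0, η))) (fun z hz => ?_) (fun z hz => ?_)
      ⟨hp, Metric.mem_ball_self hr⟩ hq
    · refine HasFDerivWithinAt.mono (t := slab T) ?_ inter_subset_left
      have := (hF (z - (0, η)) (mem_slab_sub hz.1 η)).comp z
        ((hasFDerivWithinAt_id z (slab T)).sub_const (0, η)) fun w hw => mem_slab_sub hw η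
      exact this
    · have := hv' z (hrv ⟨hz.2, hz.1⟩) η hη
      rw [← dist_eq_norm]
      exact le_of_lt this
  have i1 := (continuous_slabAvg_integrand hκ hFc hq.1).intervalIntegrable (μ := volume) 0 1
  have i2 := (continuous_slabAvg_integrand hκ hFc hp).intervalIntegrable (μ := volume) 0 1
  have i3 := (continuous_slabAvg_integrand hκ hF' hp).intervalIntegrable (μ := volume) 0 1
  have i4 : IntervalIntegrable (fun η => (κ η • F' (p - (0, η))) (q - p)) volume 0 1 :=
    Continuous.intervalIntegrable
      ((continuous_slabAvg_integrand hκ hF' hp).clm_apply continuous_const) _ _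
  unfold slabAvg
  rw [ContinuousLinearMap.intervalIntegral_apply i3, ← intervalIntegral.integral_sub i1 i2,
    ← intervalIntegral.integral_sub (i1.sub i2) i4]
  refine (intervalIntegral.norm_integral_le_of_norm_le_const (C := c * ‖q - p‖)
    fun η hη => ?_).trans_eq (by simp)
  rw [uIoc_of_le zero_le_one] at hη
  have hη' : η ∈ Icc (0 : ℝ) 1 := ⟨hη.1.le, hη.2⟩
  rw [smul_apply, ← smul_sub, ← smul_sub, norm_smul]
  calc _ ≤ K * (c / K * ‖q - p‖) :=
        mul_le_mul (hK η hη') (hpt η hη') (norm_nonneg _) (by positivity)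
    _ = _ := by field_simp

theorem contDiffOn_slabAvg_nat (hκ : Continuous κ) (n : ℕ) {E : Type} [NormedAddCommGroup E]
    [NormedSpace ℝ E] {F : ℝ × ℝ → E} (hF : ContDiffOn ℝ n F (slab T)) :
    ContDiffOn ℝ n (slabAvg κ F) (slab T) := by
  induction n generalizing E with
  | zero =>
    rw [Nat.cast_zero, contDiffOn_zero] at hF ⊢
    exact continuousOn_slabAvg hκ hF
  | succ n ih =>
    have hu := uniqueDiffOn_slab T
    rw [Nat.cast_succ, contDiffOn_succ_iff_hasFDerivWithinAt_of_uniqueDiffOn hu] at hF ⊢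
    obtain ⟨-, F', hF', hd⟩ := hF
    exact ⟨by simp, slabAvg κ F', ih hF', fun p hp =>
      hasFDerivWithinAt_slabAvg hκ hd hF'.continuousOn hp⟩

theorem contDiffOn_slabAvg (hκ : Continuous κ) {F : ℝ × ℝ → E}
    (hF : ContDiffOn ℝ (⊤ : ℕ∞) F (slab T)) : ContDiffOn ℝ (⊤ : ℕ∞) (slabAvg κ F) (slab T) := by
  rw [contDiffOn_infty] at hF ⊢
  exact fun n => contDiffOn_slabAvg_nat hκ n (hF n)

end slabAvg

section partials

variable {T : ℝ} {F : ℝ × ℝ → ℝ}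

/-- Time derivative within the slab `(0, T] × ℝ`. -/
def slabDt (T : ℝ) (F : ℝ × ℝ → ℝ) (p : ℝ × ℝ) : ℝ := fderivWithin ℝ F (slab T) p (1, 0)

/-- Space derivative within the slab `(0, T] × ℝ`. -/
def slabDx (T : ℝ) (F : ℝ × ℝ → ℝ) (p : ℝ × ℝ) : ℝ := fderivWithin ℝ F (slab T) p (0, 1)

theorem contDiffOn_slabDt (hF : ContDiffOn ℝ (⊤ : ℕ∞) F (slab T)) :
    ContDiffOn ℝ (⊤ : ℕ∞) (slabDt T F) (slab T) :=
  (hF.fderivWithin (uniqueDiffOn_slab T) (by simp)).clm_apply contDiffOn_const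

theorem contDiffOn_slabDx (hF : ContDiffOn ℝ (⊤ : ℕ∞) F (slab T)) :
    ContDiffOn ℝ (⊤ : ℕ∞) (slabDx T F) (slab T) :=
  (hF.fderivWithin (uniqueDiffOn_slab T) (by simp)).clm_apply contDiffOn_const

theorem hasFDerivWithinAt_slab (hF : ContDiffOn ℝ (⊤ : ℕ∞) F (slab T)) {p : ℝ × ℝ}
    (hp : p ∈ slab T) : HasFDerivWithinAt F (fderivWithin ℝ F (slab T) p) (slab T) p :=
  (hF.differentiableOn (by simp) p hp).hasFDerivWithinAt

theorem hasDerivAt_slabDx (hF : ContDiffOn ℝ (⊤ : ℕ∞) F (slab T)) {t : ℝ} (ht : t ∈ Ioc 0 T)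
    (x : ℝ) : HasDerivAt (fun x => F (t, x)) (slabDx T F (t, x)) x := by
  have h := (hasFDerivWithinAt_slab hF (mem_slab.2 ht)).comp_hasDerivWithinAt (s := univ) x
    ((hasDerivWithinAt_const x univ t).prodMk (hasDerivWithinAt_id x univ))
    fun z _ => mem_slab.2 ht
  rwa [hasDerivWithinAt_univ] at h

theorem hasDerivWithinAt_slabDt (hF : ContDiffOn ℝ (⊤ : ℕ∞) F (slab T)) {t : ℝ}
    (ht : t ∈ Ioc 0 T) (x : ℝ) :
    HasDerivWithinAt (fun s => F (s, x)) (slabDt T F (t, x)) (Ioc 0 T) t :=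
  HasFDerivWithinAt.comp_hasDerivWithinAt (f := fun s => (s, x)) (t := slab T) t
    (hasFDerivWithinAt_slab hF (mem_slab.2 ht))
    ((hasDerivWithinAt_id t (Ioc 0 T)).prodMk (hasDerivWithinAt_const t (Ioc 0 T) x))
    fun _ hz => mem_slab.2 hz

/-- Chain rule along a curve transverse to the time slices. -/
theorem hasDerivAt_slab_curve (hF : ContDiffOn ℝ (⊤ : ℕ∞) F (slab T)) {t : ℝ} (ht : t ∈ Ioo 0 T)
    {γ : ℝ → ℝ} {γ' : ℝ} (hγ : HasDerivAt γ γ' t) :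
    HasDerivAt (fun s => F (s, γ s)) (slabDt T F (t, γ t) + γ' * slabDx T F (t, γ t)) t := by
  have h := ((hasFDerivWithinAt_slab hF (mem_slab.2 ⟨ht.1, ht.2.le⟩)).hasFDerivAt
    (slab_mem_nhds ht (γ t))).comp_hasDerivAt t ((hasDerivAt_id t).prodMk hγ)
  refine h.congr_deriv ?_
  have : ((1 : ℝ), γ') = (1, 0) + γ' • (0, 1) := by simp
  rw [this, map_add, map_smul]
  rfl

theorem slabDt_slabAvg {κ : ℝ → ℝ} (hκ : Continuous κ) (hF : ContDiffOn ℝ (⊤ : ℕ∞) F (slab T))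
    {t : ℝ} (ht : t ∈ Ioc 0 T) (x : ℝ) :
    slabDt T (slabAvg κ F) (t, x) = avg κ (fun x => slabDt T F (t, x)) x := by
  have hp : (t, x) ∈ slab T := mem_slab.2 ht
  have hF' := (hF.fderivWithin (uniqueDiffOn_slab T) (m := 0) (by simp)).continuousOn
  rw [slabDt, (hasFDerivWithinAt_slabAvg hκ (fun q hq => hasFDerivWithinAt_slab hF hq) hF'
    hp).fderivWithin (uniqueDiffOn_slab T _ hp), slabAvg,
    ContinuousLinearMap.intervalIntegral_apply
      ((continuous_slabAvg_integrand hκ hF' hp).intervalIntegrable 0 1)]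
  simp [avg, slabDt]

end partials

/-- The cube root of a positive time. -/
def cbrt (t : ℝ) : ℝ := t ^ (1 / 3 : ℝ)

theorem cbrt_pos {t : ℝ} (ht : 0 < t) : 0 < cbrt t := Real.rpow_pos_of_pos ht _

theorem cbrt_pow_three {t : ℝ} (ht : 0 < t) : cbrt t ^ 3 = t := by
  rw [cbrt, ← Real.rpow_natCast, ← Real.rpow_mul ht.le]; norm_num

theorem rpow_eq_cbrt_rpow {t : ℝ} (ht : 0 < t) (a : ℝ) : t ^ a = cbrt t ^ (3 * a) := by
  rw [cbrt, ← Real.rpow_mul ht.le]; congr 1; ring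

theorem hasDerivAt_cbrt {t : ℝ} (ht : 0 < t) : HasDerivAt cbrt (cbrt t / (3 * t)) t := by
  refine (Real.hasDerivAt_rpow_const (p := 1 / 3) (Or.inl ht.ne')).congr_deriv ?_
  rw [Real.rpow_sub_one ht.ne', cbrt]; field_simp

theorem hasDerivAt_cbrt_inv {t : ℝ} (ht : 0 < t) :
    HasDerivAt (fun s => (cbrt s)⁻¹) (-(cbrt t)⁻¹ / (3 * t)) t := by
  have := (cbrt_pos ht).ne'
  refine ((hasDerivAt_cbrt ht).inv this).congr_deriv ?_
  field_simp

theorem contDiffOn_cbrt (T : ℝ) : ContDiffOn ℝ (⊤ : ℕ∞) cbrt (Ioc 0 T) := fun _ ht =>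
  (Real.contDiffAt_rpow_const_of_ne ht.1.ne').contDiffWithinAt

theorem contDiffOn_cbrt_inv (T : ℝ) : ContDiffOn ℝ (⊤ : ℕ∞) (fun s => (cbrt s)⁻¹) (Ioc 0 T) :=
  (contDiffOn_cbrt T).inv fun _ ht => (cbrt_pos ht.1).ne'

/-- Time dependent rescaling of amplitude and space. -/
def rescale (α β : ℝ → ℝ) (F : ℝ × ℝ → ℝ) (p : ℝ × ℝ) : ℝ := α p.1 * F (p.1, β p.1 * p.2)

section rescale

variable {T : ℝ} {F : ℝ × ℝ → ℝ} {α β : ℝ → ℝ}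

theorem contDiffOn_rescale (hα : ContDiffOn ℝ (⊤ : ℕ∞) α (Ioc 0 T))
    (hβ : ContDiffOn ℝ (⊤ : ℕ∞) β (Ioc 0 T)) (hF : ContDiffOn ℝ (⊤ : ℕ∞) F (slab T)) :
    ContDiffOn ℝ (⊤ : ℕ∞) (rescale α β F) (slab T) := by
  have hfst : MapsTo Prod.fst (slab T) (Ioc 0 T) := fun p hp => hp.1
  have h1 : ContDiffOn ℝ (⊤ : ℕ∞) (fun p : ℝ × ℝ => α p.1) (slab T) :=
    hα.comp contDiffOn_fst hfst
  have h2 : ContDiffOn ℝ (⊤ : ℕ∞) (fun p : ℝ × ℝ => β p.1) (slab T) :=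
    hβ.comp contDiffOn_fst hfst
  exact h1.mul (hF.comp (contDiffOn_fst.prodMk (h2.mul contDiffOn_snd)) fun p hp =>
    mem_slab.2 hp.1)

theorem hasDerivAt_rescale (hF : ContDiffOn ℝ (⊤ : ℕ∞) F (slab T)) {t α' β' : ℝ}
    (ht : t ∈ Ioo 0 T) (hα : HasDerivAt α α' t) (hβ : HasDerivAt β β' t) (x : ℝ) :
    HasDerivAt (fun s => rescale α β F (s, x)) (α' * F (t, β t * x)
      + α t * (slabDt T F (t, β t * x) + β' * x * slabDx T F (t, β t * x))) t :=
  hα.mul (hasDerivAt_slab_curve hF ht (hβ.mul_const x))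

theorem slabDt_rescale (hF : ContDiffOn ℝ (⊤ : ℕ∞) F (slab T))
    (hG : ContDiffOn ℝ (⊤ : ℕ∞) (rescale α β F) (slab T)) {t α' β' : ℝ}
    (ht : t ∈ Ioo 0 T) (hα : HasDerivAt α α' t) (hβ : HasDerivAt β β' t) (x : ℝ) :
    slabDt T (rescale α β F) (t, x) = α' * F (t, β t * x)
      + α t * (slabDt T F (t, β t * x) + β' * x * slabDx T F (t, β t * x)) := by
  have h1 := hasDerivAt_slab_curve hG ht (hasDerivAt_const t x)
  rw [zero_mul, add_zero] at h1
  exact h1.unique (hasDerivAt_rescale hF ht hα hβ x)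

theorem slabDx_eq_deriv (hF : ContDiffOn ℝ (⊤ : ℕ∞) F (slab T)) {t : ℝ} (ht : t ∈ Ioc 0 T) :
    (fun x => slabDx T F (t, x)) = deriv (fun x => F (t, x)) :=
  funext fun x => (hasDerivAt_slabDx hF ht x).deriv.symm

theorem slabDx_three_eq (hF : ContDiffOn ℝ (⊤ : ℕ∞) F (slab T)) {t : ℝ} (ht : t ∈ Ioc 0 T)
    (x : ℝ) : slabDx T (slabDx T (slabDx T F)) (t, x) = iteratedDeriv 3 (fun x => F (t, x)) x := by
  have h1 := contDiffOn_slabDx hF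
  rw [iteratedDeriv_succ, iteratedDeriv_succ, iteratedDeriv_one, ← slabDx_eq_deriv hF ht,
    ← slabDx_eq_deriv h1 ht, ← slabDx_eq_deriv (contDiffOn_slabDx h1) ht]

theorem slabDx_two_eq (hF : ContDiffOn ℝ (⊤ : ℕ∞) F (slab T)) {t : ℝ} (ht : t ∈ Ioc 0 T)
    (x : ℝ) : slabDx T (slabDx T F) (t, x) = iteratedDeriv 2 (fun x => F (t, x)) x := by
  have h1 := contDiffOn_slabDx hF
  rw [iteratedDeriv_succ, iteratedDeriv_one, ← slabDx_eq_deriv hF ht, ← slabDx_eq_deriv h1 ht]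

theorem contDiff_slice (hF : ContDiffOn ℝ (⊤ : ℕ∞) F (slab T)) {t : ℝ} (ht : t ∈ Ioc 0 T) :
    ContDiff ℝ (⊤ : ℕ∞) fun x => F (t, x) :=
  contDiffOn_univ.1 (hF.comp (contDiff_const.prodMk contDiff_id).contDiffOn
    fun _ _ => mem_slab.2 ht)

theorem iteratedDeriv_rescale (hF : ContDiffOn ℝ (⊤ : ℕ∞) F (slab T)) {t : ℝ} (ht : t ∈ Ioc 0 T)
    (n : ℕ) (x : ℝ) : iteratedDeriv n (fun x => rescale α β F (t, x)) x
      = α t * β t ^ n * iteratedDeriv n (fun x => F (t, x)) (β t * x) := by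
  have h := contDiff_infty.1 (contDiff_slice hF ht) n
  have h2 := iteratedDeriv_const_mul_field (n := n) (x := x) (α t) fun x => F (t, β t * x)
  refine h2.trans ?_
  rw [iteratedDeriv_comp_const_mul h, mul_assoc]

end rescale

theorem gagliardo_rescale (f : ℝ → ℝ) (c : ℝ) {a : ℝ} (ha : 0 < a) :
    gagliardo (fun x => c * f (a * x)) = ENNReal.ofReal (c ^ 2) * gagliardo f := by
  have h0 : ENNReal.ofReal a ≠ 0 := by simpa using ha
  unfold gagliardo
  rw [lintegral_comp_mul_right_real (fun x => ∫⁻ y, ENNReal.ofReal ((f x - f y) ^ 2 / (x - y) ^ 2))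
    ha.ne', abs_of_pos ha, ← lintegral_const_mul' _ _ (by simp),
    ← lintegral_const_mul' _ _ (by simp)]
  congr 1; ext x
  rw [lintegral_comp_mul_right_real (fun y => ENNReal.ofReal ((f (a * x) - f y) ^ 2
    / (a * x - y) ^ 2)) ha.ne', abs_of_pos ha, ← mul_assoc, ← mul_assoc,
    ← lintegral_const_mul' _ _ (by finiteness)]
  congr 1; ext y
  rw [← ENNReal.ofReal_mul (by positivity), ← ENNReal.ofReal_mul (by positivity),
    ← ENNReal.ofReal_mul (by positivity)]
  congr 1
  rw [← mul_sub, ← mul_sub, mul_pow, mul_pow]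
  field_simp

theorem HsNorm_nonneg (s : ℝ) (f : ℝ → ℝ) : 0 ≤ HsNorm s f :=
  Real.rpow_nonneg (integral_nonneg fun _ => by positivity) _

/-- The norm of `Ḣ^{1/2}(ℝ)` is invariant under dilations. -/
theorem HsNorm_rescale {f : ℝ → ℝ} (hf : IsSchwartz f) {c a : ℝ} (hc : 0 ≤ c) (ha : 0 < a) :
    HsNorm (1 / 2) (fun x => c * f (a * x)) = c * HsNorm (1 / 2) f := by
  obtain ⟨φ, hφ⟩ := id hf
  obtain ⟨ψ, hψ⟩ := (hf.comp_mul ha.ne').const_mul c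
  obtain rfl : f = φ := funext hφ
  have h := gagliardo_rescale φ c ha
  rw [funext hψ, gagliardo_eq, gagliardo_eq, mul_left_comm,
    ENNReal.mul_right_inj gagliardoConst_ne_zero gagliardoConst_ne_top,
    ← ENNReal.ofReal_mul (by positivity), ENNReal.ofReal_eq_ofReal_iff (by positivity)
    (by positivity), ← mul_pow, pow_left_inj₀ (HsNorm_nonneg _ _)
    (mul_nonneg hc (HsNorm_nonneg _ _)) two_ne_zero] at h
  rw [funext hψ, h]

section slabJet

variable {T : ℝ} {U : ℝ × ℝ → ℝ}

/-- The nonlinear vector field applied to a function in self-similar coordinates. -/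
def scaledField (T : ℝ) (U : ℝ × ℝ → ℝ) (p : ℝ × ℝ) : ℝ :=
  p.2 * U p - 3 * slabDx T (slabDx T U) p + 9 * U p ^ 2

theorem contDiffOn_scaledField (hU : ContDiffOn ℝ (⊤ : ℕ∞) U (slab T)) :
    ContDiffOn ℝ (⊤ : ℕ∞) (scaledField T U) (slab T) :=
  ((contDiffOn_snd.mul hU).sub
    (contDiffOn_const.mul (contDiffOn_slabDx (contDiffOn_slabDx hU)))).add
    (contDiffOn_const.mul (hU.pow 2))

/-- The jet attached to each time slice of a function in self-similar coordinates. -/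
def slabJet (T : ℝ) (U : ℝ × ℝ → ℝ) (t : ℝ) : ℝ → Jet :=
  jet (fun y => U (t, y)) (fun y => slabDx T U (t, y)) (fun y => scaledField T U (t, y))

/-- The normal form correction in self-similar coordinates. -/
def slabCor (T : ℝ) (U : ℝ × ℝ → ℝ) (p : ℝ × ℝ) : ℝ := (slabJet T U p.1 p.2).cor

/-- The remainder of the normal form correction in self-similar coordinates. -/
def slabRem (T : ℝ) (U : ℝ × ℝ → ℝ) (p : ℝ × ℝ) : ℝ :=
  (slabJet T U p.1 p.2).coef * scaledField T U p + (slabJet T U p.1 p.2).rem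

theorem avg_slice (κ : ℝ → ℝ) (F : ℝ × ℝ → ℝ) (p : ℝ × ℝ) :
    avg κ (fun y => F (p.1, y)) p.2 = slabAvg κ F p := by
  simp [avg, slabAvg, Prod.sub_def]

theorem contDiffOn_slabCor (hU : ContDiffOn ℝ (⊤ : ℕ∞) U (slab T)) :
    ContDiffOn ℝ (⊤ : ℕ∞) (slabCor T U) (slab T) := by
  have h0 : ContDiffOn ℝ (⊤ : ℕ∞) (fun p : ℝ × ℝ => mult0 p.2) (slab T) :=
    (hasTemperateGrowth_mult0.1.comp contDiff_snd).contDiffOn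
  have hV := contDiffOn_slabAvg continuous_cutoff hU
  refine ((h0.mul hU).mul hV).congr fun p _ => ?_
  simp only [slabCor, slabJet, jet, Jet.cor, avg_slice]

theorem contDiffOn_slabRem (hU : ContDiffOn ℝ (⊤ : ℕ∞) U (slab T)) :
    ContDiffOn ℝ (⊤ : ℕ∞) (slabRem T U) (slab T) := by
  have m0 : ContDiffOn ℝ (⊤ : ℕ∞) (fun p : ℝ × ℝ => mult0 p.2) (slab T) :=
    (hasTemperateGrowth_mult0.1.comp contDiff_snd).contDiffOn
  have m1 : ContDiffOn ℝ (⊤ : ℕ∞) (fun p : ℝ × ℝ => mult1 p.2) (slab T) :=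
    (hasTemperateGrowth_mult1.1.comp contDiff_snd).contDiffOn
  have m2 : ContDiffOn ℝ (⊤ : ℕ∞) (fun p : ℝ × ℝ => mult2 p.2) (slab T) :=
    (hasTemperateGrowth_mult2.1.comp contDiff_snd).contDiffOn
  have m3 : ContDiffOn ℝ (⊤ : ℕ∞) (fun p : ℝ × ℝ => mult3 p.2) (slab T) :=
    (hasTemperateGrowth_mult3.1.comp contDiff_snd).contDiffOn
  have hU1 := contDiffOn_slabDx hU
  have hZ := contDiffOn_scaledField hU
  have h0 := contDiffOn_slabAvg continuous_cutoff hU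
  have h1 := contDiffOn_slabAvg continuous_bump hU
  have h2 := contDiffOn_slabAvg continuous_bump1 hU
  have h3 := contDiffOn_slabAvg continuous_bump2 hU
  have h4 := contDiffOn_slabAvg continuous_bump hZ
  change ContDiffOn ℝ (⊤ : ℕ∞) (fun p => slabRem T U p) (slab T)
  simp only [slabRem, slabJet, jet, Jet.coef, Jet.rem, avg_slice]
  fun_prop

theorem slabDt_slabCor (hU : ContDiffOn ℝ (⊤ : ℕ∞) U (slab T)) {t : ℝ} (ht : t ∈ Ioo 0 T)
    (hU_eq : ∀ y, 3 * t * slabDt T U (t, y) = U (t, y) + slabDx T (scaledField T U) (t, y))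
    (y : ℝ) :
    3 * t * slabDt T (slabCor T U) (t, y) =
      mult0 y * (avg cutoff (fun y => U (t, y)) y * (slabDx T (scaledField T U) (t, y) + U (t, y))
        + U (t, y) * (scaledField T U (t, y) - avg bump (fun y => scaledField T U (t, y)) y
          + avg cutoff (fun y => U (t, y)) y)) := by
  have ht' : t ∈ Ioc 0 T := ⟨ht.1, ht.2.le⟩
  have hZ := contDiffOn_scaledField hU
  have hV := contDiffOn_slabAvg continuous_cutoff hU
  have hc := hasDerivAt_slab_curve (contDiffOn_slabCor hU) ht (hasDerivAt_const t y)
  have hUt := hasDerivAt_slab_curve hU ht (hasDerivAt_const t y)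
  have hVt := hasDerivAt_slab_curve hV ht (hasDerivAt_const t y)
  rw [zero_mul, add_zero] at hc hUt hVt
  have hc' : (fun s => slabCor T U (s, y))
      = fun s => mult0 y * U (s, y) * slabAvg cutoff U (s, y) := by
    ext s
    simp only [slabCor, slabJet, jet, Jet.cor, ← avg_slice]
  rw [hc'] at hc
  have hval := hc.unique ((hUt.const_mul (mult0 y)).mul hVt)
  have hUc : Continuous fun y => U (t, y) := (contDiff_slice hU ht').continuous
  have hZc : Continuous fun y => slabDx T (scaledField T U) (t, y) :=
    (contDiff_slice (contDiffOn_slabDx hZ) ht').continuous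
  have hVU : 3 * t * slabDt T (slabAvg cutoff U) (t, y) = avg cutoff (fun y => U (t, y)) y
      + (scaledField T U (t, y) - avg bump (fun y => scaledField T U (t, y)) y) := by
    rw [slabDt_slabAvg continuous_cutoff hU ht', ← avg_const_mul, funext hU_eq,
      avg_add continuous_cutoff hUc hZc,
      avg_cutoff_deriv (hasDerivAt_slabDx hZ ht') hZc]
  rw [hval, ← avg_slice]
  linear_combination mult0 y * avg cutoff (fun y => U (t, y)) y * hU_eq y
    + mult0 y * U (t, y) * hVU

end slabJet

section bootstrap

variable {t : ℝ}

theorem jb_cbrt (ht : 0 < t) (y : ℝ) :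
    jb t (cbrt t * y) = (cbrt t ^ 2 * (1 + y ^ 2)) ^ (1 / 2 : ℝ) := by
  have : t ^ ((2 : ℝ) / 3) = cbrt t ^ 2 := by
    rw [rpow_eq_cbrt_rpow ht, ← Real.rpow_natCast]; norm_num
  rw [jb, this]; congr 1; ring

theorem jb_rpow_quarter (ht : 0 < t) (y : ℝ) :
    jb t (cbrt t * y) ^ ((1 : ℝ) / 4) = cbrt t ^ (1 / 4 : ℝ) * wt y := by
  have hr := cbrt_pos ht
  have hy : (0 : ℝ) < 1 + y ^ 2 := by positivity
  rw [jb_cbrt ht, ← Real.rpow_mul (by positivity), Real.mul_rpow (by positivity) hy.le,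
    ← Real.rpow_natCast (cbrt t) 2, ← Real.rpow_mul hr.le, wt]
  norm_num

theorem bootstrap_weight (ht : 0 < t) (y : ℝ) :
    t ^ (-(1 : ℝ) / 4) * jb t (cbrt t * y) ^ (-(1 : ℝ) / 4) = (cbrt t)⁻¹ / wt y := by
  have hr := cbrt_pos ht
  have hj : 0 ≤ jb t (cbrt t * y) := Real.rpow_nonneg (by positivity) _
  rw [neg_div, Real.rpow_neg hj, jb_rpow_quarter ht, rpow_eq_cbrt_rpow ht, mul_inv, ← mul_assoc,
    ← Real.rpow_neg hr.le, ← Real.rpow_add hr, div_eq_mul_inv (cbrt t)⁻¹,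
    show 3 * -(1 / 4 : ℝ) + -(1 / 4) = -1 by norm_num, Real.rpow_neg_one]

theorem bootstrap_weight_deriv (ht : 0 < t) (y : ℝ) :
    t ^ (-(3 : ℝ) / 4) * jb t (cbrt t * y) ^ ((1 : ℝ) / 4) = (cbrt t ^ 2)⁻¹ * wt y := by
  have hr := cbrt_pos ht
  rw [jb_rpow_quarter ht, rpow_eq_cbrt_rpow ht, ← mul_assoc, ← Real.rpow_add hr,
    ← Real.rpow_natCast, ← Real.rpow_neg hr.le]
  norm_num

end bootstrap

/-- A solution in self-similar coordinates. -/
def scaledSol (u : ℝ → ℝ → ℝ) : ℝ × ℝ → ℝ :=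
  rescale (fun s => cbrt s ^ 2) cbrt fun p => u p.1 p.2

section scaledSol

variable {T t : ℝ} {u : ℝ → ℝ → ℝ}

theorem contDiffOn_scaledSol (hu : IsKdVOn (Ioc 0 T) u) :
    ContDiffOn ℝ (⊤ : ℕ∞) (scaledSol u) (slab T) :=
  contDiffOn_rescale ((contDiffOn_cbrt T).pow 2) (contDiffOn_cbrt T) hu.1

theorem isSchwartz_scaledSol (hu : IsKdVOn (Ioc 0 T) u) (ht : t ∈ Ioc 0 T) :
    IsSchwartz fun y => scaledSol u (t, y) :=
  (IsSchwartz.comp_mul (hu.2.1 t ht) (cbrt_pos ht.1).ne').const_mul (cbrt t ^ 2)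

theorem isSchwartz_slabDx {F : ℝ × ℝ → ℝ} (hF : ContDiffOn ℝ (⊤ : ℕ∞) F (slab T))
    (ht : t ∈ Ioc 0 T) (h : IsSchwartz fun y => F (t, y)) :
    IsSchwartz fun y => slabDx T F (t, y) := by
  rw [slabDx_eq_deriv hF ht]; exact h.deriv

theorem isSchwartz_scaledField {U : ℝ × ℝ → ℝ} (hU : ContDiffOn ℝ (⊤ : ℕ∞) U (slab T))
    (ht : t ∈ Ioc 0 T) (h : IsSchwartz fun y => U (t, y)) :
    IsSchwartz fun y => scaledField T U (t, y) := by
  have h1 : (fun y : ℝ => y).HasTemperateGrowth := by fun_prop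
  have h2 := isSchwartz_slabDx (contDiffOn_slabDx hU) ht (isSchwartz_slabDx hU ht h)
  convert ((h.mul_left h1).add (h2.const_mul (-3))).add ((h.mul h).const_mul 9) using 2
  simp only [scaledField]; ring

theorem iteratedDeriv_scaledSol (hu : IsKdVOn (Ioc 0 T) u) (ht : t ∈ Ioc 0 T) (n : ℕ) (y : ℝ) :
    iteratedDeriv n (fun y => scaledSol u (t, y)) y
      = cbrt t ^ (n + 2) * iteratedDeriv n (u t) (cbrt t * y) := by
  rw [scaledSol, iteratedDeriv_rescale hu.1 ht]
  ring

theorem slabDx_scaledSol (hu : IsKdVOn (Ioc 0 T) u) (ht : t ∈ Ioc 0 T) (y : ℝ) :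
    slabDx T (scaledSol u) (t, y) = cbrt t ^ 3 * deriv (u t) (cbrt t * y) := by
  have h := congrFun (slabDx_eq_deriv (contDiffOn_scaledSol hu) ht) y
  rw [← iteratedDeriv_one, iteratedDeriv_scaledSol hu ht, iteratedDeriv_one] at h
  exact h

theorem scaledField_scaledSol (hu : IsKdVOn (Ioc 0 T) u) (ht : t ∈ Ioc 0 T) (y : ℝ) :
    scaledField T (scaledSol u) (t, y) = cbrt t * LNL t (u t) (cbrt t * y) := by
  have h3 := cbrt_pow_three ht.1
  rw [scaledField, slabDx_two_eq (contDiffOn_scaledSol hu) ht, iteratedDeriv_scaledSol hu ht, LNL]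
  simp only [scaledSol, rescale]
  linear_combination (-3 * cbrt t * iteratedDeriv 2 (u t) (cbrt t * y)
    + 9 * cbrt t * u t (cbrt t * y) ^ 2) * h3

theorem HsNorm_scaledField (hu : IsKdVOn (Ioc 0 T) u) (ht : t ∈ Ioc 0 T) :
    HsNorm (1 / 2) (fun y => scaledField T (scaledSol u) (t, y))
      = cbrt t * HsNorm (1 / 2) (LNL t (u t)) := by
  have hr := cbrt_pos ht.1
  have hS := isSchwartz_scaledField (contDiffOn_scaledSol hu) ht (isSchwartz_scaledSol hu ht)
  have hL : IsSchwartz (LNL t (u t)) := by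
    convert (hS.comp_mul (inv_ne_zero hr.ne')).const_mul (cbrt t)⁻¹ using 2 with x
    rw [scaledField_scaledSol hu ht, mul_inv_cancel_left₀ hr.ne', inv_mul_cancel_left₀ hr.ne']
  rw [funext (scaledField_scaledSol hu ht), HsNorm_rescale hL hr.le hr]

theorem isProfile_scaledSol (hu : IsKdVOn (Ioc 0 T) u) (ht : t ∈ Ioc 0 T) {M ε : ℝ}
    (hb : Bootstrap M ε t (u t)) (hpos : 0 < M * ε * cbrt t) (hle : M * ε * cbrt t ≤ 1) :
    IsProfile (M * ε * cbrt t) (fun y => scaledSol u (t, y))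
      (fun y => slabDx T (scaledSol u) (t, y))
      (fun y => slabDx T (slabDx T (scaledSol u)) (t, y))
      (fun y => scaledField T (scaledSol u) (t, y))
      (fun y => slabDx T (scaledField T (scaledSol u)) (t, y)) := by
  have hU := contDiffOn_scaledSol hu
  have hU1 := contDiffOn_slabDx hU
  have hZ := contDiffOn_scaledField hU
  have hr := cbrt_pos ht.1
  refine ⟨hpos, hle, hasDerivAt_slabDx hU ht, hasDerivAt_slabDx hU1 ht, hasDerivAt_slabDx hZ ht,
    (contDiff_slice (contDiffOn_slabDx hU1) ht).continuous,
    (contDiff_slice (contDiffOn_slabDx hZ) ht).continuous, fun y => rfl, fun y => ?_, fun y => ?_⟩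
  · have h := (hb (cbrt t * y)).1
    rw [mul_assoc, bootstrap_weight ht.1] at h
    have : scaledSol u (t, y) = cbrt t ^ 2 * u t (cbrt t * y) := rfl
    rw [this, abs_mul, abs_of_pos (by positivity)]
    calc _ ≤ cbrt t ^ 2 * (M * ε * ((cbrt t)⁻¹ / wt y)) := by gcongr
      _ = _ := by field_simp
  · have h := (hb (cbrt t * y)).2
    rw [mul_assoc, bootstrap_weight_deriv ht.1] at h
    rw [slabDx_scaledSol hu ht, abs_mul, abs_of_pos (by positivity)]
    calc _ ≤ cbrt t ^ 3 * (M * ε * ((cbrt t ^ 2)⁻¹ * wt y)) := by gcongr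
      _ = _ := by field_simp

/-- The KdV equation in self-similar coordinates. -/
theorem slabDt_scaledSol (hu : IsKdVOn (Ioc 0 T) u) (ht : t ∈ Ioo 0 T) (y : ℝ) :
    3 * t * slabDt T (scaledSol u) (t, y)
      = scaledSol u (t, y) + slabDx T (scaledField T (scaledSol u)) (t, y) := by
  have ht' : t ∈ Ioc 0 T := ⟨ht.1, ht.2.le⟩
  have hU := contDiffOn_scaledSol hu
  have hU1 := contDiffOn_slabDx hU
  have hr := cbrt_pos ht.1
  have h3 := cbrt_pow_three ht.1
  have hZ1 : slabDx T (scaledField T (scaledSol u)) (t, y) = scaledSol u (t, y)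
      + y * slabDx T (scaledSol u) (t, y)
      - 3 * slabDx T (slabDx T (slabDx T (scaledSol u))) (t, y)
      + 18 * scaledSol u (t, y) * slabDx T (scaledSol u) (t, y) := by
    refine (hasDerivAt_slabDx (contDiffOn_scaledField hU) ht' y).unique ?_
    refine ((((hasDerivAt_id y).mul (hasDerivAt_slabDx hU ht' y)).sub
      ((hasDerivAt_slabDx (contDiffOn_slabDx hU1) ht' y).const_mul 3)).add
      (((hasDerivAt_slabDx hU ht' y).pow 2).const_mul 9)).congr_deriv ?_
    simp only [id]; push_cast; ring
  have hcd := hasDerivAt_cbrt ht.1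
  have hdt := slabDt_rescale hu.1 (contDiffOn_scaledSol hu) ht (hcd.pow 2) hcd y
  have hux : slabDx T (fun p => u p.1 p.2) (t, cbrt t * y) = deriv (u t) (cbrt t * y) :=
    (hasDerivAt_slabDx hu.1 ht' (cbrt t * y)).deriv.symm
  have hut : slabDt T (fun p => u p.1 p.2) (t, cbrt t * y)
      = deriv (fun s => u s (cbrt t * y)) t := by
    have := hasDerivAt_slab_curve hu.1 ht (hasDerivAt_const t (cbrt t * y))
    rw [zero_mul, add_zero] at this
    exact this.deriv.symm
  have hpde := hu.2.2 t ht' (cbrt t * y)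
  have hsol : scaledSol u (t, y) = cbrt t ^ 2 * u t (cbrt t * y) := rfl
  rw [hZ1, slabDx_three_eq hU ht', iteratedDeriv_scaledSol hu ht', slabDx_scaledSol hu ht', hsol]
  change slabDt T (scaledSol u) (t, y) = _ at hdt
  rw [hdt, hux, hut]
  have ht0 : t ≠ 0 := ht.1.ne'
  have e1 : deriv (fun s => u s (cbrt t * y)) t
    = 6 * u t (cbrt t * y) * deriv (u t) (cbrt t * y) - iteratedDeriv 3 (u t) (cbrt t * y) := by
    linarith
  simp only [e1, Nat.cast_ofNat]
  generalize u t (cbrt t * y) = a, deriv (u t) (cbrt t * y) = b,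
    iteratedDeriv 3 (u t) (cbrt t * y) = d
  field_simp
  generalize cbrt t = r at h3 ⊢
  subst h3
  ring

end scaledSol

/-- The normal form correction in the original coordinates. -/
def correction (T : ℝ) (u : ℝ → ℝ → ℝ) : ℝ × ℝ → ℝ :=
  rescale (fun s => (cbrt s)⁻¹) (fun s => (cbrt s)⁻¹) (slabCor T (scaledSol u))

/-- The remainder of the normal form correction in the original coordinates. -/
def remainder (T : ℝ) (u : ℝ → ℝ → ℝ) : ℝ × ℝ → ℝ :=
  rescale (fun s => (cbrt s)⁻¹ ^ 4) (fun s => (cbrt s)⁻¹) (slabRem T (scaledSol u))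

section correction

variable {T t : ℝ} {u : ℝ → ℝ → ℝ}

theorem contDiffOn_correction (hu : IsKdVOn (Ioc 0 T) u) :
    ContDiffOn ℝ (⊤ : ℕ∞) (correction T u) (slab T) :=
  contDiffOn_rescale (contDiffOn_cbrt_inv T) (contDiffOn_cbrt_inv T)
    (contDiffOn_slabCor (contDiffOn_scaledSol hu))

theorem contDiffOn_remainder (hu : IsKdVOn (Ioc 0 T) u) :
    ContDiffOn ℝ (⊤ : ℕ∞) (remainder T u) (slab T) :=
  contDiffOn_rescale ((contDiffOn_cbrt_inv T).pow 4) (contDiffOn_cbrt_inv T)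
    (contDiffOn_slabRem (contDiffOn_scaledSol hu))

theorem isSchwartz_slabCor (hu : IsKdVOn (Ioc 0 T) u) (ht : t ∈ Ioc 0 T) :
    IsSchwartz fun y => slabCor T (scaledSol u) (t, y) :=
  isSchwartz_cor (isSchwartz_scaledSol hu ht)

theorem isSchwartz_slabRem (hu : IsKdVOn (Ioc 0 T) u) (ht : t ∈ Ioc 0 T) :
    IsSchwartz fun y => slabRem T (scaledSol u) (t, y) :=
  have hU := contDiffOn_scaledSol hu
  have h := isSchwartz_scaledSol hu ht
  isSchwartz_coef_mul_add_rem h (isSchwartz_slabDx hU ht h) (isSchwartz_scaledField hU ht h)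

theorem isSchwartz_correction (hu : IsKdVOn (Ioc 0 T) u) (ht : t ∈ Ioc 0 T) :
    IsSchwartz fun x => correction T u (t, x) :=
  ((isSchwartz_slabCor hu ht).comp_mul (inv_ne_zero (cbrt_pos ht.1).ne')).const_mul (cbrt t)⁻¹

theorem isSchwartz_remainder (hu : IsKdVOn (Ioc 0 T) u) (ht : t ∈ Ioc 0 T) :
    IsSchwartz fun x => remainder T u (t, x) :=
  ((isSchwartz_slabRem hu ht).comp_mul (inv_ne_zero (cbrt_pos ht.1).ne')).const_mul
    ((cbrt t)⁻¹ ^ 4)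

theorem HsNorm_correction (hu : IsKdVOn (Ioc 0 T) u) (ht : t ∈ Ioc 0 T) :
    HsNorm (1 / 2) (fun x => correction T u (t, x))
      = (cbrt t)⁻¹ * HsNorm (1 / 2) (fun y => slabCor T (scaledSol u) (t, y)) := by
  have hr := inv_pos.2 (cbrt_pos ht.1)
  rw [← HsNorm_rescale (isSchwartz_slabCor hu ht) hr.le hr]
  rfl

theorem HsNorm_remainder (hu : IsKdVOn (Ioc 0 T) u) (ht : t ∈ Ioc 0 T) :
    HsNorm (1 / 2) (fun x => remainder T u (t, x))
      = (cbrt t)⁻¹ ^ 4 * HsNorm (1 / 2) (fun y => slabRem T (scaledSol u) (t, y)) := by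
  have hr := inv_pos.2 (cbrt_pos ht.1)
  rw [← HsNorm_rescale (isSchwartz_slabRem hu ht) (pow_pos hr 4).le hr]
  rfl

theorem sq_eq_correction_add_remainder_of_lt (hu : IsKdVOn (Ioc 0 T) u) (ht : t ∈ Ioo 0 T)
    {M ε : ℝ} (hb : Bootstrap M ε t (u t)) (hpos : 0 < M * ε * cbrt t)
    (hle : M * ε * cbrt t ≤ 1) (x : ℝ) :
    u t x ^ 2 = slabDt T (correction T u) (t, x)
      + slabDx T (slabDx T (slabDx T (correction T u))) (t, x)
      - 6 * u t x * slabDx T (correction T u) (t, x) + remainder T u (t, x) := by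
  have ht' : t ∈ Ioc 0 T := ⟨ht.1, ht.2.le⟩
  have hU := contDiffOn_scaledSol hu
  have hW := contDiffOn_slabCor hU
  have hw := contDiffOn_correction hu
  have hr := cbrt_pos ht.1
  have h3 := cbrt_pow_three ht.1
  have hcd := hasDerivAt_cbrt_inv ht.1
  have hdt := slabDt_rescale hW hw ht hcd hcd x
  have hWt := slabDt_slabCor hU ht (slabDt_scaledSol hu ht) ((cbrt t)⁻¹ * x)
  have hhom := (isProfile_scaledSol hu ht' hb hpos hle).homological ((cbrt t)⁻¹ * x)
  change slabRem T (scaledSol u) (t, (cbrt t)⁻¹ * x) = scaledSol u (t, (cbrt t)⁻¹ * x) ^ 2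
    + (slabCor T (scaledSol u) (t, (cbrt t)⁻¹ * x) + (cbrt t)⁻¹ * x
      * deriv (fun y => slabCor T (scaledSol u) (t, y)) ((cbrt t)⁻¹ * x)) / 3 - _
    - iteratedDeriv 3 (fun y => slabCor T (scaledSol u) (t, y)) ((cbrt t)⁻¹ * x)
    + 6 * scaledSol u (t, (cbrt t)⁻¹ * x)
      * deriv (fun y => slabCor T (scaledSol u) (t, y)) ((cbrt t)⁻¹ * x) at hhom
  rw [← hWt, ← congrFun (slabDx_eq_deriv hW ht')] at hhom
  have hdx : slabDx T (correction T u) (t, x)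
      = (cbrt t)⁻¹ * (cbrt t)⁻¹ * slabDx T (slabCor T (scaledSol u)) (t, (cbrt t)⁻¹ * x) := by
    have h := congrFun (slabDx_eq_deriv hw ht') x
    have h1 := iteratedDeriv_rescale (α := fun s => (cbrt s)⁻¹) (β := fun s => (cbrt s)⁻¹)
      hW ht' 1 x
    rw [iteratedDeriv_one, iteratedDeriv_one, ← slabDx_eq_deriv hW ht', pow_one] at h1
    exact h.trans h1
  have hdx3 : slabDx T (slabDx T (slabDx T (correction T u))) (t, x)
      = (cbrt t)⁻¹ * (cbrt t)⁻¹ ^ 3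
        * iteratedDeriv 3 (fun y => slabCor T (scaledSol u) (t, y)) ((cbrt t)⁻¹ * x) :=
    (slabDx_three_eq hw ht' x).trans (iteratedDeriv_rescale hW ht' 3 x)
  have hsol : u t x = (cbrt t)⁻¹ ^ 2 * scaledSol u (t, (cbrt t)⁻¹ * x) := by
    simp only [scaledSol, rescale]
    rw [mul_inv_cancel_left₀ hr.ne', ← mul_assoc, ← mul_pow, inv_mul_cancel₀ hr.ne', one_pow,
      one_mul]
  have hrem : remainder T u (t, x)
    = (cbrt t)⁻¹ ^ 4 * slabRem T (scaledSol u) (t, (cbrt t)⁻¹ * x) := rfl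
  change slabDt T (correction T u) (t, x) = _ at hdt
  rw [hdt, hdx, hdx3, hsol, hrem, hhom]
  generalize scaledSol u (t, (cbrt t)⁻¹ * x) = a,
    slabCor T (scaledSol u) (t, (cbrt t)⁻¹ * x) = b,
    iteratedDeriv 3 (fun y => slabCor T (scaledSol u) (t, y)) ((cbrt t)⁻¹ * x) = c,
    slabDx T (slabCor T (scaledSol u)) (t, (cbrt t)⁻¹ * x) = d,
    slabDt T (slabCor T (scaledSol u)) (t, (cbrt t)⁻¹ * x) = e
  generalize cbrt t = r at h3 hr ⊢
  subst h3
  field_simp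
  ring

/-- The decomposition of `u²`, including the final time. -/
theorem sq_eq_correction_add_remainder (hu : IsKdVOn (Ioc 0 T) u) {M ε : ℝ}
    (hb : ∀ t ∈ Ioc 0 T, Bootstrap M ε t (u t)) (hpos : 0 < M * ε)
    (hle : ∀ t ∈ Ioc 0 T, M * ε * cbrt t ≤ 1) (ht : t ∈ Ioc 0 T) (x : ℝ) :
    u t x ^ 2 = slabDt T (correction T u) (t, x)
      + slabDx T (slabDx T (slabDx T (correction T u))) (t, x)
      - 6 * u t x * slabDx T (correction T u) (t, x) + remainder T u (t, x) := by
  have hw := contDiffOn_correction hu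
  have hw1 := contDiffOn_slabDx hw
  have hL := (hu.1.pow 2).continuousOn
  have hR := ((((contDiffOn_slabDt hw).add (contDiffOn_slabDx (contDiffOn_slabDx hw1))).sub
    (((contDiffOn_const (c := (6 : ℝ))).mul hu.1).mul hw1)).add
    (contDiffOn_remainder hu)).continuousOn
  have heq : EqOn _ _ (Ioo 0 T ×ˢ univ : Set (ℝ × ℝ)) := fun p hp =>
    have hp' : p.1 ∈ Ioc 0 T := ⟨hp.1.1, hp.1.2.le⟩
    sq_eq_correction_add_remainder_of_lt hu hp.1 (hb _ hp') (mul_pos hpos (cbrt_pos hp.1.1))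
      (hle _ hp') p.2
  have hsub : slab T ⊆ closure (Ioo 0 T ×ˢ univ) := by
    rw [closure_prod_eq, closure_Ioo (ht.1.trans_le ht.2).ne, closure_univ]
    exact prod_mono Ioc_subset_Icc_self Subset.rfl
  exact heq.of_subset_closure hL hR (prod_mono Ioo_subset_Ioc_self Subset.rfl) hsub
    (mem_slab.2 ht)

end correction

section extendLinear

/-- Extension of a function on `(0, T] × ℝ` past time `T`, affine in time. -/
def extendLinear (T : ℝ) (F : ℝ × ℝ → ℝ) (s x : ℝ) : ℝ :=
  if s ≤ T then F (s, x) else F (T, x) + (s - T) * slabDt T F (T, x)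

variable {T t : ℝ} {F : ℝ × ℝ → ℝ}

theorem extendLinear_eq (ht : t ≤ T) : extendLinear T F t = fun x => F (t, x) :=
  funext fun _ => if_pos ht

theorem deriv_extendLinear (hF : ContDiffOn ℝ (⊤ : ℕ∞) F (slab T)) (ht : t ∈ Ioc 0 T) (x : ℝ) :
    deriv (fun s => extendLinear T F s x) t = slabDt T F (t, x) := by
  refine HasDerivAt.deriv ?_
  have hl : HasDerivWithinAt (fun s => extendLinear T F s x) (slabDt T F (t, x)) (Ioc 0 T) t :=
    (hasDerivWithinAt_slabDt hF ht x).congr (fun s hs => if_pos hs.2) (if_pos ht.2)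
  rcases ht.2.lt_or_eq with h | rfl
  · exact hl.hasDerivAt (Ioc_mem_nhds ht.1 h)
  · have hr : HasDerivWithinAt (fun s => extendLinear t F s x) (slabDt t F (t, x)) (Ici t) t := by
      have h1 := ((((hasDerivAt_id t).sub_const t).mul_const
        (slabDt t F (t, x))).const_add (F (t, x))).hasDerivWithinAt (s := Ici t)
      rw [one_mul] at h1
      refine h1.congr (fun s hs => ?_) (by simp [extendLinear])
      rcases (mem_Ici.1 hs).eq_or_lt with rfl | hlt
      · simp [extendLinear]
      · simp [extendLinear, hlt.not_ge]
    refine (hl.union hr).hasDerivAt ?_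
    rw [Ioc_union_Ici_eq_Ioi ht.1]
    exact Ioi_mem_nhds ht.1

end extendLinear

/-- Decomposition of the source term `u²` as `P_{lin}w₁ + f₁` where `P_{lin}`
is the linear part of the adjoint linearized KdV equation. -/
theorem u_squared_decomposition :
    ∀ M : ℝ, 1 ≤ M → ∃ c C : ℝ, 0 < c ∧ 0 < C ∧
      ∀ ε : ℝ, 0 < ε → ∀ T : ℝ, 0 < T → T ≤ c * ε ^ (-(3:ℝ)) →
      ∀ u : ℝ → ℝ → ℝ, IsKdVOn (Set.Ioc 0 T) u →
        (∀ t ∈ Set.Ioc (0:ℝ) T,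
          BesovEpsNorm ε (u t) ≤ ε ∧ Bootstrap M ε t (u t) ∧
          HsNorm ((1:ℝ)/2) (LNL t (u t)) ≤ M * ε) →
        ∃ w₁ f₁ : ℝ → ℝ → ℝ,
          ContDiffOn ℝ (⊤ : ℕ∞) (fun p : ℝ × ℝ => w₁ p.1 p.2)
            (Set.Ioc 0 T ×ˢ (Set.univ : Set ℝ)) ∧
          ContDiffOn ℝ (⊤ : ℕ∞) (fun p : ℝ × ℝ => f₁ p.1 p.2)
            (Set.Ioc 0 T ×ˢ (Set.univ : Set ℝ)) ∧
          (∀ t ∈ Set.Ioc (0:ℝ) T,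
            (∃ g : 𝓢(ℝ, ℝ), ∀ x, w₁ t x = g x) ∧
            (∃ g : 𝓢(ℝ, ℝ), ∀ x, f₁ t x = g x)) ∧
          (∀ t ∈ Set.Ioc (0:ℝ) T, ∀ x : ℝ,
            u t x ^ 2 = deriv (fun s => w₁ s x) t + iteratedDeriv 3 (w₁ t) x
              - 6 * u t x * deriv (w₁ t) x + f₁ t x) ∧
          (∀ t ∈ Set.Ioc (0:ℝ) T,
            HsNorm ((1:ℝ)/2) (w₁ t) ≤ C * ε * (ε * t ^ ((1:ℝ)/3)) ^ ((1:ℝ)/2) ∧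
            HsNorm ((1:ℝ)/2) (f₁ t) ≤ C * ε * t⁻¹ * (ε * t ^ ((1:ℝ)/3)) ^ ((1:ℝ)/2)) := by
  obtain ⟨C₀, hC₀, hmain⟩ := exists_HsNorm_bound
  intro M hM
  have hM0 : 0 < M := one_pos.trans_le hM
  refine ⟨M⁻¹ ^ 3, C₀ * M ^ 2, by positivity, by positivity, fun ε hε T hT hTle u hu hall => ?_⟩
  have hpos : 0 < M * ε := by positivity
  have hle : ∀ t ∈ Ioc 0 T, M * ε * cbrt t ≤ 1 := by
    intro t ht
    have hr := cbrt_pos ht.1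
    refine (pow_le_one_iff_of_nonneg (by positivity) three_ne_zero).1 ?_
    rw [mul_pow, cbrt_pow_three ht.1]
    have h1 : t ≤ M⁻¹ ^ 3 * (ε ^ 3)⁻¹ := by
      rw [← Real.rpow_natCast ε 3, ← Real.rpow_neg hε.le]
      exact_mod_cast ht.2.trans hTle
    calc (M * ε) ^ 3 * t ≤ (M * ε) ^ 3 * (M⁻¹ ^ 3 * (ε ^ 3)⁻¹) := by gcongr
      _ = 1 := by field_simp
  have hw := contDiffOn_correction hu
  refine ⟨extendLinear T (correction T u), fun s x => remainder T u (s, x),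
    hw.congr fun p hp => if_pos hp.1.2, contDiffOn_remainder hu, fun t ht => ⟨?_, ?_⟩,
    fun t ht x => ?_, fun t ht => ?_⟩
  · rw [extendLinear_eq ht.2]
    exact isSchwartz_correction hu ht
  · exact isSchwartz_remainder hu ht
  · rw [deriv_extendLinear hw ht, extendLinear_eq ht.2, ← slabDx_three_eq hw ht,
      ← slabDx_eq_deriv hw ht]
    exact sq_eq_correction_add_remainder hu (fun t ht => (hall t ht).2.1) hpos hle ht x
  · have hr := cbrt_pos ht.1
    have hU := contDiffOn_scaledSol hu
    have hS := isSchwartz_scaledSol hu ht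
    have hδ : 0 < M * ε * cbrt t := by positivity
    have hZ : HsNorm (1 / 2) (fun y => scaledField T (scaledSol u) (t, y)) ≤ M * ε * cbrt t := by
      rw [HsNorm_scaledField hu ht, mul_comm]
      gcongr
      exact (hall t ht).2.2
    obtain ⟨h1, h2⟩ := hmain (isProfile_scaledSol hu ht (hall t ht).2.1 hδ (hle t ht)) hS
      (isSchwartz_slabDx hU ht hS) (isSchwartz_scaledField hU ht hS) hZ
    have hsmall : ε * cbrt t ≤ (ε * cbrt t) ^ (1 / 2 : ℝ) := by
      refine Real.self_le_rpow_of_le_one (by positivity) ?_ (by norm_num)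
      refine le_trans ?_ (hle t ht)
      gcongr
      exact le_mul_of_one_le_left hε.le hM
    change _ ≤ _ * (ε * cbrt t) ^ (1 / 2 : ℝ) ∧ _ ≤ _ * (ε * cbrt t) ^ (1 / 2 : ℝ)
    rw [extendLinear_eq ht.2, HsNorm_correction hu ht, HsNorm_remainder hu ht]
    constructor
    · calc _ ≤ (cbrt t)⁻¹ * (C₀ * (M * ε * cbrt t) ^ 2) := by gcongr; exact h1
        _ = C₀ * M ^ 2 * ε * (ε * cbrt t) := by field_simp
        _ ≤ _ := by gcongr
    · calc _ ≤ (cbrt t)⁻¹ ^ 4 * (C₀ * (M * ε * cbrt t) ^ 2) := by gcongr; exact h2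
        _ = C₀ * M ^ 2 * ε * (cbrt t ^ 3)⁻¹ * (ε * cbrt t) := by field_simp
        _ = C₀ * M ^ 2 * ε * t⁻¹ * (ε * cbrt t) := by rw [cbrt_pow_three ht.1]
        _ ≤ _ := by
          have := ht.1
          gcongr
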